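/- arXiv:2003.04051 — 4 statements merged into one kernel-verified Lean document; each statement's English description precedes it below -/
import Mathlib

section
/- For every nonnegative finite Borel measure μ ≠ 0 on ℝ³ and every smooth compactly supported φ : ℝ³ → ℂ², one has ∫_{ℝ³} ‖(σ·∇φ)(x)‖²/V_μ(x) dx ≥ (16π²/(π²+4)²) · μ(ℝ³)⁻² · ∫_{ℝ³} V_μ(x)‖φ(x)‖² dx, where the left-hand integrand is interpreted as 0 at points where V_μ(x) = +∞. (The constant 16π²/(π²+4)² equals (2/(π/2+2/π))², the square of the lower bound the paper proves for the best Hardy constant ν₁.) -/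
open MeasureTheory Real

/-- The Coulomb potential generated by a measure `μ` on `ℝ³` (real-valued:
`0` where the defining extended-real integral is infinite). -/
noncomputable def coulomb (μ : Measure (EuclideanSpace ℝ (Fin 3)))
    (x : EuclideanSpace ℝ (Fin 3)) : ℝ :=
  (∫⁻ y, ENNReal.ofReal ‖x - y‖⁻¹ ∂μ).toReal

/-- The Pauli matrices. -/
noncomputable def pauli : Fin 3 → Matrix (Fin 2) (Fin 2) ℂ :=
  ![!![0, 1; 1, 0], !![0, -Complex.I; Complex.I, 0], !![1, 0; 0, -1]]

/-- `(σ·∇φ)(x) = ∑ⱼ σⱼ (∂ⱼφ)(x)` for `φ : ℝ³ → ℂ²`. -/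
noncomputable def pauliDeriv
    (φ : EuclideanSpace ℝ (Fin 3) → EuclideanSpace ℂ (Fin 2))
    (x : EuclideanSpace ℝ (Fin 3)) : EuclideanSpace ℂ (Fin 2) :=
  ∑ j : Fin 3, (WithLp.equiv 2 (Fin 2 → ℂ)).symm
    ((pauli j).mulVec (WithLp.equiv 2 (Fin 2 → ℂ)
      (fderiv ℝ φ x (EuclideanSpace.single j 1))))

section SphericalForm

set_option linter.unusedSectionVars false

variable {X : Type*} [TopologicalSpace X] [CompactSpace X] [SecondCountableTopology X]
  [MeasurableSpace X] [BorelSpace X]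
  {H : Type*} [NormedAddCommGroup H] [InnerProductSpace ℝ H] [CompleteSpace H]
  [SecondCountableTopology H]

lemma Continuous.integrable_of_compactSpace {Y F : Type*} [TopologicalSpace Y] [CompactSpace Y]
    [MeasurableSpace Y] [OpensMeasurableSpace Y] [NormedAddCommGroup F]
    [SecondCountableTopologyEither Y F]
    {ν : Measure Y} [IsFiniteMeasure ν] {f : Y → F} (hf : Continuous f) : Integrable f ν := by
  refine hf.integrable_of_hasCompactSupport (HasCompactSupport.of_compactSpace f)

/-- The form `∬ k(ω,η) (⟪h ω, f η⟫ + ⟪S h ω, S f η⟫)` attached to a kernel `k` and a field `S` of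
operators. -/
noncomputable def twistedForm (σ : Measure X) (k : X × X → ℝ) (S : X → H →L[ℝ] H)
    (h f : X → H) : ℝ :=
  ∫ p : X × X, k p * (inner ℝ (h p.1) (f p.2) +
    inner ℝ (S p.1 (h p.1)) (S p.2 (f p.2))) ∂(σ.prod σ)

variable {σ : Measure X} [IsFiniteMeasure σ] {k : X × X → ℝ} {S : X → H →L[ℝ] H}

lemma twistedForm_integrable (hk : Continuous k) (hS : Continuous S) {h f : X → H}
    (hh : Continuous h) (hf : Continuous f) :
    Integrable (fun p : X × X => k p * (inner ℝ (h p.1) (f p.2) +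
      inner ℝ (S p.1 (h p.1)) (S p.2 (f p.2)))) (σ.prod σ) := by
  apply Continuous.integrable_of_compactSpace
  fun_prop

lemma twistedForm_add_left (hk : Continuous k) (hS : Continuous S) {h h' f : X → H}
    (hh : Continuous h) (hh' : Continuous h') (hf : Continuous f) :
    twistedForm σ k S (fun x => h x + h' x) f =
      twistedForm σ k S h f + twistedForm σ k S h' f := by
  unfold twistedForm
  rw [← integral_add (twistedForm_integrable hk hS hh hf) (twistedForm_integrable hk hS hh' hf)]
  congr 1 with p
  simp only [map_add, inner_add_left]
  ring

lemma twistedForm_symm (hsymm : ∀ x y, k (x, y) = k (y, x)) (h f : X → H) :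
    twistedForm σ k S h f = twistedForm σ k S f h := by
  unfold twistedForm
  rw [← integral_prod_swap]
  congr 1 with p
  rw [← real_inner_comm, ← real_inner_comm (S _ _)]
  simp only [Prod.fst_swap, Prod.snd_swap]
  rw [Prod.swap, hsymm]

lemma twistedForm_add_right (hk : Continuous k) (hsymm : ∀ x y, k (x, y) = k (y, x))
    (hS : Continuous S) {h f f' : X → H}
    (hh : Continuous h) (hf : Continuous f) (hf' : Continuous f') :
    twistedForm σ k S h (fun x => f x + f' x) =
      twistedForm σ k S h f + twistedForm σ k S h f' := by
  rw [twistedForm_symm hsymm, twistedForm_add_left hk hS hf hf' hh, twistedForm_symm hsymm,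
    twistedForm_symm hsymm f']

lemma twistedForm_sub_const (hk : Continuous k) (hS : Continuous S) (c : ℝ) {h f : X → H}
    (hh : Continuous h) (hf : Continuous f) (hf0 : ∫ y, f y ∂σ = 0) (hf1 : ∫ y, S y (f y) ∂σ = 0) :
    twistedForm σ (fun p => k p - c) S h f = twistedForm σ k S h f := by
  have hc := twistedForm_integrable (σ := σ) (k := fun _ => c) continuous_const hS hh hf
  have : ∫ p : X × X, c * (inner ℝ (h p.1) (f p.2) +
      inner ℝ (S p.1 (h p.1)) (S p.2 (f p.2))) ∂(σ.prod σ) = 0 := by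
    rw [integral_prod _ hc]
    refine integral_eq_zero_of_ae (.of_forall fun x => ?_)
    have i0 : Integrable f σ := hf.integrable_of_compactSpace
    have i1 : Integrable (fun y => S y (f y)) σ :=
      Continuous.integrable_of_compactSpace (by fun_prop)
    simp only [Pi.zero_apply]
    rw [integral_const_mul, integral_add (i0.const_inner _) (i1.const_inner _), integral_inner i0,
      integral_inner i1, hf0, hf1]
    simp
  unfold twistedForm
  simp only [sub_mul]
  rw [integral_sub (twistedForm_integrable hk hS hh hf) hc, this, sub_zero]

lemma twistedForm_eigen (hk : Continuous k) (hS : Continuous S)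
    (hSS : ∀ x u, S x (S x u) = u) (hSsymm : ∀ x u v, inner ℝ (S x u) v = inner ℝ u (S x v))
    {κ₀ κ₁ : ℝ} (h₀ : ∀ x, ∫ y, k (x, y) ∂σ = κ₀)
    (h₁ : ∀ x u, ∫ y, k (x, y) • S y u ∂σ = κ₁ • S x u) {h : X → H} (hh : Continuous h)
    (v₀ v₁ : H) :
    twistedForm σ k S h (fun x => v₀ + S x v₁) =
      (κ₀ + κ₁) * ∫ x, inner ℝ (h x) (v₀ + S x v₁) ∂σ := by
  have hb : Continuous fun x => v₀ + S x v₁ := by fun_prop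
  unfold twistedForm
  rw [integral_prod _ (twistedForm_integrable hk hS hh hb), ← integral_const_mul]
  congr 1 with x
  have e : ∀ y, k (x, y) * (inner ℝ (h x) (v₀ + S y v₁) +
      inner ℝ (S x (h x)) (S y (v₀ + S y v₁))) =
      k (x, y) * (inner ℝ (h x) v₀ + inner ℝ (S x (h x)) v₁) +
      (inner ℝ (h x) (k (x, y) • S y v₁) + inner ℝ (S x (h x)) (k (x, y) • S y v₀)) := by
    intro y
    simp only [map_add, hSS, inner_add_right, inner_smul_right]
    ring
  have ik : ∀ u, Integrable (fun y => k (x, y) • S y u) σ := fun u =>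
    Continuous.integrable_of_compactSpace (by fun_prop)
  have ik0 : Integrable (fun y => k (x, y)) σ :=
    Continuous.integrable_of_compactSpace (by fun_prop)
  simp only [e]
  have ik1 : Integrable (fun y => inner ℝ (h x) (k (x, y) • S y v₁) +
      inner ℝ (S x (h x)) (k (x, y) • S y v₀)) σ :=
    ((ik _).const_inner _).add ((ik _).const_inner _)
  rw [integral_add (ik0.mul_const _) ik1,
    integral_add ((ik _).const_inner _) ((ik _).const_inner _), integral_inner (ik _),
    integral_inner (ik _), h₁, h₁, integral_mul_const, h₀]
  simp only [inner_smul_right, inner_add_right, hSsymm, hSS, map_smul]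
  ring

lemma twistedForm_le_of_nonneg (hk : Continuous k) (hk0 : ∀ p, 0 ≤ k p) (hS : Continuous S)
    (hsymm : ∀ x y, k (x, y) = k (y, x))
    (hSn : ∀ x u, ‖S x u‖ = ‖u‖) {κ₀ : ℝ} (h₀ : ∀ x, ∫ y, k (x, y) ∂σ = κ₀)
    {h f : X → H} (hh : Continuous h) (hf : Continuous f) :
    twistedForm σ k S h f ≤ κ₀ * (∫ x, ‖h x‖ ^ 2 ∂σ + ∫ x, ‖f x‖ ^ 2 ∂σ) := by
  have key : ∀ g : X → H, Continuous g →
      ∫ p : X × X, k p * ‖g p.1‖ ^ 2 ∂(σ.prod σ) = κ₀ * ∫ x, ‖g x‖ ^ 2 ∂σ := by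
    intro g hg
    rw [integral_prod _ (Continuous.integrable_of_compactSpace (by fun_prop)),
      ← integral_const_mul]
    congr 1 with x
    simp only
    rw [integral_mul_const, h₀]
  have key' : ∀ g : X → H, Continuous g →
      ∫ p : X × X, k p * ‖g p.2‖ ^ 2 ∂(σ.prod σ) = κ₀ * ∫ x, ‖g x‖ ^ 2 ∂σ := by
    intro g hg
    rw [← key g hg, ← integral_prod_swap]
    congr 1 with p
    rw [Prod.swap, hsymm]
  have i1 : Integrable (fun p : X × X => k p * ‖h p.1‖ ^ 2) (σ.prod σ) :=
    Continuous.integrable_of_compactSpace (by fun_prop)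
  have i2 : Integrable (fun p : X × X => k p * ‖f p.2‖ ^ 2) (σ.prod σ) :=
    Continuous.integrable_of_compactSpace (by fun_prop)
  rw [mul_add, ← key h hh, ← key' f hf, ← integral_add i1 i2]
  refine integral_mono (twistedForm_integrable hk hS hh hf) (i1.add i2) fun p => ?_
  simp only
  rw [← mul_add]
  refine mul_le_mul_of_nonneg_left ?_ (hk0 p)
  have a1 := real_inner_le_norm (h p.1) (f p.2)
  have a2 := real_inner_le_norm (S p.1 (h p.1)) (S p.2 (f p.2))
  rw [hSn, hSn] at a2
  nlinarith [sq_nonneg (‖h p.1‖ - ‖f p.2‖)]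

/-- A function splits orthogonally into its component in the span of the constants and of the
fields `S v`, and a remainder. -/
lemma exists_twisted_decomposition (hS : Continuous S) (hσ : σ ≠ 0)
    (hSS : ∀ x u, S x (S x u) = u) (hS0 : ∀ u, ∫ y, S y u ∂σ = 0) {f : X → H} (hf : Continuous f) :
    ∃ v₀ v₁ : H, ∃ f' : X → H, Continuous f' ∧ (∀ x, f x = (v₀ + S x v₁) + f' x) ∧
      ∫ x, f' x ∂σ = 0 ∧ ∫ x, S x (f' x) ∂σ = 0 := by
  have hm : σ.real Set.univ ≠ 0 := by
    simpa [measureReal_def, ENNReal.toReal_eq_zero_iff] using hσ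
  set m := σ.real Set.univ
  have i0 : Integrable f σ := hf.integrable_of_compactSpace
  have i1 : Integrable (fun y => S y (f y)) σ :=
    Continuous.integrable_of_compactSpace (by fun_prop)
  have iS : ∀ u, Integrable (fun y => S y u) σ := fun u =>
    Continuous.integrable_of_compactSpace (by fun_prop)
  set v₀ := m⁻¹ • ∫ x, f x ∂σ with hv₀
  set v₁ := m⁻¹ • ∫ x, S x (f x) ∂σ with hv₁
  refine ⟨v₀, v₁, fun x => f x - (v₀ + S x v₁), by fun_prop,
    fun x => (add_sub_cancel _ _).symm, ?_, ?_⟩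
  · have : ∫ x, (v₀ + S x v₁) ∂σ = m • v₀ := by
      rw [integral_add (integrable_const _) (iS _), hS0]; simp [m]
    have i2 : Integrable (fun x => v₀ + S x v₁) σ := (integrable_const _).add (iS _)
    rw [integral_sub i0 i2, this, hv₀, smul_inv_smul₀ hm, sub_self]
  · have : ∫ x, (S x v₀ + v₁) ∂σ = m • v₁ := by
      rw [integral_add (iS _) (integrable_const _), hS0]; simp [m]
    simp only [map_sub, map_add, hSS]
    have i2 : Integrable (fun x => S x v₀ + v₁) σ := (iS _).add (integrable_const _)
    rw [integral_sub i1 i2, this, hv₁, smul_inv_smul₀ hm, sub_self]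

lemma integral_inner_twisted_eq_zero (hS : Continuous S)
    (hSsymm : ∀ x u v, inner ℝ (S x u) v = inner ℝ u (S x v)) {f : X → H} (hf : Continuous f)
    (hf0 : ∫ y, f y ∂σ = 0) (hf1 : ∫ y, S y (f y) ∂σ = 0) (v₀ v₁ : H) :
    ∫ x, inner ℝ (v₀ + S x v₁) (f x) ∂σ = 0 := by
  have i0 : Integrable f σ := hf.integrable_of_compactSpace
  have i1 : Integrable (fun y => S y (f y)) σ :=
    Continuous.integrable_of_compactSpace (by fun_prop)
  simp only [inner_add_left, hSsymm]
  rw [integral_add (i0.const_inner _) (i1.const_inner _), integral_inner i0,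
      integral_inner i1, hf0, hf1]
  simp

/-- Bound for the twisted form by its lowest angular momentum channel. -/
theorem twistedForm_le (hk : Continuous k) (hS : Continuous S) (hσ : σ ≠ 0)
    (hsymm : ∀ x y, k (x, y) = k (y, x))
    (hSS : ∀ x u, S x (S x u) = u) (hSsymm : ∀ x u v, inner ℝ (S x u) v = inner ℝ u (S x v))
    (hS0 : ∀ u, ∫ y, S y u ∂σ = 0)
    {κ₀ κ₁ c : ℝ} (h₀ : ∀ x, ∫ y, k (x, y) ∂σ = κ₀)
    (h₁ : ∀ x u, ∫ y, k (x, y) • S y u ∂σ = κ₁ • S x u)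
    (hc : ∀ p, c ≤ k p) (hκ : 2 * (κ₀ - c * σ.real Set.univ) ≤ κ₀ + κ₁) {h f : X → H}
    (hh : Continuous h) (hf : Continuous f) :
    twistedForm σ k S h f ≤ (κ₀ + κ₁) / 2 * (∫ x, ‖h x‖ ^ 2 ∂σ + ∫ x, ‖f x‖ ^ 2 ∂σ) := by
  have hSn : ∀ x u, ‖S x u‖ = ‖u‖ := by
    intro x u
    have : ‖S x u‖ ^ 2 = ‖u‖ ^ 2 := by
      rw [← real_inner_self_eq_norm_sq, hSsymm, hSS, real_inner_self_eq_norm_sq]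
    exact (sq_eq_sq₀ (norm_nonneg _) (norm_nonneg _)).1 this
  have ortho : ∀ {g g' : X → H} {u₀ u₁ : H}, Continuous g' →
      (∀ x, g x = (u₀ + S x u₁) + g' x) → ∫ x, g' x ∂σ = 0 → ∫ x, S x (g' x) ∂σ = 0 →
      ∫ x, ‖g x‖ ^ 2 ∂σ = ∫ x, ‖u₀ + S x u₁‖ ^ 2 ∂σ + ∫ x, ‖g' x‖ ^ 2 ∂σ := by
    intro g g' u₀ u₁ hg' hg hg0 hg1
    have e : ∀ x, ‖g x‖ ^ 2 = ‖u₀ + S x u₁‖ ^ 2 + 2 * inner ℝ (u₀ + S x u₁) (g' x) + ‖g' x‖ ^ 2 :=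
      fun x => by rw [hg, norm_add_sq_real]
    simp only [e]
    rw [integral_add, integral_add, integral_const_mul,
      integral_inner_twisted_eq_zero hS hSsymm hg' hg0 hg1, mul_zero, add_zero]
    all_goals exact Continuous.integrable_of_compactSpace (by fun_prop)
  obtain ⟨a₀, a₁, h', hh', eh, hh0, hh1⟩ := exists_twisted_decomposition hS hσ hSS hS0 hh
  obtain ⟨b₀, b₁, f', hf', ef, hf0, hf1⟩ := exists_twisted_decomposition hS hσ hSS hS0 hf
  have ca : Continuous fun x => a₀ + S x a₁ := by fun_prop
  have cb : Continuous fun x => b₀ + S x b₁ := by fun_prop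
  rw [ortho hh' eh hh0 hh1, ortho hf' ef hf0 hf1]
  have eh' : h = fun x => (a₀ + S x a₁) + h' x := funext eh
  have ef' : f = fun x => (b₀ + S x b₁) + f' x := funext ef
  have comm : ∀ (g g' : X → H), ∫ x, inner ℝ (g x) (g' x) ∂σ = ∫ x, inner ℝ (g' x) (g x) ∂σ :=
    fun g g' => by congr 1 with x; exact real_inner_comm _ _
  have z1 : twistedForm σ k S (fun x => a₀ + S x a₁) f' = 0 := by
    rw [twistedForm_symm hsymm, twistedForm_eigen hk hS hSS hSsymm h₀ h₁ hf']
    rw [comm, integral_inner_twisted_eq_zero hS hSsymm hf' hf0 hf1, mul_zero]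
  have z2 : twistedForm σ k S h' (fun x => b₀ + S x b₁) = 0 := by
    rw [twistedForm_eigen hk hS hSS hSsymm h₀ h₁ hh']
    rw [comm, integral_inner_twisted_eq_zero hS hSsymm hh' hh0 hh1, mul_zero]
  have cf : Continuous fun x => (b₀ + S x b₁) + f' x := cb.add hf'
  rw [eh', ef', twistedForm_add_left hk hS ca hh' cf,
    twistedForm_add_right hk hsymm hS ca cb hf', twistedForm_add_right hk hsymm hS hh' cb hf',
    z1, z2, twistedForm_eigen hk hS hSS hSsymm h₀ h₁ ca]
  have hpos : 0 ≤ κ₀ + κ₁ := by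
    refine le_trans ?_ hκ
    obtain ⟨x⟩ : Nonempty X := by
      by_contra hX
      rw [not_nonempty_iff] at hX
      exact hσ (Measure.eq_zero_of_isEmpty σ)
    have : 0 ≤ ∫ y, (k (x, y) - c) ∂σ := integral_nonneg fun y => sub_nonneg.2 (hc _)
    rw [integral_sub (Continuous.integrable_of_compactSpace (by fun_prop)) (integrable_const _),
      h₀] at this
    simp at this
    linarith
  have p1 : ∫ x, inner ℝ (a₀ + S x a₁) (b₀ + S x b₁) ∂σ ≤
      1 / 2 * (∫ x, ‖a₀ + S x a₁‖ ^ 2 ∂σ + ∫ x, ‖b₀ + S x b₁‖ ^ 2 ∂σ) := by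
    rw [← integral_add, ← integral_const_mul]
    · refine integral_mono ?_ ?_ fun x => ?_
      · exact Continuous.integrable_of_compactSpace (by fun_prop)
      · exact Continuous.integrable_of_compactSpace (by fun_prop)
      · have := real_inner_le_norm (a₀ + S x a₁) (b₀ + S x b₁)
        simp only
        nlinarith [sq_nonneg (‖a₀ + S x a₁‖ - ‖b₀ + S x b₁‖)]
    all_goals exact Continuous.integrable_of_compactSpace (by fun_prop)
  have p2 : twistedForm σ k S h' f' ≤
      (κ₀ - c * σ.real Set.univ) * (∫ x, ‖h' x‖ ^ 2 ∂σ + ∫ x, ‖f' x‖ ^ 2 ∂σ) := by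
    rw [← twistedForm_sub_const hk hS c hh' hf' hf0 hf1]
    refine twistedForm_le_of_nonneg (k := fun p => k p - c) (by fun_prop) (fun p => sub_nonneg.2 (hc p)) hS
      (fun x y => by rw [hsymm]) hSn (fun x => ?_) hh' hf'
    rw [integral_sub (Continuous.integrable_of_compactSpace (by fun_prop)) (integrable_const _),
      h₀]
    simp [mul_comm]
  have p3 : 0 ≤ ∫ x, ‖h' x‖ ^ 2 ∂σ + ∫ x, ‖f' x‖ ^ 2 ∂σ := by positivity
  nlinarith [mul_le_mul_of_nonneg_left p1 hpos, mul_le_mul_of_nonneg_right hκ p3]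

end SphericalForm

section SphereInvariance

set_option linter.unusedSectionVars false

open Metric
open scoped Pointwise

variable {E : Type*} [NormedAddCommGroup E] [InnerProductSpace ℝ E] [FiniteDimensional ℝ E]
  [MeasurableSpace E] [BorelSpace E]

/-- The action of a linear isometry on the unit sphere. -/
def sphereMap (L : E ≃ₗᵢ[ℝ] E) (x : sphere (0 : E) 1) : sphere (0 : E) 1 :=
  ⟨L x, by simp⟩

lemma measurable_sphereMap (L : E ≃ₗᵢ[ℝ] E) : Measurable (sphereMap L) :=
  (L.continuous.measurable.comp measurable_subtype_coe).subtype_mk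

lemma map_sphereMap_toSphere (L : E ≃ₗᵢ[ℝ] E) :
    (volume : Measure E).toSphere.map (sphereMap L) = (volume : Measure E).toSphere := by
  ext s hs
  rw [Measure.map_apply (measurable_sphereMap L) hs, Measure.toSphere_apply' _ hs,
    Measure.toSphere_apply' _ (measurable_sphereMap L hs)]
  congr 1
  have : (Set.Ioo (0 : ℝ) 1 • (Subtype.val '' (sphereMap L ⁻¹' s)) : Set E) =
      L ⁻¹' (Set.Ioo (0 : ℝ) 1 • (Subtype.val '' s)) := by
    ext z
    simp only [Set.mem_smul, Set.mem_image, Set.mem_preimage]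
    constructor
    · rintro ⟨r, hr, _, ⟨x, hx, rfl⟩, rfl⟩
      exact ⟨r, hr, _, ⟨_, hx, rfl⟩, by simp [sphereMap]⟩
    · rintro ⟨r, hr, _, ⟨x, hx, rfl⟩, hz⟩
      refine ⟨r, hr, _, ⟨sphereMap L.symm x, ?_, rfl⟩, ?_⟩
      · simpa [sphereMap] using hx
      · apply L.injective
        simp [sphereMap, hz]
  rw [this]
  exact (L.measurePreserving.measure_preimage_emb L.toHomeomorph.measurableEmbedding _)

lemma measurableEmbedding_sphereMap (L : E ≃ₗᵢ[ℝ] E) : MeasurableEmbedding (sphereMap L) :=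
  (MeasurableEquiv.mk ⟨sphereMap L, sphereMap L.symm, fun x => by simp [sphereMap],
    fun x => by simp [sphereMap]⟩ (measurable_sphereMap L)
    (measurable_sphereMap L.symm)).measurableEmbedding

lemma integral_comp_sphereMap {F : Type*} [NormedAddCommGroup F] [NormedSpace ℝ F]
    (L : E ≃ₗᵢ[ℝ] E) (f : sphere (0 : E) 1 → F) :
    ∫ y, f (sphereMap L y) ∂(volume : Measure E).toSphere =
      ∫ y, f y ∂(volume : Measure E).toSphere := by
  conv_rhs => rw [← map_sphereMap_toSphere L, (measurableEmbedding_sphereMap L).integral_map]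

lemma integral_sphere_inner_eq {F : Type*} [NormedAddCommGroup F] [NormedSpace ℝ F]
    (f : ℝ → F) (x x' : sphere (0 : E) 1) :
    ∫ y, f (inner ℝ (x : E) (y : E)) ∂(volume : Measure E).toSphere =
      ∫ y, f (inner ℝ (x' : E) (y : E)) ∂(volume : Measure E).toSphere := by
  have h : ‖(x' : E)‖ = ‖(x : E)‖ := by simp
  set R := Submodule.reflection (Submodule.span ℝ {(x' : E) - x})ᗮ
  have hR : R x' = x := Submodule.reflection_sub h
  rw [← integral_comp_sphereMap R]
  congr 1 with y
  congr 1
  simp only [sphereMap]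
  rw [← hR, LinearIsometryEquiv.inner_map_map]

lemma integral_sphere_smul_self {k : ℝ → ℝ} (x : sphere (0 : E) 1)
    (hk : Continuous fun y : sphere (0 : E) 1 => k (inner ℝ (x : E) (y : E))) :
    ∫ y, k (inner ℝ (x : E) (y : E)) • (y : E) ∂(volume : Measure E).toSphere =
      (∫ y, k (inner ℝ (x : E) (y : E)) * inner ℝ (x : E) (y : E)
        ∂(volume : Measure E).toSphere) • (x : E) := by
  have hi : Integrable (fun y : sphere (0 : E) 1 => k (inner ℝ (x : E) (y : E)) • (y : E))
      (volume : Measure E).toSphere := (hk.smul continuous_subtype_val).integrable_of_compactSpace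
  set w := ∫ y, k (inner ℝ (x : E) (y : E)) • (y : E) ∂(volume : Measure E).toSphere
  have hw : ∀ u : E, inner ℝ u w = ∫ y, k (inner ℝ (x : E) (y : E)) * inner ℝ u (y : E)
      ∂(volume : Measure E).toSphere := by
    intro u
    rw [← integral_inner hi]
    simp only [inner_smul_right]
  rw [← hw]
  have hperp : ∀ u : E, inner ℝ u (x : E) = 0 → inner ℝ u w = 0 := by
    intro u hu
    set R := Submodule.reflection (Submodule.span ℝ {u})ᗮ
    have hRu : R u = -u := Submodule.reflection_orthogonalComplement_singleton_eq_neg u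
    have hRx : R x = x := Submodule.reflection_mem_subspace_eq_self
      (Submodule.mem_orthogonal_singleton_iff_inner_right.2 hu)
    have : inner ℝ u w = - inner ℝ u w := by
      conv_lhs => rw [hw, ← integral_comp_sphereMap R]
      rw [hw, ← integral_neg]
      congr 1 with y
      simp only [sphereMap]
      conv_lhs => rw [← hRx, LinearIsometryEquiv.inner_map_map, ← neg_neg u, ← hRu, inner_neg_left,
        LinearIsometryEquiv.inner_map_map]
      ring
    linarith
  have hx : inner ℝ (x : E) (x : E) = (1 : ℝ) := by
    rw [real_inner_self_eq_norm_sq]; simp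
  set u := w - inner ℝ (x : E) w • (x : E) with hu
  have h1 : inner ℝ u (x : E) = 0 := by
    rw [hu, inner_sub_left, inner_smul_left, hx, real_inner_comm]
    simp
  have h2 : inner ℝ u u = (0 : ℝ) := by
    conv_lhs => rw [hu, ← hu, inner_sub_right, inner_smul_right, hperp u h1, h1]
    simp
  exact sub_eq_zero.1 (inner_self_eq_zero.1 h2)

end SphereInvariance

section PauliVector

/-- Physical space. -/
local notation "E₃" => EuclideanSpace ℝ (Fin 3)
local notation "H₂" => EuclideanSpace ℂ (Fin 2)

/-- The matrix `σ·p`, as a real bilinear map in the vector `p` and the spinor. -/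
noncomputable def pauliVecLin : E₃ →ₗ[ℝ] H₂ →ₗ[ℝ] H₂ :=
  LinearMap.mk₂ ℝ (fun p u => !₂[(p 2 : ℂ) * u 0 + ((p 0 : ℂ) - Complex.I * p 1) * u 1,
      ((p 0 : ℂ) + Complex.I * p 1) * u 0 - (p 2 : ℂ) * u 1])
    (by intro p q u; ext i; fin_cases i <;> simp <;> ring)
    (by intro c p u; ext i; fin_cases i <;> simp <;> ring)
    (by intro p u v; ext i; fin_cases i <;> simp <;> ring)
    (by intro c p u; ext i; fin_cases i <;> simp <;> ring)

/-- The matrix `σ·p`, as a continuous real bilinear map. -/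
noncomputable def pauliVec : E₃ →L[ℝ] H₂ →L[ℝ] H₂ :=
  ((LinearMap.toContinuousLinearMap (𝕜 := ℝ) (E := H₂) (F' := H₂)).toLinearMap.comp
    pauliVecLin).toContinuousLinearMap

lemma pauliVec_apply (p : E₃) (u : H₂) :
    pauliVec p u = !₂[(p 2 : ℂ) * u 0 + ((p 0 : ℂ) - Complex.I * p 1) * u 1,
      ((p 0 : ℂ) + Complex.I * p 1) * u 0 - (p 2 : ℂ) * u 1] := rfl

lemma pauliVec_pauliVec (p : E₃) (u : H₂) : pauliVec p (pauliVec p u) = ‖p‖ ^ 2 • u := by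
  rw [EuclideanSpace.real_norm_sq_eq]
  have hI := Complex.I_mul_I
  ext i
  fin_cases i
  · simp [pauliVec_apply, Fin.sum_univ_three]
    linear_combination (-(p 1 : ℂ) ^ 2 * u 0) * hI
  · simp [pauliVec_apply, Fin.sum_univ_three]
    linear_combination (-(p 1 : ℂ) ^ 2 * u 1) * hI

lemma pauliVec_complex_smul (p : E₃) (z : ℂ) (u : H₂) : pauliVec p (z • u) = z • pauliVec p u := by
  ext i
  fin_cases i <;> simp [pauliVec_apply] <;> ring

lemma inner_pauliVec (p : E₃) (u v : H₂) :
    (inner ℝ (pauliVec p u) v : ℝ) = inner ℝ u (pauliVec p v) := by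
  simp [PiLp.inner_apply, pauliVec_apply, Fin.sum_univ_two, Complex.inner]
  ring

lemma pauliDeriv_eq (φ : E₃ → H₂) (x : E₃) :
    pauliDeriv φ x = ∑ j : Fin 3, pauliVec (EuclideanSpace.single j 1)
      (fderiv ℝ φ x (EuclideanSpace.single j 1)) := by
  unfold pauliDeriv
  refine Finset.sum_congr rfl fun j _ => ?_
  ext i
  fin_cases j <;> fin_cases i <;> simp [pauliVec_apply, pauli, dotProduct]

lemma norm_pauliVec (p : E₃) (u : H₂) : ‖pauliVec p u‖ = ‖p‖ * ‖u‖ := by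
  have : ‖pauliVec p u‖ ^ 2 = (‖p‖ * ‖u‖) ^ 2 := by
    rw [← real_inner_self_eq_norm_sq, inner_pauliVec, pauliVec_pauliVec, inner_smul_right,
      real_inner_self_eq_norm_sq, mul_pow]
  exact (sq_eq_sq₀ (norm_nonneg _) (by positivity)).1 this

end PauliVector

section SphericalCoordinates

open Set

/-- Physical space. -/
local notation "E₃" => EuclideanSpace ℝ (Fin 3)

lemma lintegral_cylindrical {F : ℝ × ℝ → ENNReal} (hF : Measurable F) :
    ∫⁻ q : E₃, F (q 0, √(q 1 ^ 2 + q 2 ^ 2)) =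
      ENNReal.ofReal (2 * π) *
        ∫⁻ p in (univ ×ˢ Ioi 0 : Set (ℝ × ℝ)), ENNReal.ofReal p.2 * F p := by
  have h1 := (volume_preserving_finTwoArrow ℝ)
  have h2 := (volume_preserving_piFinSuccAbove (fun _ : Fin 3 => ℝ) 0)
  have h3 := (PiLp.volume_preserving_ofLp (Fin 3))
  have h4 := ((MeasurePreserving.id (volume : Measure ℝ)).prod h1).comp (h2.comp h3)
  have e : ∀ q : E₃, F (q 0, √(q 1 ^ 2 + q 2 ^ 2)) =
      (fun z : ℝ × (ℝ × ℝ) => F (z.1, √(z.2.1 ^ 2 + z.2.2 ^ 2)))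
        ((Prod.map id (MeasurableEquiv.finTwoArrow) ∘
          (MeasurableEquiv.piFinSuccAbove (fun _ : Fin 3 => ℝ) 0) ∘ WithLp.ofLp) q) := by
    intro q
    rfl
  have hm : Measurable (fun z : ℝ × (ℝ × ℝ) => F (z.1, √(z.2.1 ^ 2 + z.2.2 ^ 2))) := by
    fun_prop
  simp_rw [e]
  rw [h4.lintegral_comp hm, lintegral_prod _ hm.aemeasurable, Measure.volume_eq_prod ℝ ℝ,
    ← Measure.prod_restrict,
    Measure.restrict_univ, lintegral_prod _ (by fun_prop), ← lintegral_const_mul _ (by fun_prop)]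
  refine lintegral_congr fun z => ?_
  rw [← Measure.volume_eq_prod ℝ ℝ, ← lintegral_comp_polarCoord_symm, polarCoord_target,
    Measure.volume_eq_prod ℝ ℝ,
    ← Measure.prod_restrict]
  have : ∀ᵐ p ∂((volume.restrict (Ioi (0 : ℝ))).prod (volume.restrict (Ioo (-π) π))),
      ENNReal.ofReal p.1 • F (z, √((polarCoord.symm p).1 ^ 2 + (polarCoord.symm p).2 ^ 2)) =
      ENNReal.ofReal p.1 * F (z, p.1) := by
    rw [Measure.prod_restrict]
    filter_upwards [ae_restrict_mem (measurableSet_Ioi.prod measurableSet_Ioo)] with p hp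
    have hp : 0 < p.1 := hp.1
    rw [polarCoord_symm_apply, smul_eq_mul]
    simp only [mul_pow]
    rw [← mul_add, cos_sq_add_sin_sq, mul_one, sqrt_sq hp.le]
  rw [lintegral_congr_ae this, lintegral_prod _ (by fun_prop)]
  simp only [lintegral_const, MeasurableSet.univ, Measure.restrict_apply, univ_inter, volume_Ioo]
  rw [lintegral_mul_const _ (by fun_prop), mul_comm]
  ring_nf

lemma lintegral_half_plane {F : ℝ × ℝ → ENNReal} (hF : Measurable F) :
    ∫⁻ p in (univ ×ˢ Ioi 0 : Set (ℝ × ℝ)), F p =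
      ∫⁻ θ in Ioo 0 π, ∫⁻ s in Ioi 0, ENNReal.ofReal s * F (s * cos θ, s * sin θ) := by
  have hms : MeasurableSet (univ ×ˢ Ioi 0 : Set (ℝ × ℝ)) := MeasurableSet.univ.prod measurableSet_Ioi
  have hms' : MeasurableSet (Ioi 0 ×ˢ Ioo 0 π : Set (ℝ × ℝ)) :=
    measurableSet_Ioi.prod measurableSet_Ioo
  rw [← lintegral_indicator hms, ← lintegral_comp_polarCoord_symm, polarCoord_target]
  have hsub : (Ioi 0 ×ˢ Ioo 0 π : Set (ℝ × ℝ)) ⊆ Ioi 0 ×ˢ Ioo (-π) π :=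
    prod_mono subset_rfl (Ioo_subset_Ioo (by linarith [pi_pos]) le_rfl)
  have : ∀ p ∈ (Ioi 0 ×ˢ Ioo (-π) π : Set (ℝ × ℝ)),
      ENNReal.ofReal p.1 • (univ ×ˢ Ioi 0 : Set (ℝ × ℝ)).indicator F (polarCoord.symm p) =
      (Ioi 0 ×ˢ Ioo 0 π : Set (ℝ × ℝ)).indicator
        (fun p => ENNReal.ofReal p.1 * F (p.1 * cos p.2, p.1 * sin p.2)) p := by
    rintro ⟨s, θ⟩ ⟨hs, hθ⟩
    have hs : 0 < s := hs
    have hθ : -π < θ ∧ θ < π := hθ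
    rw [polarCoord_symm_apply, smul_eq_mul]
    by_cases h : 0 < θ
    · rw [indicator_of_mem, indicator_of_mem]
      · exact ⟨hs, h, hθ.2⟩
      · exact ⟨trivial, mul_pos hs (sin_pos_of_pos_of_lt_pi h hθ.2)⟩
    · rw [indicator_of_notMem, indicator_of_notMem, mul_zero]
      · rintro ⟨_, h', _⟩
        exact h h'
      · rintro ⟨_, h'⟩
        have h' : 0 < s * sin θ := h'
        have := sin_nonpos_of_nonpos_of_neg_pi_le (not_lt.1 h) hθ.1.le
        nlinarith
  rw [setLIntegral_congr_fun (measurableSet_Ioi.prod measurableSet_Ioo) this,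
    lintegral_indicator hms', Measure.restrict_restrict hms', inter_eq_left.2 hsub,
    Measure.volume_eq_prod ℝ ℝ, ← Measure.prod_restrict, lintegral_prod_symm _ (by fun_prop)]

lemma lintegral_inv_quadratic {r θ : ℝ} (hr : 0 < r) (hθ : θ ∈ Ioo 0 π) :
    ∫⁻ s in Ioi 0, ENNReal.ofReal (sin θ / (r ^ 2 + s ^ 2 - 2 * r * s * cos θ)) =
      ENNReal.ofReal ((π - θ) / r) := by
  have hsin : 0 < sin θ := sin_pos_of_pos_of_lt_pi hθ.1 hθ.2
  have hpos : ∀ s, 0 < r ^ 2 + s ^ 2 - 2 * r * s * cos θ := by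
    intro s
    have : r ^ 2 + s ^ 2 - 2 * r * s * cos θ = (s - r * cos θ) ^ 2 + (r * sin θ) ^ 2 := by
      rw [mul_pow, sin_sq]; ring
    rw [this]; positivity
  have hd : ∀ s ∈ Ici (0 : ℝ), HasDerivAt (fun s => r⁻¹ * arctan ((s - r * cos θ) / (r * sin θ)))
      (sin θ / (r ^ 2 + s ^ 2 - 2 * r * s * cos θ)) s := by
    intro s _
    have := ((((hasDerivAt_id s).sub_const (r * cos θ)).div_const (r * sin θ)).arctan).const_mul r⁻¹
    refine this.congr_deriv ?_
    simp only [id]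
    have h1 := hpos s
    have h2 : 0 < 1 + ((s - r * cos θ) / (r * sin θ)) ^ 2 := by positivity
    have h3 : r ^ 2 + s ^ 2 - 2 * r * s * cos θ =
        (r * sin θ) ^ 2 * (1 + ((s - r * cos θ) / (r * sin θ)) ^ 2) := by
      field_simp
      rw [sin_sq]; ring
    rw [h3]
    field_simp
  have hlim : Filter.Tendsto (fun s => r⁻¹ * arctan ((s - r * cos θ) / (r * sin θ))) Filter.atTop
      (nhds (r⁻¹ * (π / 2))) := by
    refine Filter.Tendsto.const_mul _ ?_
    refine (tendsto_arctan_atTop.mono_right nhdsWithin_le_nhds).comp ?_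
    refine Filter.Tendsto.atTop_div_const (by positivity) ?_
    exact Filter.tendsto_atTop_add_const_right _ _ Filter.tendsto_id
  have hi := integrableOn_Ioi_deriv_of_nonneg' hd
    (fun s _ => div_nonneg hsin.le (hpos s).le) hlim
  rw [← ofReal_integral_eq_lintegral_ofReal hi
    (.of_forall fun s => div_nonneg hsin.le (hpos s).le),
    integral_Ioi_of_hasDerivAt_of_tendsto' hd hi hlim]
  congr 1
  have : arctan ((0 - r * cos θ) / (r * sin θ)) = θ - π / 2 := by
    have e : (0 - r * cos θ) / (r * sin θ) = tan (θ - π / 2) := by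
      rw [tan_eq_sin_div_cos, sin_sub_pi_div_two, cos_sub_pi_div_two]
      field_simp
      ring
    rw [e, arctan_tan] <;> linarith [hθ.1, hθ.2]
  rw [this]
  ring

lemma norm_sq_eq_cylindrical (q : E₃) : ‖q‖ ^ 2 = q 0 ^ 2 + √(q 1 ^ 2 + q 2 ^ 2) ^ 2 := by
  rw [EuclideanSpace.real_norm_sq_eq, sq_sqrt (by positivity), Fin.sum_univ_three]
  ring

/-- Potential at distance `r` along the polar axis of an angular density over `‖q‖²`. -/
lemma lintegral_axial_potential {r : ℝ} (hr : 0 < r) {f : ℝ → ℝ} (hf : Measurable f) :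
    ∫⁻ q : E₃, ENNReal.ofReal (f (q 0 / ‖q‖) *
        ((r ^ 2 + ‖q‖ ^ 2 - 2 * r * q 0) * ‖q‖ ^ 2)⁻¹) =
      ENNReal.ofReal (2 * π) *
        ∫⁻ θ in Ioo 0 π, ENNReal.ofReal (f (cos θ)) * ENNReal.ofReal ((π - θ) / r) := by
  set F : ℝ × ℝ → ENNReal := fun p => ENNReal.ofReal (f (p.1 / √(p.1 ^ 2 + p.2 ^ 2)) *
    ((r ^ 2 + (p.1 ^ 2 + p.2 ^ 2) - 2 * r * p.1) * (p.1 ^ 2 + p.2 ^ 2))⁻¹) with hFdef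
  have hF : Measurable F := by fun_prop
  have e : ∀ q : E₃, ENNReal.ofReal (f (q 0 / ‖q‖) *
        ((r ^ 2 + ‖q‖ ^ 2 - 2 * r * q 0) * ‖q‖ ^ 2)⁻¹) = F (q 0, √(q 1 ^ 2 + q 2 ^ 2)) := by
    intro q
    simp only [hFdef, ← norm_sq_eq_cylindrical, sqrt_sq (norm_nonneg q)]
  simp_rw [e]
  rw [lintegral_cylindrical hF, lintegral_half_plane (by fun_prop)]
  congr 1
  refine setLIntegral_congr_fun measurableSet_Ioo fun θ hθ => ?_
  simp only
  rw [← lintegral_inv_quadratic hr hθ, ← lintegral_const_mul _ (by fun_prop)]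
  refine setLIntegral_congr_fun measurableSet_Ioi fun s hs => ?_
  have hs : 0 < s := hs
  have hsin : 0 < sin θ := sin_pos_of_pos_of_lt_pi hθ.1 hθ.2
  have e1 : (s * cos θ) ^ 2 + (s * sin θ) ^ 2 = s ^ 2 := by
    rw [mul_pow, mul_pow, sin_sq]; ring
  simp only [hFdef, e1, sqrt_sq hs.le]
  rw [mul_div_cancel_left₀ _ hs.ne', ← ENNReal.ofReal_mul (by positivity),
    ← ENNReal.ofReal_mul hs.le, ← ENNReal.ofReal_mul' (by
      have : r ^ 2 + s ^ 2 - 2 * r * s * cos θ = (s - r * cos θ) ^ 2 + (r * sin θ) ^ 2 := by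
        rw [mul_pow, sin_sq]; ring
      rw [this]; positivity)]
  congr 1
  field_simp

lemma lintegral_axial_one_add {r : ℝ} (hr : 0 < r) :
    ENNReal.ofReal (2 * π) *
      ∫⁻ θ in Ioo 0 π, ENNReal.ofReal (1 + cos θ) * ENNReal.ofReal ((π - θ) / r) =
    ENNReal.ofReal ((π ^ 3 + 4 * π) / r) := by
  have hi : IntervalIntegrable (fun θ => (1 + cos θ) * ((π - θ) / r)) volume 0 π :=
    Continuous.intervalIntegrable (by fun_prop) _ _
  have hd : ∀ θ ∈ uIcc 0 π, HasDerivAt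
      (fun θ => r⁻¹ * (π * θ - θ ^ 2 / 2 + (π - θ) * sin θ - cos θ))
      ((1 + cos θ) * ((π - θ) / r)) θ := by
    intro θ _
    have := (((((hasDerivAt_id θ).const_mul π).sub (((hasDerivAt_id θ).pow 2).div_const 2)).add
      (((hasDerivAt_id θ).const_sub π).mul (hasDerivAt_sin θ))).sub (hasDerivAt_cos θ)).const_mul
      r⁻¹
    refine this.congr_deriv ?_
    simp only [id]
    field_simp
    simp
    ring
  have hval := intervalIntegral.integral_eq_sub_of_hasDerivAt hd hi
  rw [intervalIntegral.integral_of_le pi_pos.le, integral_Ioc_eq_integral_Ioo] at hval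
  have hi' : IntegrableOn (fun θ => (1 + cos θ) * ((π - θ) / r)) (Ioo 0 π) :=
    ((intervalIntegrable_iff_integrableOn_Ioc_of_le pi_pos.le).1 hi).mono_set Ioo_subset_Ioc_self
  have e : ∀ θ ∈ Ioo 0 π, ENNReal.ofReal (1 + cos θ) * ENNReal.ofReal ((π - θ) / r) =
      ENNReal.ofReal ((1 + cos θ) * ((π - θ) / r)) := by
    intro θ hθ
    rw [ENNReal.ofReal_mul (by linarith [neg_one_le_cos θ])]
  rw [setLIntegral_congr_fun measurableSet_Ioo e, ← ofReal_integral_eq_lintegral_ofReal hi', hval,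
    ← ENNReal.ofReal_mul (by positivity)]
  · congr 1
    simp
    field_simp
    ring
  · filter_upwards [ae_restrict_mem measurableSet_Ioo] with θ hθ
    exact mul_nonneg (by linarith [neg_one_le_cos θ]) (div_nonneg (by linarith [hθ.2]) hr.le)

end SphericalCoordinates

section PolarCoordinates

open Metric Set

lemma ofReal_integral_le_lintegral_ofReal {α : Type*} [MeasurableSpace α] {ν : Measure α}
    (f : α → ℝ) : ENNReal.ofReal (∫ x, f x ∂ν) ≤ ∫⁻ x, ENNReal.ofReal (f x) ∂ν := by
  by_cases hf : Integrable f ν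
  · calc ENNReal.ofReal (∫ x, f x ∂ν) ≤ ENNReal.ofReal (∫ x, max (f x) 0 ∂ν) :=
          ENNReal.ofReal_le_ofReal (integral_mono hf hf.pos_part fun x => le_max_left _ _)
      _ = ∫⁻ x, ENNReal.ofReal (max (f x) 0) ∂ν :=
          ofReal_integral_eq_lintegral_ofReal hf.pos_part (.of_forall fun x => le_max_right _ _)
      _ = ∫⁻ x, ENNReal.ofReal (f x) ∂ν := by
          refine lintegral_congr fun x => ?_
          rcases le_total (f x) 0 with h | h
          · rw [max_eq_right h, ENNReal.ofReal_of_nonpos h, ENNReal.ofReal_zero]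
          · rw [max_eq_left h]
  · simp [integral_undef hf]

variable {E : Type*} [NormedAddCommGroup E] [NormedSpace ℝ E] [FiniteDimensional ℝ E]
  [MeasurableSpace E] [BorelSpace E] (μ : Measure E) [μ.IsAddHaarMeasure] [Nontrivial E]

/-- The radial part of Lebesgue measure. -/
noncomputable abbrev radialMeasure (E : Type*) [NormedAddCommGroup E] [NormedSpace ℝ E] :
    Measure (Ioi (0 : ℝ)) := Measure.volumeIoiPow (Module.finrank ℝ E - 1)

instance radialMeasure_nullSingletonClass : NullSingletonClass (radialMeasure E) := by
  refine ⟨fun x => ?_⟩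
  refine withDensity_absolutelyContinuous _ _ ?_
  rw [comap_subtype_coe_apply measurableSet_Ioi]
  simp

lemma lintegral_polar {f : E → ENNReal} (hf : Measurable f) :
    ∫⁻ x, f x ∂μ = ∫⁻ r, ∫⁻ ω, f ((r : ℝ) • (ω : E)) ∂μ.toSphere ∂radialMeasure E := by
  have h := μ.measurePreserving_homeomorphUnitSphereProd
  have hm : Measurable fun z : sphere (0 : E) 1 × Ioi (0 : ℝ) => f ((z.2 : ℝ) • (z.1 : E)) := by
    fun_prop
  have e := lintegral_prod_symm (μ := μ.toSphere) (ν := radialMeasure E) _ hm.aemeasurable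
  simp only at e
  rw [← e, ← h.lintegral_comp hm, ← restrict_compl_singleton (μ := μ) 0,
    ← lintegral_subtype_comap (measurableSet_singleton _).compl, restrict_compl_singleton]
  refine lintegral_congr fun x => ?_
  have hx : ‖(x : E)‖ ≠ 0 := norm_ne_zero_iff.2 x.2
  simp [smul_smul, hx]

/-- Polar coordinates in both factors of a product. -/
noncomputable def polarProd (z : (Ioi (0 : ℝ) × Ioi (0 : ℝ)) ×
    (sphere (0 : E) 1 × sphere (0 : E) 1)) :
    E × E := ((z.1.1 : ℝ) • (z.2.1 : E), (z.1.2 : ℝ) • (z.2.2 : E))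

omit [FiniteDimensional ℝ E] [MeasurableSpace E] [BorelSpace E] [Nontrivial E] in
lemma continuous_polarProd : Continuous (polarProd (E := E)) := by
  unfold polarProd
  fun_prop

lemma measurePreserving_polarProd : MeasurePreserving (polarProd (E := E))
    (((radialMeasure E).prod (radialMeasure E)).prod (μ.toSphere.prod μ.toSphere))
    (μ.prod μ) := by
  refine ⟨continuous_polarProd.measurable, Measure.ext_of_lintegral _ fun f hf => ?_⟩
  have hm := continuous_polarProd (E := E).measurable
  rw [lintegral_map hf hm, lintegral_prod _ (by fun_prop), lintegral_prod _ (by fun_prop),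
    lintegral_prod _ (by fun_prop), lintegral_polar μ (by fun_prop)]
  refine lintegral_congr fun r => ?_
  have e : ∀ s, ∫⁻ y, f (polarProd ((r, s), y)) ∂μ.toSphere.prod μ.toSphere =
      ∫⁻ ω, ∫⁻ η, f ((r : ℝ) • (ω : E), (s : ℝ) • (η : E)) ∂μ.toSphere ∂μ.toSphere := by
    intro s
    rw [lintegral_prod _ (by fun_prop)]
    rfl
  simp_rw [e]
  rw [lintegral_lintegral_swap]
  · refine lintegral_congr fun ω => ?_
    rw [lintegral_polar μ (by fun_prop)]
  · refine Measurable.aemeasurable ?_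
    unfold Function.uncurry
    exact Measurable.lintegral_prod_right' (f := fun z : (Ioi (0 : ℝ) × sphere (0 : E) 1) ×
      sphere (0 : E) 1 => f ((r : ℝ) • (z.1.2 : E), (z.1.1 : ℝ) • (z.2 : E))) (by fun_prop)

end PolarCoordinates

section PauliSphere

open Metric Set

local notation "E₃" => EuclideanSpace ℝ (Fin 3)
local notation "H₂" => EuclideanSpace ℂ (Fin 2)

/-- Surface measure on the unit sphere of physical space. -/
local notation "σ₃" => Measure.toSphere (volume : Measure E₃)

/-- The kernel `‖rω - sη‖⁻²` on the unit sphere. -/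
noncomputable def shellKernel (r s t : ℝ) : ℝ := (r ^ 2 + s ^ 2 - 2 * r * s * t)⁻¹

/-- The north pole of the unit sphere. -/
noncomputable def northPole : sphere (0 : E₃) 1 := ⟨EuclideanSpace.single 0 1, by simp⟩

/-- The largest eigenvalue of the pair of zonal operators with kernel `shellKernel`. -/
noncomputable def shellConst (r s : ℝ) : ℝ :=
  ∫ η, (1 + inner ℝ (northPole : E₃) (η : E₃)) *
    shellKernel r s (inner ℝ (northPole : E₃) (η : E₃)) ∂σ₃

lemma norm_smul_sub_smul_sq (r s : ℝ) (ω η : sphere (0 : E₃) 1) :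
    ‖r • (ω : E₃) - s • (η : E₃)‖ ^ 2 = r ^ 2 + s ^ 2 - 2 * r * s * inner ℝ (ω : E₃) (η : E₃) := by
  rw [norm_sub_sq_real, norm_smul, norm_smul, inner_smul_left, inner_smul_right]
  simp
  ring

lemma abs_inner_sphere_le (ω η : sphere (0 : E₃) 1) : |inner ℝ (ω : E₃) (η : E₃)| ≤ 1 := by
  simpa using abs_real_inner_le_norm (ω : E₃) (η : E₃)

lemma shellKernel_denom_pos {r s t : ℝ} (hr : 0 < r) (hs : 0 < s) (hrs : r ≠ s) (ht : t ≤ 1) :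
    0 < r ^ 2 + s ^ 2 - 2 * r * s * t := by
  have : 0 < (r - s) ^ 2 := by have := sub_ne_zero.2 hrs; positivity
  nlinarith [mul_pos hr hs]

lemma continuous_shellKernel_inner {r s : ℝ} (hr : 0 < r) (hs : 0 < s) (hrs : r ≠ s) :
    Continuous fun p : sphere (0 : E₃) 1 × sphere (0 : E₃) 1 =>
      shellKernel r s (inner ℝ (p.1 : E₃) (p.2 : E₃)) := by
  unfold shellKernel
  refine Continuous.inv₀ (by fun_prop) fun p => ?_
  exact (shellKernel_denom_pos hr hs hrs (abs_le.1 (abs_inner_sphere_le p.1 p.2)).2).ne'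

lemma integral_pauliVec_sphere (u : H₂) : ∫ η : sphere (0 : E₃) 1, pauliVec η u ∂σ₃ = 0 := by
  have h := integral_comp_sphereMap (LinearIsometryEquiv.neg ℝ (E := E₃))
    (fun η => pauliVec (η : E₃) u)
  simp only [sphereMap, LinearIsometryEquiv.coe_neg, map_neg,
    neg_apply, integral_neg] at h
  have h2 : (2 : ℝ) • ∫ η : sphere (0 : E₃) 1, pauliVec η u ∂σ₃ = 0 := by
    rw [two_smul]
    nth_rewrite 1 [← h]
    exact neg_add_cancel _
  simpa using h2

lemma twistedForm_pauli_le {r s : ℝ} (hr : 0 < r) (hs : 0 < s) (hrs : r ≠ s)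
    {h f : sphere (0 : E₃) 1 → H₂} (hh : Continuous h) (hf : Continuous f) :
    twistedForm σ₃ (fun p => shellKernel r s (inner ℝ (p.1 : E₃) (p.2 : E₃)))
      (fun ω => pauliVec ω) h f ≤
      shellConst r s / 2 * (∫ x, ‖h x‖ ^ 2 ∂σ₃ + ∫ x, ‖f x‖ ^ 2 ∂σ₃) := by
  have hk := continuous_shellKernel_inner hr hs hrs
  have hkx : ∀ x : sphere (0 : E₃) 1, Continuous fun y : sphere (0 : E₃) 1 =>
      shellKernel r s (inner ℝ (x : E₃) (y : E₃)) := fun x =>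
    hk.comp (Continuous.prodMk_right x)
  have hin : ∀ x : sphere (0 : E₃) 1, Continuous fun y : sphere (0 : E₃) 1 =>
      (inner ℝ (x : E₃) (y : E₃) : ℝ) := fun x => by fun_prop
  set κ₀ := ∫ y, shellKernel r s (inner ℝ (northPole : E₃) (y : E₃)) ∂σ₃
  set κ₁ := ∫ y, shellKernel r s (inner ℝ (northPole : E₃) (y : E₃)) *
    inner ℝ (northPole : E₃) (y : E₃) ∂σ₃
  have i₀ : Integrable (fun y : sphere (0 : E₃) 1 =>
      shellKernel r s (inner ℝ (northPole : E₃) (y : E₃))) σ₃ :=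
    (hkx northPole).integrable_of_compactSpace
  have i₁ : Integrable (fun y : sphere (0 : E₃) 1 =>
      shellKernel r s (inner ℝ (northPole : E₃) (y : E₃)) * inner ℝ (northPole : E₃) (y : E₃)) σ₃ :=
    ((hkx northPole).mul (hin northPole)).integrable_of_compactSpace
  have hA : shellConst r s = κ₀ + κ₁ := by
    rw [← integral_add i₀ i₁]
    unfold shellConst
    congr 1 with y
    ring
  rw [hA]
  have hden : ∀ p : sphere (0 : E₃) 1 × sphere (0 : E₃) 1,
      0 < r ^ 2 + s ^ 2 - 2 * r * s * inner ℝ (p.1 : E₃) (p.2 : E₃) := fun p =>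
    shellKernel_denom_pos hr hs hrs (abs_le.1 (abs_inner_sphere_le p.1 p.2)).2
  have hσ : σ₃ ≠ 0 := Measure.toSphere_ne_zero _
  refine twistedForm_le (c := ((r + s) ^ 2)⁻¹) hk (by fun_prop) hσ ?_ ?_ ?_ ?_ ?_ ?_ ?_ ?_ hh hf
  · intro x y
    simp only [real_inner_comm]
  · intro x u
    simp [pauliVec_pauliVec]
  · intro x u v
    exact inner_pauliVec _ _ _
  · exact integral_pauliVec_sphere
  · intro x
    exact integral_sphere_inner_eq (shellKernel r s) _ _
  · intro x u
    have e := integral_sphere_smul_self x (hkx x)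
    have hi : Integrable (fun y : sphere (0 : E₃) 1 =>
        shellKernel r s (inner ℝ (x : E₃) (y : E₃)) • (y : E₃)) σ₃ :=
      ((hkx x).smul continuous_subtype_val).integrable_of_compactSpace
    have e' := (pauliVec.flip u).integral_comp_comm hi
    rw [e] at e'
    simp only [ContinuousLinearMap.flip_apply, map_smul] at e'
    rw [e']
    congr 1
    exact integral_sphere_inner_eq (fun t => shellKernel r s t * t) _ _
  · intro p
    unfold shellKernel
    refine inv_anti₀ (hden p) ?_
    nlinarith [mul_pos hr hs, (abs_le.1 (abs_inner_sphere_le p.1 p.2)).1]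
  · have : κ₀ - κ₁ ≤ ∫ _y : sphere (0 : E₃) 1, 2 * ((r + s) ^ 2)⁻¹ ∂σ₃ := by
      rw [← integral_sub i₀ i₁]
      refine integral_mono (i₀.sub i₁) (integrable_const _) fun y => ?_
      have hd := hden (northPole, y)
      simp only at hd ⊢
      set t : ℝ := inner ℝ (northPole : E₃) (y : E₃)
      have ht : -1 ≤ t := (abs_le.1 (abs_inner_sphere_le northPole y)).1
      have e : shellKernel r s t - shellKernel r s t * t =
          (1 - t) / (r ^ 2 + s ^ 2 - 2 * r * s * t) := by
        unfold shellKernel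
        ring
      rw [e, ← div_eq_mul_inv, div_le_div_iff₀ hd (by positivity)]
      nlinarith [mul_nonneg (sq_nonneg (r - s)) (by linarith : 0 ≤ 1 + t)]
    rw [integral_const, smul_eq_mul] at this
    linarith

lemma twistedForm_pauli_le_weighted {r s : ℝ} (hr : 0 < r) (hs : 0 < s) (hrs : r ≠ s)
    {h f : sphere (0 : E₃) 1 → H₂} (hh : Continuous h) (hf : Continuous f) :
    twistedForm σ₃ (fun p => shellKernel r s (inner ℝ (p.1 : E₃) (p.2 : E₃)))
      (fun ω => pauliVec ω) h f ≤
      shellConst r s / 2 * (r ^ 2 * (s ^ 2)⁻¹ * ∫ x, ‖h x‖ ^ 2 ∂σ₃ +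
        s ^ 2 * (r ^ 2)⁻¹ * ∫ x, ‖f x‖ ^ 2 ∂σ₃) := by
  have := twistedForm_pauli_le hr hs hrs (hh.const_smul (r / s)) (hf.const_smul (s / r))
  convert this using 1
  · unfold twistedForm
    congr 1 with p
    simp only [map_smul, inner_smul_left, inner_smul_right, Pi.smul_apply]
    simp only [conj_trivial]
    field_simp
  · simp only [norm_smul, mul_pow, integral_const_mul, norm_eq_abs, sq_abs,
      div_eq_mul_inv, inv_pow, Pi.smul_apply]

lemma lintegral_shellConst_le {r : ℝ} (hr : 0 < r) :
    ∫⁻ s, ENNReal.ofReal (shellConst r s) * ENNReal.ofReal (((s : ℝ) ^ 2)⁻¹) ∂radialMeasure E₃ ≤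
      ENNReal.ofReal ((π ^ 3 + 4 * π) / r) := by
  rw [← lintegral_axial_one_add hr, ← lintegral_axial_potential hr (f := fun t => 1 + t)
    (by fun_prop), lintegral_polar (volume : Measure E₃) (by fun_prop)]
  refine lintegral_mono fun s => ?_
  have hs : 0 < (s : ℝ) := s.2
  refine (mul_le_mul_left (ofReal_integral_le_lintegral_ofReal _) _).trans ?_
  rw [← lintegral_mul_const']
  · refine lintegral_mono fun η => le_of_eq ?_
    rw [← ENNReal.ofReal_mul' (by positivity)]
    congr 1
    have e : inner ℝ (northPole : E₃) (η : E₃) = (η : E₃) 0 := by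
      simp [northPole, EuclideanSpace.inner_single_left]
    rw [e, norm_smul]
    simp only [norm_eq_of_mem_sphere, norm_eq_abs, abs_of_pos hs, PiLp.smul_apply, smul_eq_mul,
      mul_one, shellKernel, mul_inv]
    rw [mul_div_cancel_left₀ _ hs.ne']
    ring_nf
  · exact ENNReal.ofReal_ne_top

lemma shellConst_comm (r s : ℝ) : shellConst r s = shellConst s r := by
  unfold shellConst shellKernel
  congr 1 with η
  ring_nf

lemma shellConst_nonneg {r s : ℝ} (hr : 0 < r) (hs : 0 < s) : 0 ≤ shellConst r s := by
  refine integral_nonneg fun η => mul_nonneg ?_ (inv_nonneg.2 ?_)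
  · linarith [(abs_le.1 (abs_inner_sphere_le northPole η)).1]
  · nlinarith [mul_pos hr hs, (abs_le.1 (abs_inner_sphere_le northPole η)).2, sq_nonneg (r - s)]

end PauliSphere

section MomentumForm

open Metric Set

local notation "E₃" => EuclideanSpace ℝ (Fin 3)
local notation "H₂" => EuclideanSpace ℂ (Fin 2)
local notation "σ₃" => Measure.toSphere (volume : Measure E₃)
local notation "ν₃" => radialMeasure E₃

/-- The sign of `σ·p`. -/
noncomputable def pauliSign (p : E₃) : H₂ →L[ℝ] H₂ := pauliVec (‖p‖⁻¹ • p)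

lemma pauliSign_smul {r : ℝ} (hr : 0 < r) (ω : sphere (0 : E₃) 1) :
    pauliSign (r • (ω : E₃)) = pauliVec ω := by
  simp [pauliSign, norm_smul, abs_of_pos hr, smul_smul, hr.ne']

lemma norm_pauliSign_le (p : E₃) (u : H₂) : ‖pauliSign p u‖ ≤ ‖u‖ := by
  rw [pauliSign, norm_pauliVec, norm_smul, norm_inv, norm_norm]
  exact mul_le_of_le_one_left (norm_nonneg _) inv_mul_le_one

/-- The integrand of the Coulomb energy of a spinor field and its sign-flipped partner. -/
noncomputable def momentumKernel (g : E₃ → H₂) (z : E₃ × E₃) : ℝ :=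
  (‖z.1 - z.2‖ ^ 2)⁻¹ * (inner ℝ (g z.1) (g z.2) +
    inner ℝ (pauliSign z.1 (g z.1)) (pauliSign z.2 (g z.2)))

lemma measurable_shellConst : Measurable fun z : ℝ × ℝ => shellConst z.1 z.2 := by
  unfold shellConst shellKernel
  exact (StronglyMeasurable.integral_prod_right (f := fun (z : ℝ × ℝ) (η : sphere (0 : E₃) 1) =>
    (1 + inner ℝ (northPole : E₃) (η : E₃)) *
      (z.1 ^ 2 + z.2 ^ 2 - 2 * z.1 * z.2 * inner ℝ (northPole : E₃) (η : E₃))⁻¹)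
    (Measurable.stronglyMeasurable (by fun_prop))).measurable

/-- The square mass of a field on the sphere of radius `r`. -/
noncomputable def shellMass (g : E₃ → H₂) (r : ℝ) : ℝ :=
  ∫ ω : sphere (0 : E₃) 1, ‖g (r • (ω : E₃))‖ ^ 2 ∂σ₃

lemma shellMass_nonneg (g : E₃ → H₂) (r : ℝ) : 0 ≤ shellMass g r :=
  integral_nonneg fun _ => by positivity

lemma measurable_shellMass {g : E₃ → H₂} (hg : Continuous g) : Measurable (shellMass g) :=
  (StronglyMeasurable.integral_prod_right (f := fun (r : ℝ)
    (ω : sphere (0 : E₃) 1) => ‖g (r • (ω : E₃))‖ ^ 2)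
    (Continuous.stronglyMeasurable (by fun_prop))).measurable

/-- The Schur weight attached to a pair of radii. -/
noncomputable def shellWeight (g : E₃ → H₂) (z : Ioi (0 : ℝ) × Ioi (0 : ℝ)) : ENNReal :=
  ENNReal.ofReal ((z.1 : ℝ) ^ 2 / 2 * shellMass g z.1) *
    (ENNReal.ofReal (shellConst z.1 z.2) * ENNReal.ofReal (((z.2 : ℝ) ^ 2)⁻¹))

lemma measurable_shellWeight {g : E₃ → H₂} (hg : Continuous g) : Measurable (shellWeight g) := by
  have hH : Measurable fun z : Ioi (0 : ℝ) × Ioi (0 : ℝ) => shellMass g z.1 :=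
    (measurable_shellMass hg).comp (by fun_prop)
  have hA : Measurable fun z : Ioi (0 : ℝ) × Ioi (0 : ℝ) => shellConst z.1 z.2 :=
    measurable_shellConst.comp (by fun_prop : Measurable fun z : Ioi (0 : ℝ) × Ioi (0 : ℝ) =>
      ((z.1 : ℝ), (z.2 : ℝ)))
  have h1 : Measurable fun z : Ioi (0 : ℝ) × Ioi (0 : ℝ) => (z.1 : ℝ) ^ 2 / 2 := by fun_prop
  have h2 : Measurable fun z : Ioi (0 : ℝ) × Ioi (0 : ℝ) => ((z.2 : ℝ) ^ 2)⁻¹ := by fun_prop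
  exact (h1.mul hH).ennreal_ofReal.mul (hA.ennreal_ofReal.mul h2.ennreal_ofReal)

lemma lintegral_shellWeight_le {g : E₃ → H₂} (hg : Continuous g) :
    ∫⁻ z, shellWeight g z ∂(Measure.prod ν₃ ν₃) ≤
    ENNReal.ofReal ((π ^ 3 + 4 * π) / 2) * ∫⁻ p, ENNReal.ofReal (‖p‖ * ‖g p‖ ^ 2) := by
  rw [lintegral_prod _ (measurable_shellWeight hg).aemeasurable, lintegral_polar (volume : Measure E₃) (by fun_prop),
    ← lintegral_const_mul' _ _ ENNReal.ofReal_ne_top]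
  refine lintegral_mono fun r => ?_
  have hr : 0 < (r : ℝ) := r.2
  have hM := shellMass_nonneg g r
  simp only [shellWeight]
  rw [lintegral_const_mul' _ _ ENNReal.ofReal_ne_top]
  refine (mul_le_mul_right (lintegral_shellConst_le hr) _).trans (le_of_eq ?_)
  have e : ∫⁻ ω : sphere (0 : E₃) 1, ENNReal.ofReal (‖(r : ℝ) • (ω : E₃)‖ *
      ‖g ((r : ℝ) • (ω : E₃))‖ ^ 2) ∂σ₃ =
      ENNReal.ofReal ((r : ℝ) * shellMass g r) := by
    rw [shellMass, ← integral_const_mul, ofReal_integral_eq_lintegral_ofReal]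
    · simp [norm_smul, abs_of_pos hr]
    · exact Continuous.integrable_of_compactSpace (by fun_prop)
    · exact .of_forall fun ω => by positivity
  rw [e, ← ENNReal.ofReal_mul' (by positivity), ← ENNReal.ofReal_mul (by positivity)]
  congr 1
  field_simp

lemma ofReal_integral_momentumKernel_le {g : E₃ → H₂} (hg : Continuous g) :
    ENNReal.ofReal (∫ z, momentumKernel g z ∂(volume.prod volume)) ≤
      ENNReal.ofReal (π ^ 3 + 4 * π) * ∫⁻ p, ENNReal.ofReal (‖p‖ * ‖g p‖ ^ 2) := by
  by_cases hi : Integrable (momentumKernel g) (volume.prod volume)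
  swap
  · simp [integral_undef hi]
  have hmp := measurePreserving_polarProd (volume : Measure E₃)
  have hi' := hmp.integrable_comp_of_integrable hi
  have e1 : ∫ z, momentumKernel g z ∂(volume.prod volume) = ∫ z, (momentumKernel g ∘ polarProd) z
      ∂((Measure.prod ν₃ ν₃).prod (Measure.prod σ₃ σ₃)) := by
    rw [← hmp.map_eq] at hi ⊢
    exact integral_map hmp.measurable.aemeasurable hi.1
  rw [e1, integral_prod _ hi']
  refine (ofReal_integral_le_lintegral_ofReal _).trans ?_
  have hdiag : ∀ᵐ z ∂(Measure.prod ν₃ ν₃), z.1 ≠ z.2 := by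
    rw [Measure.ae_prod_iff_ae_ae]
    · refine .of_forall fun r => ?_
      filter_upwards [compl_mem_ae_iff.2 (measure_singleton (μ := ν₃) r)] with s hs h
      exact hs h.symm
    · exact (measurableSet_eq_fun measurable_fst measurable_snd).compl
  have key : ∀ᵐ z ∂(Measure.prod ν₃ ν₃), ENNReal.ofReal
      (∫ y, (momentumKernel g ∘ polarProd) (z, y) ∂(Measure.prod σ₃ σ₃)) ≤ shellWeight g z + shellWeight g z.swap := by
    filter_upwards [hdiag] with z hz
    obtain ⟨⟨r, hr⟩, ⟨s, hs⟩⟩ := z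
    have hr : 0 < r := hr
    have hs : 0 < s := hs
    have hrs : r ≠ s := fun h => hz (Subtype.ext h)
    have := twistedForm_pauli_le_weighted hr hs hrs
      (h := fun ω => g (r • (ω : E₃))) (f := fun ω => g (s • (ω : E₃)))
      (by fun_prop) (by fun_prop)
    have e2 : ∫ y, (momentumKernel g ∘ polarProd) ((⟨r, hr⟩, ⟨s, hs⟩), y) ∂(Measure.prod σ₃ σ₃) =
        twistedForm σ₃ (fun p => shellKernel r s (inner ℝ (p.1 : E₃) (p.2 : E₃)))
          (fun ω => pauliVec ω) (fun ω => g (r • (ω : E₃))) (fun ω => g (s • (ω : E₃))) := by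
      unfold twistedForm
      congr 1 with y
      simp only [Function.comp, polarProd, momentumKernel, norm_smul_sub_smul_sq,
        pauliSign_smul hr, pauliSign_smul hs, shellKernel]
    have hA := shellConst_nonneg hr hs
    rw [e2]
    refine (ENNReal.ofReal_le_ofReal this).trans (le_of_eq ?_)
    change ENNReal.ofReal (shellConst r s / 2 * (r ^ 2 * (s ^ 2)⁻¹ * shellMass g r +
      s ^ 2 * (r ^ 2)⁻¹ * shellMass g s)) = _
    have hM := shellMass_nonneg g
    simp only [shellWeight, Prod.swap]
    rw [shellConst_comm s r, ← ENNReal.ofReal_mul hA, ← ENNReal.ofReal_mul hA,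
      ← ENNReal.ofReal_mul (by have := hM r; positivity),
      ← ENNReal.ofReal_mul (by have := hM s; positivity),
      ← ENNReal.ofReal_add (by have := hM r; positivity)
        (by have := hM s; positivity)]
    congr 1
    ring
  calc _ ≤ ∫⁻ z, (shellWeight g z + shellWeight g z.swap) ∂(Measure.prod ν₃ ν₃) := lintegral_mono_ae key
    _ = ∫⁻ z, shellWeight g z ∂(Measure.prod ν₃ ν₃) + ∫⁻ z, shellWeight g z ∂(Measure.prod ν₃ ν₃) := by
      rw [lintegral_add_left (measurable_shellWeight hg), lintegral_prod_swap]
    _ ≤ _ := by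
      refine (add_le_add (lintegral_shellWeight_le hg) (lintegral_shellWeight_le hg)).trans (le_of_eq ?_)
      rw [← add_mul, ← ENNReal.ofReal_add (by positivity) (by positivity), add_halves]

end MomentumForm

section CoulombEnergy

open Set Filter Topology
open scoped FourierTransform

local notation "E₃" => EuclideanSpace ℝ (Fin 3)
local notation "H₂" => EuclideanSpace ℂ (Fin 2)

lemma inner_real_eq_re (u v : H₂) : (inner ℝ u v : ℝ) = (inner ℂ u v : ℂ).re := by
  simp [PiLp.inner_apply, Complex.inner, Fin.sum_univ_two]

lemma heatWeight_integral {a : ℝ} (ha : 0 < a) :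
    IntegrableOn (fun t : ℝ => 2 * (t ^ 3)⁻¹ * exp (-(a / t ^ 2))) (Ioi 0) ∧
      ∫ t in Ioi 0, 2 * (t ^ 3)⁻¹ * exp (-(a / t ^ 2)) = a⁻¹ := by
  have hd : ∀ t ∈ Ioi (0 : ℝ), HasDerivAt (fun t => a⁻¹ * expNegInvGlue (t ^ 2 / a))
      (2 * (t ^ 3)⁻¹ * exp (-(a / t ^ 2))) t := by
    intro t ht
    have ht : 0 < t := ht
    have h1 : HasDerivAt (fun t : ℝ => a⁻¹ * exp (-(a * (t ^ 2)⁻¹)))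
        (a⁻¹ * (exp (-(a * (t ^ 2)⁻¹)) * (-(a * (-(2 * t) / (t ^ 2) ^ 2))))) t := by
      have h2 : HasDerivAt (fun t : ℝ => t ^ 2) (2 * t) t := by simpa using hasDerivAt_pow 2 t
      exact (((h2.inv (by positivity)).const_mul a).neg.exp).const_mul a⁻¹
    have h3 : HasDerivAt (fun t => a⁻¹ * expNegInvGlue (t ^ 2 / a))
        (a⁻¹ * (exp (-(a * (t ^ 2)⁻¹)) * (-(a * (-(2 * t) / (t ^ 2) ^ 2))))) t := by
      refine h1.congr_of_eventuallyEq ?_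
      filter_upwards [lt_mem_nhds ht] with s hs
      have : 0 < s ^ 2 / a := by positivity
      rw [expNegInvGlue, if_neg (not_le.2 this), inv_div, div_eq_mul_inv]
    refine h3.congr_deriv ?_
    rw [div_eq_mul_inv a]
    field_simp
  have hc : ContinuousWithinAt (fun t => a⁻¹ * expNegInvGlue (t ^ 2 / a)) (Ici 0) 0 := by
    have := (expNegInvGlue.contDiff (n := 0)).continuous
    fun_prop
  have hpos : ∀ t ∈ Ioi (0 : ℝ), 0 ≤ 2 * (t ^ 3)⁻¹ * exp (-(a / t ^ 2)) := by
    intro t ht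
    have ht : 0 < t := ht
    positivity
  have hlim : Tendsto (fun t => a⁻¹ * expNegInvGlue (t ^ 2 / a)) atTop (𝓝 a⁻¹) := by
    have h1 : Tendsto (fun t : ℝ => a⁻¹ * exp (-(a * (t ^ 2)⁻¹))) atTop
        (𝓝 (a⁻¹ * exp (-(a * 0)))) := by
      refine ((continuous_exp.tendsto _).comp ?_).const_mul _
      exact ((tendsto_inv_atTop_zero.comp (tendsto_pow_atTop two_ne_zero)).const_mul a).neg
    simp only [mul_zero, neg_zero, exp_zero, mul_one] at h1
    refine h1.congr' ?_
    filter_upwards [eventually_gt_atTop 0] with s hs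
    have : 0 < s ^ 2 / a := by positivity
    rw [expNegInvGlue, if_neg (not_le.2 this), inv_div, div_eq_mul_inv]
  refine ⟨integrableOn_Ioi_deriv_of_nonneg hc hd hpos hlim, ?_⟩
  rw [integral_Ioi_of_hasDerivAt_of_nonneg hc hd hpos hlim]
  simp

lemma integral_gaussian_phase {t : ℝ} (ht : 0 < t) (w : E₃) :
    ∫ x : E₃, Complex.exp (-((π * t ^ 2 : ℝ) : ℂ) * (‖x‖ : ℂ) ^ 2 +
      2 * π * Complex.I * (inner ℝ w x : ℝ)) =
      (((t ^ 3)⁻¹ * exp (-(π * ‖w‖ ^ 2 / t ^ 2)) : ℝ) : ℂ) := by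
  have hb : 0 < ((π * t ^ 2 : ℝ) : ℂ).re := by rw [Complex.ofReal_re]; positivity
  rw [GaussianFourier.integral_cexp_neg_mul_sq_norm_add hb]
  have e1 : ((π : ℂ) / ((π * t ^ 2 : ℝ) : ℂ)) ^ ((Module.finrank ℝ E₃ : ℂ) / 2) =
      (((t ^ 3)⁻¹ : ℝ) : ℂ) := by
    have : ((π : ℂ) / ((π * t ^ 2 : ℝ) : ℂ)) = ((((t⁻¹) ^ 2 : ℝ)) : ℂ) := by
      push_cast
      have : (t : ℂ) ≠ 0 := by exact_mod_cast ht.ne'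
      have : (π : ℂ) ≠ 0 := by exact_mod_cast pi_ne_zero
      field_simp
    rw [this, show (Module.finrank ℝ E₃ : ℂ) / 2 = ((3 / 2 : ℝ) : ℂ) by simp,
      ← Complex.ofReal_cpow (by positivity), ← rpow_natCast, ← rpow_mul (by positivity)]
    norm_num
  rw [e1]
  push_cast
  congr 2
  have h1 : (t : ℂ) ≠ 0 := by exact_mod_cast ht.ne'
  have h2 : (π : ℂ) ≠ 0 := by exact_mod_cast pi_ne_zero
  field_simp
  rw [Complex.I_sq]
  ring

variable {G : E₃ → H₂}

lemma integrable_phase_smul (hG : Integrable G) (x : E₃) :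
    Integrable fun v => Complex.exp (↑(2 * π * inner ℝ v x) * Complex.I) • G v := by
  have hc : Continuous fun v : E₃ => Complex.exp (↑(2 * π * inner ℝ v x) * Complex.I) := by
    fun_prop
  refine hG.norm.mono' (hc.aestronglyMeasurable.smul hG.1) (.of_forall fun v => ?_)
  rw [norm_smul, Complex.norm_exp_ofReal_mul_I, one_mul]

lemma integrable_prod_inner (hG : Integrable G) :
    Integrable (fun z : E₃ × E₃ => (inner ℂ (G z.1) (G z.2) : ℂ)) (volume.prod volume) :=
  (hG.norm.mul_prod hG.norm).mono' (hG.1.comp_fst.inner hG.1.comp_snd)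
    (.of_forall fun _ => norm_inner_le_norm _ _)

lemma integral_prod_inner_self (hG : Integrable G) :
    ∫ z : E₃ × E₃, (inner ℂ (G z.1) (G z.2) : ℂ) ∂(volume.prod volume) =
      ((‖∫ v, G v‖ ^ 2 : ℝ) : ℂ) := by
  rw [integral_prod _ (integrable_prod_inner hG)]
  simp_rw [integral_inner hG]
  have := integral_inner (𝕜 := ℂ) hG (∫ v, G v)
  rw [inner_self_eq_norm_sq_to_K] at this
  have h3 := congrArg (starRingEnd ℂ) this
  rw [← integral_conj] at h3
  simp only [inner_conj_symm] at h3
  rw [h3]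
  simp

lemma integral_gaussian_mul_norm_sq_fourierInv (hG : Integrable G) {t : ℝ} (ht : 0 < t) :
    Integrable (fun x => exp (-(π * t ^ 2 * ‖x‖ ^ 2)) * ‖(𝓕⁻ G) x‖ ^ 2) ∧
    ∫ x, exp (-(π * t ^ 2 * ‖x‖ ^ 2)) * ‖(𝓕⁻ G) x‖ ^ 2 =
      ∫ z : E₃ × E₃, (t ^ 3)⁻¹ * exp (-(π * ‖z.1 - z.2‖ ^ 2 / t ^ 2)) * inner ℝ (G z.1) (G z.2)
        ∂(volume.prod volume) := by
  set γ : E₃ → E₃ → ℂ := fun w x => Complex.exp (-((π * t ^ 2 : ℝ) : ℂ) * (‖x‖ : ℂ) ^ 2 +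
      2 * π * Complex.I * (inner ℝ w x : ℝ)) with hγ
  set J : E₃ × (E₃ × E₃) → ℂ := fun y => γ (y.2.2 - y.2.1) y.1 * inner ℂ (G y.2.1) (G y.2.2)
    with hJ
  have hG2 := integrable_prod_inner hG
  have hγn : ∀ w x, ‖γ w x‖ = exp (-(π * t ^ 2 * ‖x‖ ^ 2)) := by
    intro w x
    rw [hγ, Complex.norm_exp]
    congr 1
    simp [← Complex.ofReal_pow]
  have hgi : Integrable (fun x : E₃ => exp (-(π * t ^ 2 * ‖x‖ ^ 2))) := by
    have := (GaussianFourier.integrable_cexp_neg_mul_sq_norm_add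
      (b := ((π * t ^ 2 : ℝ) : ℂ)) (by rw [Complex.ofReal_re]; positivity)
      (2 * π * Complex.I) (0 : E₃)).norm
    refine this.congr (.of_forall fun x => ?_)
    exact hγn 0 x
  have hγc : Continuous fun y : E₃ × (E₃ × E₃) => γ (y.2.2 - y.2.1) y.1 := by
    rw [hγ]; fun_prop
  have hJi : Integrable J (volume.prod (volume.prod volume)) := by
    refine (hgi.mul_prod hG2.norm).mono' (hγc.aestronglyMeasurable.mul hG2.1.comp_snd) ?_
    refine .of_forall fun y => ?_
    rw [hJ, norm_mul, hγn]
  have hx : ∀ x, ∫ z, J (x, z) ∂(volume.prod volume) =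
      ((exp (-(π * t ^ 2 * ‖x‖ ^ 2)) * ‖(𝓕⁻ G) x‖ ^ 2 : ℝ) : ℂ) := by
    intro x
    set P : E₃ → H₂ := fun v => Complex.exp (↑(2 * π * inner ℝ v x) * Complex.I) • G v with hP
    have hPi : Integrable P := integrable_phase_smul hG x
    have e2 : ∫ z : E₃ × E₃, (inner ℂ (P z.1) (P z.2) : ℂ) ∂(volume.prod volume) =
        ((‖(𝓕⁻ G) x‖ ^ 2 : ℝ) : ℂ) := by
      rw [integral_prod_inner_self hPi, fourierInv_eq' G x]
    rw [Complex.ofReal_mul, ← e2, ← integral_const_mul]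
    congr 1 with z
    simp only [hJ, hγ, hP, inner_smul_left, inner_smul_right]
    rw [← mul_assoc, ← mul_assoc, ← Complex.exp_conj, Complex.ofReal_exp, ← Complex.exp_add,
      ← Complex.exp_add]
    congr 2
    simp [inner_sub_left, map_ofNat (starRingEnd ℂ) 2]
    ring
  have hz : ∀ z : E₃ × E₃, ∫ x, J (x, z) =
      (((t ^ 3)⁻¹ * exp (-(π * ‖z.1 - z.2‖ ^ 2 / t ^ 2)) : ℝ) : ℂ) * inner ℂ (G z.1) (G z.2) := by
    intro z
    simp only [hJ]
    rw [integral_mul_const, integral_gaussian_phase ht, norm_sub_rev]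
  have hsw := integral_integral_swap (f := fun x z => J (x, z)) hJi
  simp_rw [hx, hz] at hsw
  constructor
  · have := hJi.integral_prod_left
    simp_rw [hx] at this
    exact this.re
  · have h1 : ∀ z : E₃ × E₃, (t ^ 3)⁻¹ * exp (-(π * ‖z.1 - z.2‖ ^ 2 / t ^ 2)) *
        inner ℝ (G z.1) (G z.2) = ((((t ^ 3)⁻¹ * exp (-(π * ‖z.1 - z.2‖ ^ 2 / t ^ 2)) : ℝ) : ℂ) *
          inner ℂ (G z.1) (G z.2)).re := by
      intro z
      rw [Complex.re_ofReal_mul, inner_real_eq_re]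
    have h2 := hJi.integral_prod_right
    simp_rw [hz] at h2
    simp_rw [h1]
    rw [integral_complex_ofReal] at hsw
    have h3 : ∫ z : E₃ × E₃, ((((t ^ 3)⁻¹ * exp (-(π * ‖z.1 - z.2‖ ^ 2 / t ^ 2)) : ℝ) : ℂ) *
        inner ℂ (G z.1) (G z.2)).re ∂(volume.prod volume) = _ := integral_re (𝕜 := ℂ) h2
    rw [h3, ← hsw]
    simp

lemma ofReal_inv_norm_le {r : ℝ} (hr : 0 ≤ r) : ENNReal.ofReal r⁻¹ ≤
    ∫⁻ t in Ioi (0 : ℝ), ENNReal.ofReal (2 * exp (-(π * t ^ 2 * r ^ 2))) := by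
  rcases hr.eq_or_lt with rfl | hr
  · simp
  have hb : 0 < π * r ^ 2 := by positivity
  have hi : IntegrableOn (fun t : ℝ => 2 * exp (-(π * t ^ 2 * r ^ 2))) (Ioi 0) := by
    refine ((integrable_exp_neg_mul_sq hb).const_mul 2).integrableOn.congr_fun (fun t _ => ?_)
      measurableSet_Ioi
    simp only
    ring_nf
  rw [← ofReal_integral_eq_lintegral_ofReal hi (.of_forall fun t => by positivity)]
  refine ENNReal.ofReal_le_ofReal (le_of_eq ?_)
  have := integral_gaussian_Ioi (π * r ^ 2)
  rw [integral_const_mul]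
  have e : ∀ t : ℝ, exp (-(π * t ^ 2 * r ^ 2)) = exp (-(π * r ^ 2) * t ^ 2) := fun t => by ring_nf
  simp_rw [e, this]
  have : π / (π * r ^ 2) = r⁻¹ ^ 2 := by field_simp
  rw [this, sqrt_sq (by positivity)]
  ring

lemma continuous_fourierInv_of_integrable (hG : Integrable G) : Continuous (𝓕⁻ G) := by
  have h : (𝓕⁻ G) = fun x => ∫ v, Complex.exp (↑(2 * π * inner ℝ v x) * Complex.I) • G v :=
    funext fun x => fourierInv_eq' G x
  rw [h]
  refine continuous_of_dominated (fun x => (integrable_phase_smul hG x).1) (bound := fun v => ‖G v‖)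
    (fun x => .of_forall fun v => ?_) hG.norm (.of_forall fun v => by fun_prop)
  rw [norm_smul, Complex.norm_exp_ofReal_mul_I, one_mul]

/-- The heat-kernel superposition whose integral in `t` is `π⁻¹ ‖p - q‖⁻² ⟪G p, G q⟫`. -/
noncomputable def heatEnergy (G : E₃ → H₂) (t : ℝ) (z : E₃ × E₃) : ℝ :=
  2 * (t ^ 3)⁻¹ * exp (-(π * ‖z.1 - z.2‖ ^ 2 / t ^ 2)) * inner ℝ (G z.1) (G z.2)

lemma ae_offDiagonal : ∀ᵐ z : E₃ × E₃ ∂(volume.prod volume), 0 < π * ‖z.1 - z.2‖ ^ 2 := by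
  rw [Measure.ae_prod_iff_ae_ae]
  · refine .of_forall fun r => ?_
    filter_upwards [compl_mem_ae_iff.2 (measure_singleton r)] with s hs
    have : 0 < ‖r - s‖ := norm_pos_iff.2 (sub_ne_zero.2 fun h => hs h.symm)
    positivity
  · exact measurableSet_lt measurable_const (by fun_prop)

lemma norm_heatEnergy {t : ℝ} (ht : t ∈ Ioi (0 : ℝ)) (z : E₃ × E₃) :
    ‖heatEnergy G t z‖ = 2 * (t ^ 3)⁻¹ * exp (-(π * ‖z.1 - z.2‖ ^ 2 / t ^ 2)) *
      ‖(inner ℝ (G z.1) (G z.2) : ℝ)‖ := by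
  have ht : 0 < t := ht
  have h0 : 0 ≤ 2 * (t ^ 3)⁻¹ * exp (-(π * ‖z.1 - z.2‖ ^ 2 / t ^ 2)) := by positivity
  rw [heatEnergy, norm_mul, norm_of_nonneg h0]

lemma aestronglyMeasurable_heatEnergy (hG : Integrable G) :
    AEStronglyMeasurable (fun y : ℝ × (E₃ × E₃) => heatEnergy G y.1 y.2)
      ((volume.restrict (Ioi 0)).prod (volume.prod volume)) := by
  have hGm : AEStronglyMeasurable (fun z : E₃ × E₃ => (inner ℝ (G z.1) (G z.2) : ℝ))
      (volume.prod volume) := hG.1.comp_fst.inner hG.1.comp_snd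
  have hm : Measurable fun y : ℝ × (E₃ × E₃) =>
      2 * (y.1 ^ 3)⁻¹ * exp (-(π * ‖y.2.1 - y.2.2‖ ^ 2 / y.1 ^ 2)) := by fun_prop
  exact hm.aestronglyMeasurable.mul hGm.comp_snd

lemma integrable_heatEnergy (hG : Integrable G)
    (hK : Integrable (fun z : E₃ × E₃ => (‖z.1 - z.2‖ ^ 2)⁻¹ * inner ℝ (G z.1) (G z.2))
      (volume.prod volume)) :
    Integrable (fun y : ℝ × (E₃ × E₃) => heatEnergy G y.1 y.2)
      ((volume.restrict (Ioi 0)).prod (volume.prod volume)) := by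
  rw [integrable_prod_iff' (aestronglyMeasurable_heatEnergy hG)]
  constructor
  · filter_upwards [ae_offDiagonal] with z hz
    exact (heatWeight_integral hz).1.mul_const (inner ℝ (G z.1) (G z.2))
  · refine (hK.norm.const_mul π⁻¹).congr ?_
    filter_upwards [ae_offDiagonal] with z hz
    have e := setIntegral_congr_fun (μ := volume) measurableSet_Ioi
      fun t ht => norm_heatEnergy (G := G) ht z
    have h0 : 0 ≤ (‖z.1 - z.2‖ ^ 2)⁻¹ := by positivity
    rw [e, integral_mul_const, (heatWeight_integral hz).2, norm_mul, norm_of_nonneg h0,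
      mul_inv, mul_assoc]

lemma integral_heatEnergy (hG : Integrable G)
    (hK : Integrable (fun z : E₃ × E₃ => (‖z.1 - z.2‖ ^ 2)⁻¹ * inner ℝ (G z.1) (G z.2))
      (volume.prod volume)) :
    ∫ t in Ioi 0, ∫ z, heatEnergy G t z ∂(volume.prod volume) = π⁻¹ * ∫ z : E₃ × E₃,
      (‖z.1 - z.2‖ ^ 2)⁻¹ * inner ℝ (G z.1) (G z.2) ∂(volume.prod volume) := by
  rw [integral_integral_swap (f := fun t z => heatEnergy G t z) (integrable_heatEnergy hG hK),
    ← integral_const_mul]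
  refine integral_congr_ae ?_
  filter_upwards [ae_offDiagonal] with z hz
  simp only [heatEnergy]
  rw [integral_mul_const, (heatWeight_integral hz).2, mul_inv, mul_assoc]

lemma integral_heatEnergy_slice (hG : Integrable G) {t : ℝ} (ht : 0 < t) :
    ∫ z, heatEnergy G t z ∂(volume.prod volume) =
      ∫ x, 2 * (exp (-(π * t ^ 2 * ‖x‖ ^ 2)) * ‖(𝓕⁻ G) x‖ ^ 2) := by
  rw [integral_const_mul, (integral_gaussian_mul_norm_sq_fourierInv hG ht).2,
    ← integral_const_mul]
  simp only [heatEnergy, mul_assoc]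

lemma lintegral_gaussian_mul_norm_sq_fourierInv (hG : Integrable G) {t : ℝ} (ht : 0 < t) :
    ∫⁻ x, ENNReal.ofReal (2 * exp (-(π * t ^ 2 * ‖x‖ ^ 2))) *
      ENNReal.ofReal (‖(𝓕⁻ G) x‖ ^ 2) =
        ENNReal.ofReal (∫ z, heatEnergy G t z ∂(volume.prod volume)) := by
  rw [integral_heatEnergy_slice hG ht, ofReal_integral_eq_lintegral_ofReal
    ((integral_gaussian_mul_norm_sq_fourierInv hG ht).1.const_mul 2)
    (.of_forall fun x => by positivity)]
  refine lintegral_congr fun x => ?_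
  rw [← ENNReal.ofReal_mul (by positivity), mul_assoc]

/-- The Coulomb energy of `|𝓕⁻ G|²` is controlled by its momentum-space expression. -/
lemma lintegral_inv_norm_mul_norm_sq_fourierInv_le (hG : Integrable G)
    (hK : Integrable (fun z : E₃ × E₃ => (‖z.1 - z.2‖ ^ 2)⁻¹ * inner ℝ (G z.1) (G z.2))
      (volume.prod volume)) :
    ∫⁻ x, ENNReal.ofReal ‖x‖⁻¹ * ENNReal.ofReal (‖(𝓕⁻ G) x‖ ^ 2) ≤
      ENNReal.ofReal (π⁻¹ * ∫ z : E₃ × E₃, (‖z.1 - z.2‖ ^ 2)⁻¹ * inner ℝ (G z.1) (G z.2)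
        ∂(volume.prod volume)) := by
  have hχ : Continuous (𝓕⁻ G) := continuous_fourierInv_of_integrable hG
  set χ := 𝓕⁻ G with hχ'
  have hmJ : Measurable fun y : E₃ × ℝ => ENNReal.ofReal (2 * exp (-(π * y.2 ^ 2 * ‖y.1‖ ^ 2))) *
      ENNReal.ofReal (‖χ y.1‖ ^ 2) := by
    have h1 : Measurable fun y : E₃ × ℝ =>
        ENNReal.ofReal (2 * exp (-(π * y.2 ^ 2 * ‖y.1‖ ^ 2))) := by fun_prop
    exact h1.mul ((hχ.comp continuous_fst).norm.pow 2).measurable.ennreal_ofReal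
  calc ∫⁻ x, ENNReal.ofReal ‖x‖⁻¹ * ENNReal.ofReal (‖χ x‖ ^ 2)
      ≤ ∫⁻ x, ∫⁻ t in Ioi (0 : ℝ), ENNReal.ofReal (2 * exp (-(π * t ^ 2 * ‖x‖ ^ 2))) *
        ENNReal.ofReal (‖χ x‖ ^ 2) := by
        refine lintegral_mono fun x => ?_
        rw [lintegral_mul_const' _ _ ENNReal.ofReal_ne_top]
        gcongr
        exact ofReal_inv_norm_le (norm_nonneg x)
    _ = ∫⁻ t in Ioi (0 : ℝ), ∫⁻ x, ENNReal.ofReal (2 * exp (-(π * t ^ 2 * ‖x‖ ^ 2))) *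
        ENNReal.ofReal (‖χ x‖ ^ 2) := lintegral_lintegral_swap hmJ.aemeasurable
    _ = ∫⁻ t in Ioi (0 : ℝ), ENNReal.ofReal (∫ z, heatEnergy G t z ∂(volume.prod volume)) :=
        setLIntegral_congr_fun measurableSet_Ioi fun t ht =>
          lintegral_gaussian_mul_norm_sq_fourierInv hG ht
    _ = _ := by
        rw [← integral_heatEnergy hG hK, ofReal_integral_eq_lintegral_ofReal
          (integrable_heatEnergy hG hK).integral_prod_left]
        filter_upwards [ae_restrict_mem measurableSet_Ioi] with t ht
        rw [integral_heatEnergy_slice hG ht]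
        exact integral_nonneg fun x => by positivity

end CoulombEnergy

section TranslatedEnergy

open Set Metric
open scoped FourierTransform

local notation "E₃" => EuclideanSpace ℝ (Fin 3)
local notation "H₂" => EuclideanSpace ℂ (Fin 2)

lemma integrableOn_inv_norm_sq : IntegrableOn (fun w : E₃ => (‖w‖ ^ 2)⁻¹) (ball 0 1) := by
  rw [integrableOn_fun_norm_addHaar volume (f := fun r => (r ^ 2)⁻¹)]
  have h : IntegrableOn (fun _ : ℝ => (1 : ℝ)) (Ioo 0 1) := integrableOn_const (by simp)
  refine h.congr_fun (fun r hr => ?_) measurableSet_Ioo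
  have : r ≠ 0 := hr.1.ne'
  simp [this]

variable {f g : E₃ → H₂}

lemma integrable_inv_sq_mul_inner (hg : Integrable g) {C : ℝ} (hC : ∀ p, ‖g p‖ ≤ C)
    (hf : AEStronglyMeasurable f) (hfg : ∀ p, ‖f p‖ ≤ ‖g p‖) :
    Integrable (fun z : E₃ × E₃ => (‖z.1 - z.2‖ ^ 2)⁻¹ * inner ℝ (f z.1) (f z.2))
      (volume.prod volume) := by
  set k : E₃ → ℝ := indicator (ball 0 1) fun w => (‖w‖ ^ 2)⁻¹ with hk
  have hki : Integrable k := (integrable_indicator_iff measurableSet_ball).2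
    integrableOn_inv_norm_sq
  have h1 := hg.norm.convolution_integrand (ContinuousLinearMap.mul ℝ ℝ) hki
  have h2 := (h1.const_mul C).add (hg.norm.mul_prod hg.norm)
  have hm : Measurable fun z : E₃ × E₃ => (‖z.1 - z.2‖ ^ 2)⁻¹ := by fun_prop
  refine h2.mono' (hm.aestronglyMeasurable.mul (hf.comp_fst.inner hf.comp_snd))
    (.of_forall fun z => ?_)
  have h0 : 0 ≤ (‖z.1 - z.2‖ ^ 2)⁻¹ := by positivity
  have hin : ‖(inner ℝ (f z.1) (f z.2) : ℝ)‖ ≤ ‖g z.1‖ * ‖g z.2‖ :=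
    (norm_inner_le_norm _ _).trans (mul_le_mul (hfg _) (hfg _) (norm_nonneg _) (norm_nonneg _))
  rw [norm_mul, norm_of_nonneg h0]
  simp only [Pi.add_apply, ContinuousLinearMap.mul_apply']
  refine (mul_le_mul_of_nonneg_left hin h0).trans ?_
  have hgg : 0 ≤ ‖g z.1‖ * ‖g z.2‖ := by positivity
  by_cases hz : z.1 - z.2 ∈ ball (0 : E₃) 1
  · rw [hk, indicator_of_mem hz]
    have : ‖g z.1‖ * (‖g z.2‖ * (‖z.1 - z.2‖ ^ 2)⁻¹) ≤ C * (‖g z.2‖ * (‖z.1 - z.2‖ ^ 2)⁻¹) :=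
      mul_le_mul_of_nonneg_right (hC _) (by positivity)
    linarith
  · rw [hk, indicator_of_notMem hz]
    rw [mem_ball_zero_iff, not_lt] at hz
    have : (‖z.1 - z.2‖ ^ 2)⁻¹ ≤ 1 := inv_le_one_of_one_le₀ (one_le_pow₀ hz)
    have := mul_le_mul_of_nonneg_right this hgg
    linarith

/-- The pointwise action of the sign of `σ·p` on a momentum-space field. -/
noncomputable def pauliConj (g : E₃ → H₂) (p : E₃) : H₂ := pauliSign p (g p)

lemma aestronglyMeasurable_pauliConj (hg : Continuous g) :
    AEStronglyMeasurable (pauliConj g) volume := by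
  have h1 : Measurable fun p : E₃ => ‖p‖⁻¹ := by fun_prop
  have h2 : Continuous fun p : E₃ => pauliVec p (g p) := by fun_prop
  have h3 : pauliConj g = fun p => ‖p‖⁻¹ • pauliVec p (g p) := by
    funext p
    simp [pauliConj, pauliSign]
  rw [h3]
  exact h1.aestronglyMeasurable.smul h2.aestronglyMeasurable

lemma norm_pauliConj_le (p : E₃) : ‖pauliConj g p‖ ≤ ‖g p‖ := norm_pauliSign_le p (g p)

lemma integrable_pauliConj (hgc : Continuous g) (hg : Integrable g) : Integrable (pauliConj g) :=
  hg.norm.mono' (aestronglyMeasurable_pauliConj hgc) (.of_forall norm_pauliConj_le)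

lemma lintegral_inv_norm_mul_energy_le (hgc : Continuous g) (hg : Integrable g) {C : ℝ}
    (hC : ∀ p, ‖g p‖ ≤ C) :
    ∫⁻ x, ENNReal.ofReal ‖x‖⁻¹ * (ENNReal.ofReal (‖(𝓕⁻ g) x‖ ^ 2) +
      ENNReal.ofReal (‖(𝓕⁻ (pauliConj g)) x‖ ^ 2)) ≤
      ENNReal.ofReal (π ^ 2 + 4) * ∫⁻ p, ENNReal.ofReal (‖p‖ * ‖g p‖ ^ 2) := by
  have hs := integrable_pauliConj hgc hg
  have hK1 := integrable_inv_sq_mul_inner hg hC hg.1 fun _ => le_rfl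
  have hK2 := integrable_inv_sq_mul_inner hg hC hs.1 fun p => norm_pauliConj_le p
  have h1 := lintegral_inv_norm_mul_norm_sq_fourierInv_le hg hK1
  have h2 := lintegral_inv_norm_mul_norm_sq_fourierInv_le hs hK2
  have hn1 : 0 ≤ π⁻¹ * ∫ z : E₃ × E₃, (‖z.1 - z.2‖ ^ 2)⁻¹ * inner ℝ (g z.1) (g z.2)
      ∂(volume.prod volume) := by
    rw [← integral_heatEnergy hg hK1]
    refine setIntegral_nonneg measurableSet_Ioi fun t ht => ?_
    rw [integral_heatEnergy_slice hg ht]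
    exact integral_nonneg fun x => by positivity
  have hn2 : 0 ≤ π⁻¹ * ∫ z : E₃ × E₃, (‖z.1 - z.2‖ ^ 2)⁻¹ *
      inner ℝ (pauliConj g z.1) (pauliConj g z.2) ∂(volume.prod volume) := by
    rw [← integral_heatEnergy hs hK2]
    refine setIntegral_nonneg measurableSet_Ioi fun t ht => ?_
    rw [integral_heatEnergy_slice hs ht]
    exact integral_nonneg fun x => by positivity
  have hsum : ∫ z, momentumKernel g z ∂(volume.prod volume) =
      (∫ z : E₃ × E₃, (‖z.1 - z.2‖ ^ 2)⁻¹ * inner ℝ (g z.1) (g z.2) ∂(volume.prod volume)) +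
      ∫ z : E₃ × E₃, (‖z.1 - z.2‖ ^ 2)⁻¹ *
        inner ℝ (pauliConj g z.1) (pauliConj g z.2) ∂(volume.prod volume) := by
    rw [← integral_add hK1 hK2]
    refine integral_congr_ae (.of_forall fun z => ?_)
    simp only [momentumKernel, pauliConj, mul_add]
  have hB := ofReal_integral_momentumKernel_le hgc
  have hm : Measurable fun x : E₃ => ENNReal.ofReal ‖x‖⁻¹ * ENNReal.ofReal (‖(𝓕⁻ g) x‖ ^ 2) := by
    have h3 : Measurable fun x : E₃ => ENNReal.ofReal ‖x‖⁻¹ := by fun_prop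
    exact h3.mul ((continuous_fourierInv_of_integrable hg).norm.pow 2).measurable.ennreal_ofReal
  simp_rw [mul_add]
  rw [lintegral_add_left hm]
  refine (add_le_add h1 h2).trans ?_
  rw [← ENNReal.ofReal_add hn1 hn2, ← mul_add, ← hsum, ENNReal.ofReal_mul (by positivity)]
  refine (mul_le_mul_right hB _).trans (le_of_eq ?_)
  rw [← mul_assoc, ← ENNReal.ofReal_mul (by positivity)]
  congr 2
  field_simp

lemma fourierInv_phase_smul (g : E₃ → H₂) (x y : E₃) :
    (𝓕⁻ fun v => Complex.exp (((2 * π * inner ℝ v y : ℝ) : ℂ) * Complex.I) • g v) x = (𝓕⁻ g) (x + y) := by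
  rw [fourierInv_eq', fourierInv_eq']
  congr 1 with v : 1
  rw [smul_smul, ← Complex.exp_add, inner_add_right]
  congr 2
  push_cast
  ring

lemma lintegral_inv_norm_sub_mul_energy_le (hgc : Continuous g) (hg : Integrable g) {C : ℝ}
    (hC : ∀ p, ‖g p‖ ≤ C) (y : E₃) :
    ∫⁻ x, ENNReal.ofReal ‖x - y‖⁻¹ * (ENNReal.ofReal (‖(𝓕⁻ g) x‖ ^ 2) +
      ENNReal.ofReal (‖(𝓕⁻ (pauliConj g)) x‖ ^ 2)) ≤
      ENNReal.ofReal (π ^ 2 + 4) * ∫⁻ p, ENNReal.ofReal (‖p‖ * ‖g p‖ ^ 2) := by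
  set h : E₃ → H₂ := fun v => Complex.exp (((2 * π * inner ℝ v y : ℝ) : ℂ) * Complex.I) • g v with hh
  have hhc : Continuous h := by fun_prop
  have hhn : ∀ p, ‖h p‖ = ‖g p‖ := fun p => by
    rw [hh, norm_smul, Complex.norm_exp_ofReal_mul_I, one_mul]
  have hhs : pauliConj h = fun v =>
      Complex.exp (((2 * π * inner ℝ v y : ℝ) : ℂ) * Complex.I) • pauliConj g v := by
    funext p
    simp only [pauliConj, pauliSign, hh, pauliVec_complex_smul]
  have key := lintegral_inv_norm_mul_energy_le hhc (integrable_phase_smul hg y) (C := C)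
    fun p => (hhn p).trans_le (hC p)
  simp only [hhn, hhs] at key
  rw [hh] at key
  simp only [fourierInv_phase_smul] at key
  rw [← lintegral_add_right_eq_self _ y]
  simpa only [add_sub_cancel_right] using key

end TranslatedEnergy

section PauliPairing

open Set Metric
open scoped FourierTransform SchwartzMap

local notation "E₃" => EuclideanSpace ℝ (Fin 3)
local notation "H₂" => EuclideanSpace ℂ (Fin 2)

lemma pauliVec_eq_sum (p : E₃) (u : H₂) :
    pauliVec p u = ∑ j : Fin 3, p j • pauliVec (EuclideanSpace.single j 1) u := by
  ext i
  fin_cases i <;> simp [pauliVec_apply, Fin.sum_univ_three] <;> ring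

lemma fourier_pauliVec_comp {F : E₃ → H₂} (hF : Integrable F) (q p : E₃) :
    (𝓕 fun x => pauliVec q (F x)) p = pauliVec q ((𝓕 F) p) := by
  rw [fourier_eq', fourier_eq']
  have hi : Integrable fun v =>
      Complex.exp (((-2 * π * inner ℝ v p : ℝ) : ℂ) * Complex.I) • F v := by
    have hc : Continuous fun v : E₃ =>
      Complex.exp (((-2 * π * inner ℝ v p : ℝ) : ℂ) * Complex.I) := by fun_prop
    refine hF.norm.mono' (hc.aestronglyMeasurable.smul hF.1) (.of_forall fun v => ?_)
    rw [norm_smul, Complex.norm_exp_ofReal_mul_I, one_mul]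
  rw [← ContinuousLinearMap.integral_comp_comm _ hi]
  simp only [pauliVec_complex_smul]

lemma integral_inner_fourierInv {D F : E₃ → H₂} (hD : Integrable D) (hF : Integrable F) :
    ∫ p, (inner ℂ ((𝓕 D) p) (F p) : ℂ) = ∫ x, (inner ℂ (D x) ((𝓕⁻ F) x) : ℂ) := by
  have h := VectorFourier.integral_sesq_fourierIntegral_eq_neg_flip (innerSL ℂ)
    (L := innerₗ E₃) continuous_fourierChar continuous_inner hD hF
  rw [flip_innerₗ] at h
  exact h

lemma fourier_fderiv_apply (f : 𝓢(E₃, H₂)) (m p : E₃) :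
    (𝓕 fun x => fderiv ℝ f x m) p =
      (2 * π * Complex.I) • (inner ℝ p m : ℝ) • (𝓕 f : 𝓢(E₃, H₂)) p := by
  have hi : Integrable (fderiv ℝ f) := (SchwartzMap.fderivCLM ℝ E₃ H₂ f).integrable
  rw [← fourier_continuousLinearMap_apply hi, fourier_fderiv f.integrable f.differentiable hi]
  simp [SchwartzMap.fourier_coe]
  rfl

lemma integrable_fderiv_apply (f : 𝓢(E₃, H₂)) (m : E₃) : Integrable fun x => fderiv ℝ f x m :=
  (SchwartzMap.fderivCLM ℝ E₃ H₂ f).integrable.apply_continuousLinearMap m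

lemma pauliDeriv_eq_sum (f : E₃ → H₂) : pauliDeriv f = fun x => ∑ j : Fin 3,
    pauliVec (EuclideanSpace.single j 1) (fderiv ℝ f x (EuclideanSpace.single j 1)) :=
  funext (pauliDeriv_eq f)

lemma integrable_pauliDeriv (f : 𝓢(E₃, H₂)) : Integrable (pauliDeriv f) := by
  rw [pauliDeriv_eq_sum]
  exact integrable_finsetSum _ fun j _ =>
    ContinuousLinearMap.integrable_comp _ (integrable_fderiv_apply f _)

lemma fourier_pauliDeriv (f : 𝓢(E₃, H₂)) (p : E₃) :
    (𝓕 (pauliDeriv f)) p = (2 * π * Complex.I) • pauliVec p ((𝓕 f : 𝓢(E₃, H₂)) p) := by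
  have hs : (𝓕 (pauliDeriv f)) p = ∑ j : Fin 3, (𝓕 fun x => pauliVec (EuclideanSpace.single j 1)
      (fderiv ℝ f x (EuclideanSpace.single j 1))) p := by
    rw [pauliDeriv_eq_sum]
    simp only [fourier_eq', Finset.smul_sum]
    refine integral_finsetSum _ fun j _ => ?_
    have hF := ContinuousLinearMap.integrable_comp (pauliVec (EuclideanSpace.single j 1))
      (integrable_fderiv_apply f (EuclideanSpace.single j 1))
    have hc : Continuous fun v : E₃ =>
      Complex.exp (((-2 * π * inner ℝ v p : ℝ) : ℂ) * Complex.I) := by fun_prop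
    refine hF.norm.mono' (hc.aestronglyMeasurable.smul hF.1) (.of_forall fun v => ?_)
    rw [norm_smul, Complex.norm_exp_ofReal_mul_I, one_mul]
  rw [hs, pauliVec_eq_sum p, Finset.smul_sum]
  refine Finset.sum_congr rfl fun j _ => ?_
  rw [fourier_pauliVec_comp (integrable_fderiv_apply f _), fourier_fderiv_apply,
    pauliVec_complex_smul, map_smul, EuclideanSpace.inner_single_right]
  simp

lemma inner_pauliVec_pauliSign (p : E₃) (u : H₂) :
    (inner ℂ (pauliVec p u) (pauliSign p u) : ℂ) = ((‖p‖ * ‖u‖ ^ 2 : ℝ) : ℂ) := by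
  have h : pauliSign p u = ((‖p‖⁻¹ : ℝ) : ℂ) • pauliVec p u := by
    rw [pauliSign, map_smul, Complex.coe_smul, _root_.smul_apply]
  rw [h, inner_smul_right, inner_self_eq_norm_sq_to_K, norm_pauliVec]
  rcases eq_or_ne p 0 with rfl | hp
  · simp
  have : (‖p‖ : ℂ) ≠ 0 := by simpa using hp
  simp
  field_simp

lemma norm_fourierInv_le (F : E₃ → H₂) (x : E₃) : ‖(𝓕⁻ F) x‖ ≤ ∫ v, ‖F v‖ := by
  rw [fourierInv_eq']
  refine (norm_integral_le_integral_norm _).trans (le_of_eq ?_)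
  refine integral_congr_ae (.of_forall fun v => ?_)
  simp only [norm_smul, Complex.norm_exp_ofReal_mul_I, one_mul]

lemma integrable_norm_mul_norm_fourierInv {D F : E₃ → H₂} (hD : Integrable D)
    (hF : Integrable F) : Integrable fun x => ‖D x‖ * ‖(𝓕⁻ F) x‖ :=
  hD.norm.mul_bdd (c := ∫ v, ‖F v‖)
    (continuous_fourierInv_of_integrable hF).norm.aestronglyMeasurable
    (.of_forall fun x => by rw [norm_norm]; exact norm_fourierInv_le F x)

/-- The momentum form is the pairing of `σ·∇f` with the sign-flipped field. -/
lemma two_pi_mul_integral_le (f : 𝓢(E₃, H₂)) :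
    2 * π * ∫ p, ‖p‖ * ‖(𝓕 f : 𝓢(E₃, H₂)) p‖ ^ 2 ≤
      ∫ x, ‖pauliDeriv f x‖ * ‖(𝓕⁻ (pauliConj (𝓕 f : 𝓢(E₃, H₂)))) x‖ := by
  have hF := integrable_pauliConj (𝓕 f : 𝓢(E₃, H₂)).continuous (𝓕 f : 𝓢(E₃, H₂)).integrable
  have hp := integral_inner_fourierInv (integrable_pauliDeriv f) hF
  have h1 : ∀ p, (inner ℂ ((𝓕 (pauliDeriv f)) p) (pauliConj (𝓕 f : 𝓢(E₃, H₂)) p) : ℂ) =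
      (-(2 * π * Complex.I)) * ((‖p‖ * ‖(𝓕 f : 𝓢(E₃, H₂)) p‖ ^ 2 : ℝ) : ℂ) := by
    intro p
    rw [fourier_pauliDeriv, inner_smul_left, pauliConj, inner_pauliVec_pauliSign]
    simp [map_ofNat (starRingEnd ℂ) 2]
  simp_rw [h1] at hp
  rw [integral_const_mul, integral_complex_ofReal] at hp
  have h2 := congrArg norm hp
  have h0 : 0 ≤ ∫ p, ‖p‖ * ‖(𝓕 f : 𝓢(E₃, H₂)) p‖ ^ 2 := integral_nonneg fun p => by positivity
  rw [norm_mul, norm_neg, Complex.norm_real, norm_of_nonneg h0] at h2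
  simp only [norm_mul, Complex.norm_I, Complex.norm_real, Complex.norm_ofNat,
    norm_of_nonneg pi_pos.le, mul_one] at h2
  rw [h2]
  exact norm_integral_le_of_norm_le
    (integrable_norm_mul_norm_fourierInv (integrable_pauliDeriv f) hF)
    (.of_forall fun x => norm_inner_le_norm _ _)

end PauliPairing

section CoulombPotential

open Set Metric Filter

local notation "E₃" => EuclideanSpace ℝ (Fin 3)
local notation "H₂" => EuclideanSpace ℂ (Fin 2)

variable (μ : Measure E₃)

/-- The extended-real Coulomb potential of `μ`. -/
noncomputable def coulombENNReal (x : E₃) : ENNReal := ∫⁻ y, ENNReal.ofReal ‖x - y‖⁻¹ ∂μ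

lemma measurable_coulombENNReal [SFinite μ] : Measurable (coulombENNReal μ) :=
  Measurable.lintegral_prod_right' (f := fun z : E₃ × E₃ => ENNReal.ofReal ‖z.1 - z.2‖⁻¹)
    (by fun_prop)

lemma coulomb_eq_toReal (x : E₃) : coulomb μ x = (coulombENNReal μ x).toReal := rfl

lemma measurable_coulomb [SFinite μ] : Measurable (coulomb μ) := (measurable_coulombENNReal μ).ennreal_toReal

lemma coulomb_nonneg (x : E₃) : 0 ≤ coulomb μ x := ENNReal.toReal_nonneg

lemma exists_lower_bound_coulombENNReal [IsFiniteMeasure μ] (hμ : μ ≠ 0) (R : ℝ) :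
    ∃ c : ℝ, 0 < c ∧ ∀ᵐ x : E₃, ‖x‖ ≤ R → ENNReal.ofReal c ≤ coulombENNReal μ x := by
  obtain ⟨n, hn⟩ : ∃ n : ℕ, 0 < μ (closedBall 0 n) := by
    by_contra! h
    refine hμ (Measure.measure_univ_eq_zero.1 ?_)
    rw [← iUnion_closedBall_nat (0 : E₃)]
    exact measure_iUnion_null fun n => le_zero_iff.1 (h n)
  set r : ℝ := max R 0 + n + 1 with hr
  have hr0 : 0 < r := by positivity
  have hne : ∀ᵐ x : E₃, ∀ᵐ y ∂μ, x ≠ y := by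
    have hm : MeasurableSet {z : E₃ × E₃ | z.1 ≠ z.2} :=
      (measurableSet_eq_fun measurable_fst measurable_snd).compl
    have h : ∀ᵐ z : E₃ × E₃ ∂(Measure.prod volume μ), z.1 ≠ z.2 := by
      rw [← Measure.prod_swap, ae_map_iff measurable_swap.aemeasurable hm,
        Measure.ae_prod_iff_ae_ae]
      · refine .of_forall fun y => ?_
        filter_upwards [compl_mem_ae_iff.2 (measure_singleton y)] with x hx
        exact hx
      · exact measurable_swap hm
    exact Measure.ae_ae_of_ae_prod h
  refine ⟨r⁻¹ * μ.real (closedBall 0 n), ?_, ?_⟩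
  · exact mul_pos (inv_pos.2 hr0) (ENNReal.toReal_pos hn.ne' (measure_ne_top _ _))
  filter_upwards [hne] with x hx hxR
  calc ENNReal.ofReal (r⁻¹ * μ.real (closedBall 0 n))
      = ∫⁻ y in closedBall 0 n, ENNReal.ofReal r⁻¹ ∂μ := by
        rw [setLIntegral_const, ENNReal.ofReal_mul (by positivity), ofReal_measureReal]
    _ ≤ ∫⁻ y in closedBall 0 n, ENNReal.ofReal ‖x - y‖⁻¹ ∂μ := by
        refine setLIntegral_mono_ae (by fun_prop) ?_
        filter_upwards [hx] with y hy hyn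
        refine ENNReal.ofReal_le_ofReal (inv_anti₀ (norm_pos_iff.2 (sub_ne_zero.2 hy)) ?_)
        have h1 := norm_sub_le x y
        have h2 : ‖y‖ ≤ n := mem_closedBall_zero_iff.1 hyn
        have h3 := le_max_left R 0
        linarith
    _ ≤ coulombENNReal μ x := setLIntegral_le_lintegral _ _

lemma lintegral_coulombENNReal_mul_le [SFinite μ] {F : E₃ → ENNReal} (hF : Measurable F) {B : ENNReal}
    (hB : ∀ y, ∫⁻ x, ENNReal.ofReal ‖x - y‖⁻¹ * F x ≤ B) :
    ∫⁻ x, coulombENNReal μ x * F x ≤ B * μ univ := by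
  have hm : Measurable fun z : E₃ × E₃ => ENNReal.ofReal ‖z.1 - z.2‖⁻¹ * F z.1 :=
    (show Measurable fun z : E₃ × E₃ => ENNReal.ofReal ‖z.1 - z.2‖⁻¹ by fun_prop).mul
      (hF.comp measurable_fst)
  calc ∫⁻ x, coulombENNReal μ x * F x
      = ∫⁻ x, ∫⁻ y, ENNReal.ofReal ‖x - y‖⁻¹ * F x ∂μ := by
        refine lintegral_congr fun x => ?_
        rw [coulombENNReal, lintegral_mul_const _ (by fun_prop)]
    _ = ∫⁻ y, (∫⁻ x, ENNReal.ofReal ‖x - y‖⁻¹ * F x) ∂μ :=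
        lintegral_lintegral_swap hm.aemeasurable
    _ ≤ ∫⁻ _, B ∂μ := lintegral_mono hB
    _ = B * μ univ := lintegral_const _

variable [IsFiniteMeasure μ] {φ χ D : E₃ → H₂}

lemma measurable_ofReal_norm_sq_add (hφ : Continuous φ) (hχ : Continuous χ) :
    Measurable fun x => ENNReal.ofReal (‖φ x‖ ^ 2) + ENNReal.ofReal (‖χ x‖ ^ 2) :=
  (hφ.norm.pow 2).measurable.ennreal_ofReal.add (hχ.norm.pow 2).measurable.ennreal_ofReal

lemma ae_eq_zero_of_coulombENNReal_eq_top (hφ : Continuous φ) (hχ : Continuous χ) {b : ℝ}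
    (hen : ∀ y, ∫⁻ x, ENNReal.ofReal ‖x - y‖⁻¹ * (ENNReal.ofReal (‖φ x‖ ^ 2) +
      ENNReal.ofReal (‖χ x‖ ^ 2)) ≤ ENNReal.ofReal b) :
    ∀ᵐ x, coulombENNReal μ x = ⊤ → χ x = 0 := by
  have hF := measurable_ofReal_norm_sq_add hφ hχ
  have hm : Measurable fun x => coulombENNReal μ x * (ENNReal.ofReal (‖φ x‖ ^ 2) +
      ENNReal.ofReal (‖χ x‖ ^ 2)) := (measurable_coulombENNReal μ).mul hF
  have hlt := ((lintegral_coulombENNReal_mul_le μ hF hen).trans_lt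
    (ENNReal.mul_lt_top ENNReal.ofReal_lt_top (measure_lt_top _ _))).ne
  filter_upwards [ae_lt_top hm hlt] with x hx hx'
  by_contra hne
  have h2 : 0 < ‖χ x‖ := norm_pos_iff.2 hne
  have h3 : 0 < ENNReal.ofReal (‖χ x‖ ^ 2) := ENNReal.ofReal_pos.2 (by positivity)
  rw [hx', ENNReal.top_mul ((h3.trans_le le_add_self).ne')] at hx
  exact hx.ne rfl

lemma integrable_coulomb_mul_norm_sq_add (hφ : Continuous φ) (hχ : Continuous χ) {b : ℝ}
    (hb : 0 ≤ b)
    (hen : ∀ y, ∫⁻ x, ENNReal.ofReal ‖x - y‖⁻¹ * (ENNReal.ofReal (‖φ x‖ ^ 2) +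
      ENNReal.ofReal (‖χ x‖ ^ 2)) ≤ ENNReal.ofReal b) :
    Integrable (fun x => coulomb μ x * (‖φ x‖ ^ 2 + ‖χ x‖ ^ 2)) ∧
      ∫ x, coulomb μ x * (‖φ x‖ ^ 2 + ‖χ x‖ ^ 2) ≤ b * (μ univ).toReal := by
  have hA : ∫⁻ x, ENNReal.ofReal (coulomb μ x * (‖φ x‖ ^ 2 + ‖χ x‖ ^ 2)) ≤
      ENNReal.ofReal (b * (μ univ).toReal) := by
    rw [ENNReal.ofReal_mul hb, ENNReal.ofReal_toReal (measure_ne_top _ _)]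
    refine le_trans (lintegral_mono fun x => ?_)
      (lintegral_coulombENNReal_mul_le μ (measurable_ofReal_norm_sq_add hφ hχ) hen)
    rw [ENNReal.ofReal_mul (coulomb_nonneg μ x), ENNReal.ofReal_add (by positivity) (by positivity)]
    gcongr
    exact ENNReal.ofReal_toReal_le
  have hAm : Measurable fun x => coulomb μ x * (‖φ x‖ ^ 2 + ‖χ x‖ ^ 2) :=
    (measurable_coulomb μ).mul ((hφ.norm.pow 2).measurable.add (hχ.norm.pow 2).measurable)
  have hA0 : ∀ x, 0 ≤ coulomb μ x * (‖φ x‖ ^ 2 + ‖χ x‖ ^ 2) := fun x =>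
    mul_nonneg (coulomb_nonneg μ x) (by positivity)
  refine ⟨⟨hAm.aestronglyMeasurable, ?_⟩, ?_⟩
  · rw [hasFiniteIntegral_iff_ofReal (.of_forall hA0)]
    exact hA.trans_lt ENNReal.ofReal_lt_top
  · rw [integral_eq_lintegral_of_nonneg_ae (.of_forall hA0) hAm.aestronglyMeasurable]
    exact ENNReal.toReal_le_of_le_ofReal (by positivity) hA

lemma integrable_coulomb_mul_norm_sq (hφ : Continuous φ)
    (h : Integrable fun x => coulomb μ x * (‖φ x‖ ^ 2 + ‖χ x‖ ^ 2)) :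
    Integrable fun x => coulomb μ x * ‖φ x‖ ^ 2 := by
  refine h.mono' ((measurable_coulomb μ).mul (hφ.norm.pow 2).measurable).aestronglyMeasurable
    (.of_forall fun x => ?_)
  have h0 := coulomb_nonneg μ x
  rw [norm_of_nonneg (by positivity)]
  exact mul_le_mul_of_nonneg_left (by nlinarith [sq_nonneg ‖χ x‖]) h0

lemma exists_lower_bound_coulomb_of_hasCompactSupport (hμ : μ ≠ 0) (hDs : HasCompactSupport D) :
    ∃ c : ℝ, 0 < c ∧ ∀ᵐ x, D x ≠ 0 → coulombENNReal μ x ≠ ⊤ → c ≤ coulomb μ x := by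
  obtain ⟨R, hR⟩ := hDs.isCompact.isBounded.subset_closedBall (0 : E₃)
  obtain ⟨c, hc, hlow⟩ := exists_lower_bound_coulombENNReal μ hμ R
  refine ⟨c, hc, ?_⟩
  filter_upwards [hlow] with x hx hDx hV
  exact (ENNReal.ofReal_le_iff_le_toReal hV).1
    (hx (mem_closedBall_zero_iff.1 (hR (subset_tsupport D hDx))))

lemma integrable_norm_sq_div_coulomb (hμ : μ ≠ 0) (hD : Continuous D)
    (hDs : HasCompactSupport D) : Integrable fun x => ‖D x‖ ^ 2 / coulomb μ x := by
  obtain ⟨c, hc, hlow⟩ := exists_lower_bound_coulomb_of_hasCompactSupport μ hμ hDs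
  have hDs2 : HasCompactSupport fun x => ‖D x‖ ^ 2 :=
    hDs.mono fun x hx hx0 => hx (by simp [hx0])
  have hDi : Integrable fun x => ‖D x‖ ^ 2 :=
    (hD.norm.pow 2).integrable_of_hasCompactSupport hDs2
  have hm : Measurable fun x => ‖D x‖ ^ 2 / coulomb μ x :=
    (hD.norm.pow 2).measurable.div (measurable_coulomb μ)
  refine (hDi.const_mul c⁻¹).mono' hm.aestronglyMeasurable ?_
  filter_upwards [hlow] with x hx
  have h0 := coulomb_nonneg μ x
  rw [norm_of_nonneg (by positivity), div_eq_inv_mul]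
  by_cases hDx : D x = 0
  · simp [hDx]
  refine mul_le_mul_of_nonneg_right ?_ (by positivity)
  by_cases hV : coulombENNReal μ x = ⊤
  · rw [coulomb_eq_toReal, hV]
    simpa using hc.le
  · exact inv_anti₀ hc (hx hDx hV)

lemma ae_two_mul_norm_mul_norm_le (hμ : μ ≠ 0) (hDs : HasCompactSupport D)
    (hfin : ∀ᵐ x, coulombENNReal μ x = ⊤ → χ x = 0) {l : ℝ} (hl : 0 < l) :
    ∀ᵐ x, 2 * (‖D x‖ * ‖χ x‖) ≤
      l * (coulomb μ x * ‖χ x‖ ^ 2) + l⁻¹ * (‖D x‖ ^ 2 / coulomb μ x) := by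
  obtain ⟨c, hc, hlow⟩ := exists_lower_bound_coulomb_of_hasCompactSupport μ hμ hDs
  filter_upwards [hlow, hfin] with x hx hfx
  have h0 := coulomb_nonneg μ x
  have hrhs : 0 ≤ l * (coulomb μ x * ‖χ x‖ ^ 2) + l⁻¹ * (‖D x‖ ^ 2 / coulomb μ x) := by
    positivity
  by_cases hDx : D x = 0
  · simpa only [hDx, norm_zero, zero_mul, mul_zero] using hrhs
  by_cases hV : coulombENNReal μ x = ⊤
  · simpa only [hfx hV, norm_zero, mul_zero] using hrhs
  have hW : 0 < coulomb μ x := hc.trans_le (hx hDx hV)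
  have key : l * (coulomb μ x * ‖χ x‖ ^ 2) + l⁻¹ * (‖D x‖ ^ 2 / coulomb μ x) -
      2 * (‖D x‖ * ‖χ x‖) =
      (l * coulomb μ x)⁻¹ * (l * coulomb μ x * ‖χ x‖ - ‖D x‖) ^ 2 := by
    field_simp
    ring
  have : 0 ≤ (l * coulomb μ x)⁻¹ * (l * coulomb μ x * ‖χ x‖ - ‖D x‖) ^ 2 := by positivity
  linarith

/-- Young's inequality weighted by the Coulomb potential turns a pairing bound and an energy bound
into a Hardy inequality. -/
lemma hardy_of_pairing (hμ : μ ≠ 0) (hφ : Continuous φ) (hχ : Continuous χ) (hD : Continuous D)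
    (hDs : HasCompactSupport D) {κ T : ℝ} (hκ : 0 < κ) (hT : 0 ≤ T)
    (hpair : 2 * π * T ≤ ∫ x, ‖D x‖ * ‖χ x‖)
    (hen : ∀ y, ∫⁻ x, ENNReal.ofReal ‖x - y‖⁻¹ * (ENNReal.ofReal (‖φ x‖ ^ 2) +
      ENNReal.ofReal (‖χ x‖ ^ 2)) ≤ ENNReal.ofReal (κ * T)) :
    (4 * π / ((μ univ).toReal * κ)) ^ 2 * ∫ x, coulomb μ x * ‖φ x‖ ^ 2 ≤
      ∫ x, ‖D x‖ ^ 2 / coulomb μ x := by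
  have hm0 : 0 < (μ univ).toReal := ENNReal.toReal_pos (by simpa using hμ) (measure_ne_top _ _)
  obtain ⟨hAi, hA⟩ := integrable_coulomb_mul_norm_sq_add μ hφ hχ (by positivity) hen
  have hNi := integrable_coulomb_mul_norm_sq μ hφ hAi
  have hMi : Integrable fun x => coulomb μ x * ‖χ x‖ ^ 2 :=
    integrable_coulomb_mul_norm_sq μ (χ := φ) hχ (by simpa only [add_comm] using hAi)
  have hLi := integrable_norm_sq_div_coulomb μ hμ hD hDs
  have hPi : Integrable fun x => ‖D x‖ * ‖χ x‖ :=
    (hD.norm.mul hχ.norm).integrable_of_hasCompactSupport hDs.norm.mul_right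
  simp_rw [mul_add] at hA
  rw [integral_add hNi hMi] at hA
  generalize hm : (μ univ).toReal = m at hA hm0 ⊢
  set l : ℝ := 4 * π / (m * κ) with hl
  have hl0 : 0 < l := by positivity
  have hpw := ae_two_mul_norm_mul_norm_le μ hμ hDs
    (ae_eq_zero_of_coulombENNReal_eq_top μ hφ hχ hen) hl0
  have hsum := integral_mono_ae (hPi.const_mul 2)
    ((hMi.const_mul l).add (hLi.const_mul l⁻¹)) hpw
  simp only [Pi.add_apply] at hsum
  rw [integral_add (hMi.const_mul l) (hLi.const_mul l⁻¹), integral_const_mul, integral_const_mul,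
    integral_const_mul] at hsum
  have h1 := mul_le_mul_of_nonneg_left hA hl0.le
  have h2 : l * (κ * T * m) = 4 * π * T := by rw [hl]; field_simp
  rw [h2, mul_add] at h1
  have h3 : l * ∫ x, coulomb μ x * ‖φ x‖ ^ 2 ≤ l⁻¹ * ∫ x, ‖D x‖ ^ 2 / coulomb μ x := by
    linarith
  have h4 := mul_le_mul_of_nonneg_left h3 hl0.le
  rwa [← mul_assoc, ← mul_assoc, mul_inv_cancel₀ hl0.ne', one_mul, ← sq] at h4

end CoulombPotential

section HardyInequality

open scoped FourierTransform SchwartzMap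

theorem hardy_type_inequality_explicit_constant
    (μ : Measure (EuclideanSpace ℝ (Fin 3))) [IsFiniteMeasure μ] (hμ : μ ≠ 0)
    (φ : EuclideanSpace ℝ (Fin 3) → EuclideanSpace ℂ (Fin 2))
    (hφ : ContDiff ℝ (⊤ : ℕ∞) φ) (hsupp : HasCompactSupport φ) :
    ∫ x, ‖pauliDeriv φ x‖ ^ 2 / coulomb μ x ≥
      (16 * π ^ 2 / (π ^ 2 + 4) ^ 2) * ((μ Set.univ).toReal ^ 2)⁻¹ *
        ∫ x, coulomb μ x * ‖φ x‖ ^ 2 := by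
  set f : 𝓢(EuclideanSpace ℝ (Fin 3), EuclideanSpace ℂ (Fin 2)) := hsupp.toSchwartzMap hφ with hf
  have hfφ : (f : EuclideanSpace ℝ (Fin 3) → EuclideanSpace ℂ (Fin 2)) = φ := rfl
  set g : 𝓢(EuclideanSpace ℝ (Fin 3), EuclideanSpace ℂ (Fin 2)) := 𝓕 f with hg
  have hinv : 𝓕⁻ (g : EuclideanSpace ℝ (Fin 3) → EuclideanSpace ℂ (Fin 2)) = φ := by
    rw [← SchwartzMap.fourierInv_coe, hg, FourierTransform.fourierInv_fourier_eq, hfφ]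
  have hbd : ∀ p, ‖g p‖ ≤ ‖g.toBoundedContinuousFunction‖ := fun p =>
    g.toBoundedContinuousFunction.norm_coe_le_norm p
  have hTi : Integrable fun p => ‖p‖ * ‖g p‖ ^ 2 := by
    have h1 := (g.integrable_pow_mul volume 1).mul_bdd
      (c := ‖g.toBoundedContinuousFunction‖) g.continuous.norm.aestronglyMeasurable
      (.of_forall fun p => by rw [norm_norm]; exact hbd p)
    refine h1.congr (.of_forall fun p => ?_)
    simp only
    ring
  have hD : Continuous (pauliDeriv φ) := by
    rw [pauliDeriv_eq_sum]
    have := hφ.continuous_fderiv (by simp)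
    fun_prop
  have hDs : HasCompactSupport (pauliDeriv φ) := by
    refine (hsupp.fderiv ℝ).mono fun x hx hx0 => hx ?_
    rw [pauliDeriv_eq]
    simp [hx0]
  have hmain := hardy_of_pairing μ hμ hφ.continuous
    (continuous_fourierInv_of_integrable (integrable_pauliConj g.continuous g.integrable)) hD hDs
    (κ := π ^ 2 + 4) (by positivity) (integral_nonneg fun p => by positivity)
    (two_pi_mul_integral_le f) fun y => by
      have h := lintegral_inv_norm_sub_mul_energy_le g.continuous g.integrable hbd y
      rw [hinv, ← ofReal_integral_eq_lintegral_ofReal hTi (.of_forall fun p => by positivity),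
        ← ENNReal.ofReal_mul (by positivity)] at h
      exact h
  refine ge_iff_le.2 (le_trans (le_of_eq ?_) hmain)
  rw [div_pow, mul_pow, mul_pow, div_eq_mul_inv, div_eq_mul_inv, mul_inv]
  ring

end HardyInequality
end

section
/- There exists a universal constant C > 0 such that for every nonnegative finite Borel measure μ on ℝ³, every R ≥ 1, and every smooth compactly supported φ : ℝ³ → ℂ, one has ( ∫_{ℝ³} V_μ(x)²·|φ(x)|² dx )^{1/2} ≤ ( C·sup_{x∈ℝ³} μ(B̄_R(x)) + C·μ(ℝ³)/R )·( ∫_{ℝ³} (1 + 4π²‖ξ‖²)·|(𝓕φ)(ξ)|² dξ )^{1/2}. (This expresses the paper's bound ‖V_μ·(D₀)⁻¹‖ ≤ C·sup_x μ(B_R(x)) + C·μ(ℝ³)/R, since ‖D₀ψ‖² = ∫(1+4π²‖ξ‖²)|𝓕ψ|² dξ.) -/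
open MeasureTheory Real FourierTransform
open scoped SchwartzMap LineDeriv

lemma lintegral_eq_lintegral_toSphere_Ioi {E : Type*} [NormedAddCommGroup E] [NormedSpace ℝ E]
    [Nontrivial E] [FiniteDimensional ℝ E] [MeasurableSpace E] [BorelSpace E]
    (ν : Measure E) [ν.IsAddHaarMeasure] {f : E → ENNReal} (hf : Measurable f) :
    ∫⁻ x, f x ∂ν = ∫⁻ ω : Metric.sphere (0 : E) 1, (∫⁻ r in Set.Ioi (0 : ℝ),
      ENNReal.ofReal (r ^ (Module.finrank ℝ E - 1)) * f (r • (ω : E))) ∂ν.toSphere := by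
  have hmeas : Measurable fun p : Metric.sphere (0 : E) 1 × Set.Ioi (0 : ℝ) ↦
      f ((p.2 : ℝ) • (p.1 : E)) := hf.comp (by fun_prop)
  calc
    ∫⁻ x, f x ∂ν = ∫⁻ x in ({0}ᶜ : Set E), f x ∂ν := by
      rw [restrict_compl_singleton]
    _ = ∫⁻ x : ({0}ᶜ : Set E), f x ∂(ν.comap (↑)) :=
      (lintegral_subtype_comap (measurableSet_singleton _).compl f).symm
    _ = ∫⁻ p, f ((p.2 : ℝ) • (p.1 : E))
          ∂(ν.toSphere.prod (Measure.volumeIoiPow (Module.finrank ℝ E - 1))) := by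
      rw [← ν.measurePreserving_homeomorphUnitSphereProd.lintegral_comp hmeas]
      refine lintegral_congr fun x ↦ congrArg f ?_
      have hx : ‖(x : E)‖ ≠ 0 := norm_ne_zero_iff.2 x.2
      simp [smul_smul, hx]
    _ = _ := by
      rw [lintegral_prod _ hmeas.aemeasurable]
      refine lintegral_congr fun ω ↦ ?_
      have hω : Measurable fun r : ℝ ↦ f (r • (ω : E)) := hf.comp (by fun_prop)
      rw [Measure.volumeIoiPow]
      refine (lintegral_withDensity_eq_lintegral_mul _ (by fun_prop)
        (hω.comp measurable_subtype_coe)).trans ?_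
      exact lintegral_subtype_comap measurableSet_Ioi
        fun r : ℝ ↦ ENNReal.ofReal (r ^ (Module.finrank ℝ E - 1)) * f (r • (ω : E))

/-- A Hardy inequality on `[0, R]` for the weight `r ^ 2`, without boundary conditions. -/
lemma integral_norm_sq_le_integral_sq_mul {u u' : ℝ → ℂ} (hu : ∀ r, HasDerivAt u (u' r) r)
    (hu' : Continuous u') {R : ℝ} (hR : 1 ≤ R) :
    ∫ r in (0 : ℝ)..R, ‖u r‖ ^ 2 ≤
      8 * ∫ r in (0 : ℝ)..R, r ^ 2 * (‖u r‖ ^ 2 + ‖u' r‖ ^ 2) := by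
  have hR0 : 0 < R := by linarith
  have hc : Continuous u := continuous_iff_continuousAt.2 fun r ↦ (hu r).continuousAt
  set F' : ℝ → ℝ := fun r ↦
    (1 - 2 * r / R) * ‖u r‖ ^ 2 + (r - r ^ 2 / R) * (2 * inner ℝ (u r) (u' r))
  have hF' : Continuous F' := by fun_prop
  have hF : ∀ r, HasDerivAt (fun r ↦ (r - r ^ 2 / R) * ‖u r‖ ^ 2) (F' r) r := fun r ↦ by
    have h1 : HasDerivAt (fun r : ℝ ↦ r - r ^ 2 / R) (1 - 2 * r / R) r := by
      have := (hasDerivAt_id' r).fun_sub ((hasDerivAt_pow 2 r).div_const R)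
      simpa using this
    exact h1.mul (hu r).norm_sq
  have hzero : ∫ r in (0 : ℝ)..R, F' r = 0 := by
    rw [intervalIntegral.integral_eq_sub_of_hasDerivAt (fun r _ ↦ hF r)
      (hF'.intervalIntegrable _ _)]
    have : R - R ^ 2 / R = 0 := by field_simp; ring
    simp [this]
  have hpt : ∀ r ∈ Set.Icc 0 R, ‖u r‖ ^ 2 ≤
      2 * F' r + 8 * (r ^ 2 * (‖u r‖ ^ 2 + ‖u' r‖ ^ 2)) := by
    rintro r ⟨hr0, hrR⟩
    have hin : |inner ℝ (u r) (u' r)| ≤ ‖u r‖ * ‖u' r‖ := abs_real_inner_le_norm _ _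
    have hdiv : r / R ≤ r := div_le_self hr0 hR
    have hw0 : 0 ≤ r - r ^ 2 / R := by
      have : r ^ 2 / R ≤ r := by rw [div_le_iff₀ hR0]; nlinarith
      linarith
    have hw1 : r - r ^ 2 / R ≤ r := by
      have : 0 ≤ r ^ 2 / R := by positivity
      linarith
    have h1 : -(r * (‖u r‖ * ‖u' r‖)) ≤ (r - r ^ 2 / R) * inner ℝ (u r) (u' r) := by
      have := mul_le_mul hw1 hin (abs_nonneg _) hr0
      have h2 := neg_abs_le ((r - r ^ 2 / R) * inner ℝ (u r) (u' r))
      rw [abs_mul, abs_of_nonneg hw0] at h2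
      linarith
    have h2 : (1 - 2 * r) * ‖u r‖ ^ 2 ≤ (1 - 2 * r / R) * ‖u r‖ ^ 2 := by
      have : 2 * r / R = 2 * (r / R) := by ring
      gcongr
      linarith
    have h3 : 0 ≤ (2 * r - 1 / 2) ^ 2 * ‖u r‖ ^ 2 := by positivity
    have h4 : 0 ≤ (‖u r‖ / 2 - 2 * r * ‖u' r‖) ^ 2 := by positivity
    simp only [F']
    nlinarith
  calc
    ∫ r in (0 : ℝ)..R, ‖u r‖ ^ 2
      ≤ ∫ r in (0 : ℝ)..R, (2 * F' r + 8 * (r ^ 2 * (‖u r‖ ^ 2 + ‖u' r‖ ^ 2))) :=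
        intervalIntegral.integral_mono_on hR0.le
          (Continuous.intervalIntegrable (by fun_prop) _ _)
          (Continuous.intervalIntegrable (by fun_prop) _ _) hpt
    _ = _ := by
      rw [intervalIntegral.integral_add (Continuous.intervalIntegrable (by fun_prop) _ _)
        (Continuous.intervalIntegrable (by fun_prop) _ _), intervalIntegral.integral_const_mul,
        intervalIntegral.integral_const_mul, hzero]
      ring

lemma lintegral_norm_sq_le_lintegral_sq_mul {u u' : ℝ → ℂ} (hu : ∀ r, HasDerivAt u (u' r) r)
    (hu' : Continuous u') {R : ℝ} (hR : 1 ≤ R) :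
    ∫⁻ r in Set.Ioc 0 R, ENNReal.ofReal (‖u r‖ ^ 2) ≤
      8 * ∫⁻ r in Set.Ioc 0 R, ENNReal.ofReal (r ^ 2 * (‖u r‖ ^ 2 + ‖u' r‖ ^ 2)) := by
  have hR0 : 0 ≤ R := by linarith
  have hc : Continuous u := continuous_iff_continuousAt.2 fun r ↦ (hu r).continuousAt
  have key := integral_norm_sq_le_integral_sq_mul hu hu' hR
  rw [intervalIntegral.integral_of_le hR0, intervalIntegral.integral_of_le hR0] at key
  have hint {g : ℝ → ℝ} (hg : Continuous g) : IntegrableOn g (Set.Ioc 0 R) :=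
    (hg.integrableOn_Icc).mono_set Set.Ioc_subset_Icc_self
  rw [← ofReal_integral_eq_lintegral_ofReal (hint (by fun_prop))
      (ae_of_all _ fun r ↦ by positivity),
    ← ofReal_integral_eq_lintegral_ofReal (hint (by fun_prop))
      (ae_of_all _ fun r ↦ by positivity)]
  have h8 : (8 : ENNReal) = ENNReal.ofReal 8 := by simp
  rw [h8, ← ENNReal.ofReal_mul (by norm_num)]
  exact ENNReal.ofReal_le_ofReal key

lemma lintegral_closedBall_eq_lintegral_toSphere_Ioc {E : Type*} [NormedAddCommGroup E]
    [NormedSpace ℝ E] [Nontrivial E] [FiniteDimensional ℝ E] [MeasurableSpace E] [BorelSpace E]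
    (ν : Measure E) [ν.IsAddHaarMeasure] {f : E → ENNReal} (hf : Measurable f) (R : ℝ) :
    ∫⁻ x in Metric.closedBall 0 R, f x ∂ν =
      ∫⁻ ω : Metric.sphere (0 : E) 1, (∫⁻ r in Set.Ioc 0 R,
        ENNReal.ofReal (r ^ (Module.finrank ℝ E - 1)) * f (r • (ω : E))) ∂ν.toSphere := by
  rw [← lintegral_indicator Metric.isClosed_closedBall.measurableSet,
    lintegral_eq_lintegral_toSphere_Ioi ν
      (hf.indicator Metric.isClosed_closedBall.measurableSet)]
  refine lintegral_congr fun ω ↦ ?_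
  rw [← Set.Ioi_inter_Iic, Set.inter_comm, ← Measure.restrict_restrict measurableSet_Iic,
    ← lintegral_indicator measurableSet_Iic]
  refine setLIntegral_congr_fun measurableSet_Ioi fun r (hr : 0 < r) ↦ ?_
  have hmem : r • (ω : E) ∈ Metric.closedBall (0 : E) R ↔ r ∈ Set.Iic R := by
    simp [norm_smul, abs_of_pos hr]
  by_cases h : r ∈ Set.Iic R
  · simp only [Set.indicator_of_mem h, Set.indicator_of_mem (hmem.2 h)]
  · simp only [Set.indicator_of_notMem h, Set.indicator_of_notMem (mt hmem.1 h), mul_zero]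

lemma setLIntegral_closedBall_eq_add_right {E : Type*} [NormedAddCommGroup E] [MeasurableSpace E]
    [BorelSpace E] (ν : Measure E) [ν.IsAddRightInvariant] (f : E → ENNReal) (y : E) (R : ℝ) :
    ∫⁻ x in Metric.closedBall y R, f x ∂ν = ∫⁻ z in Metric.closedBall 0 R, f (z + y) ∂ν := by
  rw [← lintegral_indicator Metric.isClosed_closedBall.measurableSet,
    ← lintegral_indicator Metric.isClosed_closedBall.measurableSet,
    ← lintegral_add_right_eq_self _ y]
  refine lintegral_congr fun z ↦ ?_
  simp [Set.indicator, dist_eq_norm]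

/-- The Hardy inequality on a ball centred at the origin of a three-dimensional space. -/
lemma lintegral_closedBall_zero_hardy {E : Type*} [NormedAddCommGroup E]
    [NormedSpace ℝ E] [FiniteDimensional ℝ E] [MeasurableSpace E] [BorelSpace E]
    (hE : Module.finrank ℝ E = 3) (ν : Measure E) [ν.IsAddHaarMeasure] {φ : E → ℂ}
    (hφ : ContDiff ℝ 1 φ) {R : ℝ} (hR : 1 ≤ R) :
    ∫⁻ x in Metric.closedBall 0 R, ENNReal.ofReal ‖x‖⁻¹ ^ 2 * ENNReal.ofReal (‖φ x‖ ^ 2) ∂ν ≤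
      8 * ∫⁻ x in Metric.closedBall 0 R, ENNReal.ofReal (‖φ x‖ ^ 2 + ‖fderiv ℝ φ x‖ ^ 2) ∂ν := by
  have : Nontrivial E := Module.nontrivial_of_finrank_pos (R := ℝ) (by omega)
  have hc : Continuous φ := hφ.continuous
  have hc' : Continuous (fderiv ℝ φ) := hφ.continuous_fderiv one_ne_zero
  have hm : Measurable φ := hc.measurable
  have hmeas : Measurable fun x ↦ ENNReal.ofReal (‖φ x‖ ^ 2 + ‖fderiv ℝ φ x‖ ^ 2) :=
    ENNReal.measurable_ofReal.comp (Continuous.measurable (by fun_prop))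
  rw [lintegral_closedBall_eq_lintegral_toSphere_Ioc ν (by fun_prop),
    lintegral_closedBall_eq_lintegral_toSphere_Ioc ν hmeas,
    ← lintegral_const_mul' _ _ (by simp), hE]
  simp only [Nat.reduceSub]
  refine lintegral_mono fun ω ↦ ?_
  have hω : ‖(ω : E)‖ = 1 := by simp
  have hu : ∀ r : ℝ, HasDerivAt (fun r : ℝ ↦ φ (r • (ω : E)))
      (fderiv ℝ φ (r • (ω : E)) ω) r := fun r ↦ by
    have h1 : HasDerivAt (fun r : ℝ ↦ r • (ω : E)) (ω : E) r := by
      simpa using (hasDerivAt_id' r).smul_const (ω : E)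
    exact ((hφ.differentiable one_ne_zero).differentiableAt.hasFDerivAt).comp_hasDerivAt r h1
  calc
    _ = ∫⁻ r in Set.Ioc 0 R, ENNReal.ofReal (‖φ (r • (ω : E))‖ ^ 2) := by
      refine setLIntegral_congr_fun measurableSet_Ioc fun r hr ↦ ?_
      have hr0 : 0 < r := hr.1
      simp only [norm_smul, hω, Real.norm_eq_abs, abs_of_pos hr0, mul_one]
      rw [← mul_assoc, ← ENNReal.ofReal_pow (by positivity), ← ENNReal.ofReal_mul (by positivity),
        ← mul_pow, mul_inv_cancel₀ hr0.ne']
      simp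
    _ ≤ 8 * ∫⁻ r in Set.Ioc 0 R, ENNReal.ofReal (r ^ 2 * (‖φ (r • (ω : E))‖ ^ 2 +
          ‖fderiv ℝ φ (r • (ω : E)) ω‖ ^ 2)) :=
      lintegral_norm_sq_le_lintegral_sq_mul hu (by fun_prop) hR
    _ ≤ _ := by
      gcongr with r
      rw [← ENNReal.ofReal_mul (by positivity)]
      gcongr
      simpa [hω] using (fderiv ℝ φ (r • (ω : E))).le_opNorm (ω : E)

lemma lintegral_closedBall_hardy {E : Type*} [NormedAddCommGroup E]
    [NormedSpace ℝ E] [FiniteDimensional ℝ E] [MeasurableSpace E] [BorelSpace E]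
    (hE : Module.finrank ℝ E = 3) (ν : Measure E) [ν.IsAddHaarMeasure] {φ : E → ℂ}
    (hφ : ContDiff ℝ 1 φ) {R : ℝ} (hR : 1 ≤ R) (y : E) :
    ∫⁻ x in Metric.closedBall y R,
        ENNReal.ofReal ‖x - y‖⁻¹ ^ 2 * ENNReal.ofReal (‖φ x‖ ^ 2) ∂ν ≤
      8 * ∫⁻ x in Metric.closedBall y R, ENNReal.ofReal (‖φ x‖ ^ 2 + ‖fderiv ℝ φ x‖ ^ 2) ∂ν := by
  rw [setLIntegral_closedBall_eq_add_right, setLIntegral_closedBall_eq_add_right ν _ y]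
  have hφy : ContDiff ℝ 1 fun z ↦ φ (z + y) := hφ.comp (contDiff_id.add contDiff_const)
  simpa [fderiv_comp_add_right] using lintegral_closedBall_zero_hardy hE ν hφy hR

lemma lintegral_lintegral_closedBall_swap {E : Type*} [PseudoMetricSpace E]
    [SecondCountableTopology E] [MeasurableSpace E] [BorelSpace E] (μ ν : Measure E) [SFinite μ]
    [SFinite ν] {f : E → E → ENNReal} (hf : Measurable (Function.uncurry f)) (R : ℝ) :
    ∫⁻ x, ∫⁻ y in Metric.closedBall x R, f x y ∂μ ∂ν =
      ∫⁻ y, ∫⁻ x in Metric.closedBall y R, f x y ∂ν ∂μ := by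
  have hs : MeasurableSet {p : E × E | dist p.1 p.2 ≤ R} :=
    measurableSet_le (by fun_prop) measurable_const
  simp_rw [← lintegral_indicator Metric.isClosed_closedBall.measurableSet]
  have h1 (x y : E) : (Metric.closedBall x R).indicator (f x) y =
      {p : E × E | dist p.1 p.2 ≤ R}.indicator (Function.uncurry f) (x, y) := by
    simp [Set.indicator, dist_comm, Function.uncurry]
  have h2 (x y : E) : (Metric.closedBall y R).indicator (fun x ↦ f x y) x =
      {p : E × E | dist p.1 p.2 ≤ R}.indicator (Function.uncurry f) (x, y) := by
    simp [Set.indicator, Function.uncurry]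
  simp_rw [h1, h2]
  exact lintegral_lintegral_swap (hf.indicator hs).aemeasurable

lemma sq_lintegral_le_measure_mul_lintegral_sq {α : Type*} [MeasurableSpace α] (μ : Measure α)
    {f : α → ENNReal} (hf : Measurable f) :
    (∫⁻ a, f a ∂μ) ^ 2 ≤ μ Set.univ * ∫⁻ a, f a ^ 2 ∂μ := by
  have h := ENNReal.lintegral_mul_norm_pow_le (μ := μ) (f := fun _ ↦ 1) (g := fun a ↦ f a ^ 2)
    aemeasurable_const (hf.pow_const 2).aemeasurable (p := 1 / 2) (q := 1 / 2)
    (by norm_num) (by norm_num) (by norm_num)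
  have hsq (a : ENNReal) : (a ^ 2) ^ (1 / 2 : ℝ) = a := by
    rw [← ENNReal.rpow_natCast, ← ENNReal.rpow_mul]; simp
  have hsq' (a : ENNReal) : (a ^ (1 / 2 : ℝ)) ^ 2 = a := by
    rw [← ENNReal.rpow_natCast, ← ENNReal.rpow_mul]; simp
  simp only [ENNReal.one_rpow, one_mul, hsq, lintegral_const] at h
  calc
    _ ≤ _ := pow_le_pow_left' h 2
    _ = _ := by rw [mul_pow, hsq', hsq']

lemma sq_lintegral_inv_norm_sub_le {E : Type*} [NormedAddCommGroup E] [MeasurableSpace E]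
    [BorelSpace E] (μ : Measure E) {R : ℝ} (hR : 0 < R) (x : E) :
    (∫⁻ y, ENNReal.ofReal ‖x - y‖⁻¹ ∂μ) ^ 2 ≤
      2 * (μ (Metric.closedBall x R) *
        ∫⁻ y in Metric.closedBall x R, ENNReal.ofReal ‖x - y‖⁻¹ ^ 2 ∂μ) +
      2 * (ENNReal.ofReal R⁻¹ * μ Set.univ) ^ 2 := by
  have hB : MeasurableSet (Metric.closedBall x R) := Metric.isClosed_closedBall.measurableSet
  have hnear := sq_lintegral_le_measure_mul_lintegral_sq (μ.restrict (Metric.closedBall x R))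
    (f := fun y ↦ ENNReal.ofReal ‖x - y‖⁻¹)
    (ENNReal.measurable_ofReal.comp
      (by fun_prop : Continuous fun y ↦ ‖x - y‖).measurable.inv)
  rw [Measure.restrict_apply_univ] at hnear
  have hfar : ∫⁻ y in (Metric.closedBall x R)ᶜ, ENNReal.ofReal ‖x - y‖⁻¹ ∂μ ≤
      ENNReal.ofReal R⁻¹ * μ Set.univ := by
    calc
      _ ≤ ∫⁻ y in (Metric.closedBall x R)ᶜ, ENNReal.ofReal R⁻¹ ∂μ := by
        refine setLIntegral_mono measurable_const fun y hy ↦ ?_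
        have : R < ‖x - y‖ := by simpa [dist_eq_norm, norm_sub_rev] using hy
        gcongr
      _ ≤ _ := by
        rw [setLIntegral_const]
        gcongr
        exact Set.subset_univ _
  rw [← lintegral_add_compl _ hB, ← mul_add]
  have hsq (a b : ENNReal) : (a + b) ^ 2 ≤ 2 * (a ^ 2 + b ^ 2) := by
    have := ENNReal.rpow_add_le_mul_rpow_add_rpow a b (p := 2) (by norm_num)
    norm_num at this
    exact_mod_cast this
  refine (hsq _ _).trans ?_
  gcongr

lemma norm_sq_le_sum_norm_sq_apply {V F ι : Type*} [NormedAddCommGroup V] [InnerProductSpace ℝ V]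
    [NormedAddCommGroup F] [NormedSpace ℝ F] [Fintype ι] (b : OrthonormalBasis ι ℝ V)
    (L : V →L[ℝ] F) : ‖L‖ ^ 2 ≤ ∑ i, ‖L (b i)‖ ^ 2 := by
  have hL : ‖L‖ ≤ √(∑ i, ‖L (b i)‖ ^ 2) := by
    refine L.opNorm_le_bound (Real.sqrt_nonneg _) fun v ↦ ?_
    calc
      ‖L v‖ = ‖∑ i, b.repr v i • L (b i)‖ := by
        conv_lhs => rw [← b.sum_repr v, map_sum]
        simp_rw [map_smul]
      _ ≤ ∑ i, |b.repr v i| * ‖L (b i)‖ :=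
        (norm_sum_le _ _).trans_eq (by simp [norm_smul])
      _ ≤ √(∑ i, |b.repr v i| ^ 2) * √(∑ i, ‖L (b i)‖ ^ 2) :=
        Real.sum_mul_le_sqrt_mul_sqrt _ _ _
      _ = _ := by
        rw [mul_comm, ← b.repr.norm_map v, EuclideanSpace.norm_eq]
        simp
  calc
    ‖L‖ ^ 2 ≤ √(∑ i, ‖L (b i)‖ ^ 2) ^ 2 := by gcongr
    _ = _ := Real.sq_sqrt (by positivity)

lemma SchwartzMap.integrable_norm_sq {V F : Type*} [NormedAddCommGroup V] [NormedSpace ℝ V]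
    [MeasurableSpace V] [BorelSpace V] [SecondCountableTopology V] [NormedAddCommGroup F]
    [NormedSpace ℝ F] (ν : Measure V) [ν.HasTemperateGrowth] (f : 𝓢(V, F)) :
    Integrable (fun x ↦ ‖f x‖ ^ 2) ν :=
  (f.memLp 2 ν).integrable_norm_pow two_ne_zero

lemma SchwartzMap.lintegral_norm_sq_add_norm_fderiv_sq_le {V : Type*} [NormedAddCommGroup V]
    [InnerProductSpace ℝ V] [FiniteDimensional ℝ V] [MeasurableSpace V] [BorelSpace V]
    (f : 𝓢(V, ℂ)) :
    ∫⁻ x, ENNReal.ofReal (‖f x‖ ^ 2 + ‖fderiv ℝ f x‖ ^ 2) ≤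
      ENNReal.ofReal (∫ ξ, (1 + 4 * π ^ 2 * ‖ξ‖ ^ 2) * ‖𝓕 f ξ‖ ^ 2) := by
  let b := stdOrthonormalBasis ℝ V
  have hsymbol (ξ : V) : (1 + 4 * π ^ 2 * ‖ξ‖ ^ 2) * ‖𝓕 f ξ‖ ^ 2 =
      ‖𝓕 f ξ‖ ^ 2 + ∑ i, ‖𝓕 (∂_{b i} f) ξ‖ ^ 2 := by
    have hi (i) : ‖𝓕 (∂_{b i} f) ξ‖ ^ 2 =
        4 * π ^ 2 * ‖𝓕 f ξ‖ ^ 2 * ‖inner ℝ ξ (b i)‖ ^ 2 := by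
      have : (fun x : V ↦ inner ℝ x (b i)).HasTemperateGrowth := by fun_prop
      rw [SchwartzMap.fourier_lineDerivOp_eq, smul_apply,
        SchwartzMap.smulLeftCLM_apply_apply this]
      simp [mul_pow, abs_of_pos Real.pi_pos]
      ring
    simp_rw [hi, ← Finset.mul_sum, b.sum_sq_norm_inner_left]
    ring
  have hint (g : 𝓢(V, ℂ)) : Integrable fun x ↦ ‖g x‖ ^ 2 := g.integrable_norm_sq volume
  have hplancherel : ∫ ξ, (1 + 4 * π ^ 2 * ‖ξ‖ ^ 2) * ‖𝓕 f ξ‖ ^ 2 =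
      ∫ x, (‖f x‖ ^ 2 + ∑ i, ‖(∂_{b i} f) x‖ ^ 2) := by
    simp_rw [hsymbol]
    rw [integral_add (hint _) (integrable_finsetSum _ fun i _ ↦ hint _),
      integral_finsetSum _ fun i _ ↦ hint _,
      integral_add (hint _) (integrable_finsetSum _ fun i _ ↦ hint _),
      integral_finsetSum _ fun i _ ↦ hint _]
    simp_rw [SchwartzMap.integral_norm_sq_fourier]
  have hsum : Integrable fun x ↦ ‖f x‖ ^ 2 + ∑ i, ‖(∂_{b i} f) x‖ ^ 2 :=
    (hint _).add (integrable_finsetSum _ fun i _ ↦ hint _)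
  rw [hplancherel, ofReal_integral_eq_lintegral_ofReal hsum (ae_of_all _ fun x ↦ by positivity)]
  gcongr with x
  simpa [SchwartzMap.lineDerivOp_apply_eq_fderiv] using
    norm_sq_le_sum_norm_sq_apply b (fderiv ℝ f x)

/-- The potential estimate in `ℝ≥0∞`, with a bound `S` on the local masses. -/
lemma lintegral_sq_lintegral_inv_norm_sub_mul_le {E : Type*} [NormedAddCommGroup E]
    [NormedSpace ℝ E] [FiniteDimensional ℝ E] [MeasurableSpace E] [BorelSpace E]
    (hE : Module.finrank ℝ E = 3) (ν : Measure E) [ν.IsAddHaarMeasure] (μ : Measure E)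
    [IsFiniteMeasure μ] {φ : E → ℂ} (hφ : ContDiff ℝ 1 φ) {R : ℝ} (hR : 1 ≤ R)
    {S : ENNReal} (hS' : S ≠ ⊤) (hS : ∀ x, μ (Metric.closedBall x R) ≤ S) :
    ∫⁻ x, (∫⁻ y, ENNReal.ofReal ‖x - y‖⁻¹ ∂μ) ^ 2 * ENNReal.ofReal (‖φ x‖ ^ 2) ∂ν ≤
      (4 * S + 4 * (ENNReal.ofReal R⁻¹ * μ Set.univ)) ^ 2 *
        ∫⁻ x, ENNReal.ofReal (‖φ x‖ ^ 2 + ‖fderiv ℝ φ x‖ ^ 2) ∂ν := by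
  set p : E → ENNReal := fun x ↦ ENNReal.ofReal (‖φ x‖ ^ 2)
  set q : E → ENNReal := fun x ↦ ENNReal.ofReal (‖φ x‖ ^ 2 + ‖fderiv ℝ φ x‖ ^ 2)
  set m : ENNReal := ENNReal.ofReal R⁻¹ * μ Set.univ
  have hc : Continuous φ := hφ.continuous
  have hc' : Continuous (fderiv ℝ φ) := hφ.continuous_fderiv one_ne_zero
  have hp : Measurable p := ENNReal.measurable_ofReal.comp (Continuous.measurable (by fun_prop))
  have hq : Measurable q := ENNReal.measurable_ofReal.comp (Continuous.measurable (by fun_prop))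
  have hk : Measurable fun z : E × E ↦ ENNReal.ofReal ‖z.1 - z.2‖⁻¹ ^ 2 * p z.1 := by
    have : Continuous fun z : E × E ↦ ‖z.1 - z.2‖ := by fun_prop
    exact ((ENNReal.measurable_ofReal.comp this.measurable.inv).pow_const 2).mul
      (hp.comp measurable_fst)
  have hpq (x : E) : p x ≤ q x := ENNReal.ofReal_le_ofReal (by simp)
  have hnear : ∫⁻ x, ∫⁻ y in Metric.closedBall x R,
      ENNReal.ofReal ‖x - y‖⁻¹ ^ 2 * p x ∂μ ∂ν ≤ 8 * (S * ∫⁻ x, q x ∂ν) := by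
    rw [lintegral_lintegral_closedBall_swap μ ν
      (f := fun x y ↦ ENNReal.ofReal ‖x - y‖⁻¹ ^ 2 * p x) hk]
    calc
      _ ≤ ∫⁻ y, 8 * ∫⁻ x in Metric.closedBall y R, q x ∂ν ∂μ :=
        lintegral_mono fun y ↦ lintegral_closedBall_hardy hE ν hφ hR y
      _ = 8 * ∫⁻ x, q x * μ (Metric.closedBall x R) ∂ν := by
        rw [lintegral_const_mul' _ _ (by simp), lintegral_lintegral_closedBall_swap ν μ
          (f := fun _ x ↦ q x) (hq.comp measurable_snd)]
        simp_rw [setLIntegral_const]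
      _ ≤ 8 * ∫⁻ x, S * q x ∂ν := by
        refine mul_le_mul_right (lintegral_mono fun x ↦ ?_) 8
        rw [mul_comm S]
        exact mul_le_mul_right (hS x) _
      _ = _ := by rw [lintegral_const_mul _ hq]
  calc
    _ ≤ ∫⁻ x, (2 * S * ∫⁻ y in Metric.closedBall x R,
          ENNReal.ofReal ‖x - y‖⁻¹ ^ 2 * p x ∂μ) + 2 * m ^ 2 * q x ∂ν := by
      refine lintegral_mono fun x ↦ ?_
      rw [lintegral_mul_const' _ _ ENNReal.ofReal_ne_top]
      calc
        _ ≤ (2 * (S * ∫⁻ y in Metric.closedBall x R, ENNReal.ofReal ‖x - y‖⁻¹ ^ 2 ∂μ) +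
              2 * m ^ 2) * p x := by
          gcongr
          refine (sq_lintegral_inv_norm_sub_le μ (by linarith) x).trans ?_
          gcongr
          exact hS x
        _ ≤ _ := by
          rw [add_mul, ← mul_assoc, ← mul_assoc]
          gcongr
          exact hpq x
    _ ≤ 2 * S * (8 * (S * ∫⁻ x, q x ∂ν)) + 2 * m ^ 2 * ∫⁻ x, q x ∂ν := by
      rw [lintegral_add_right _ (hq.const_mul _), lintegral_const_mul _ hq,
        lintegral_const_mul' _ _ (ENNReal.mul_ne_top (by simp) hS')]
      gcongr
    _ = (16 * S ^ 2 + 2 * m ^ 2) * ∫⁻ x, q x ∂ν := by ring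
    _ ≤ (16 * S ^ 2 + 2 * m ^ 2 + (32 * S * m + 14 * m ^ 2)) * ∫⁻ x, q x ∂ν := by
      gcongr ?_ * _
      exact le_self_add
    _ = _ := by ring

theorem coulomb_bound_by_largest_local_mass :
    ∃ C : ℝ, 0 < C ∧
      ∀ (μ : Measure (EuclideanSpace ℝ (Fin 3))), IsFiniteMeasure μ →
        ∀ R : ℝ, 1 ≤ R →
          ∀ φ : EuclideanSpace ℝ (Fin 3) → ℂ,
            ContDiff ℝ (⊤ : ℕ∞) φ → HasCompactSupport φ →
            Real.sqrt (∫ x, coulomb μ x ^ 2 * ‖φ x‖ ^ 2) ≤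
              (C * (⨆ x : EuclideanSpace ℝ (Fin 3),
                  (μ (Metric.closedBall x R)).toReal) +
                C * (μ Set.univ).toReal / R) *
              Real.sqrt (∫ ξ, (1 + 4 * π ^ 2 * ‖ξ‖ ^ 2) * ‖𝓕 φ ξ‖ ^ 2) := by
  refine ⟨4, by norm_num, fun μ _ R hR φ hφ hsupp ↦ ?_⟩
  have hR0 : 0 < R := by linarith
  set s : ℝ := ⨆ x : EuclideanSpace ℝ (Fin 3), (μ (Metric.closedBall x R)).toReal
  set K : ℝ := ∫ ξ, (1 + 4 * π ^ 2 * ‖ξ‖ ^ 2) * ‖𝓕 φ ξ‖ ^ 2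
  have hK : 0 ≤ K := integral_nonneg fun ξ ↦ by positivity
  have hbdd : BddAbove (Set.range fun x : EuclideanSpace ℝ (Fin 3) ↦
      (μ (Metric.closedBall x R)).toReal) :=
    ⟨(μ Set.univ).toReal, Set.forall_mem_range.2 fun x ↦
      ENNReal.toReal_mono (measure_ne_top _ _) (measure_mono (Set.subset_univ _))⟩
  have hs (x) : μ (Metric.closedBall x R) ≤ ENNReal.ofReal s :=
    (ENNReal.le_ofReal_iff_toReal_le (measure_ne_top _ _)
      (Real.iSup_nonneg fun _ ↦ ENNReal.toReal_nonneg)).2 (le_ciSup hbdd x)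
  have hs0 : 0 ≤ s := Real.iSup_nonneg fun _ ↦ ENNReal.toReal_nonneg
  set A : ℝ := 4 * s + 4 * (μ Set.univ).toReal / R
  have hA : 0 ≤ A := by positivity
  have hAeq : 4 * ENNReal.ofReal s + 4 * (ENNReal.ofReal R⁻¹ * μ Set.univ) =
      ENNReal.ofReal A := by
    rw [ENNReal.ofReal_add (by positivity) (by positivity), mul_div_assoc,
      ENNReal.ofReal_mul (by norm_num), ENNReal.ofReal_mul (by norm_num), div_eq_inv_mul,
      ENNReal.ofReal_mul (by positivity), ENNReal.ofReal_toReal (measure_ne_top _ _)]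
    simp
  have hfourier : ∫⁻ x, ENNReal.ofReal (‖φ x‖ ^ 2 + ‖fderiv ℝ φ x‖ ^ 2) ≤ ENNReal.ofReal K :=
    (hsupp.toSchwartzMap hφ).lintegral_norm_sq_add_norm_fderiv_sq_le
  have hmain := (lintegral_sq_lintegral_inv_norm_sub_mul_le (by simp) volume μ
    (hφ.of_le (by exact_mod_cast le_top)) hR ENNReal.ofReal_ne_top hs).trans
    (mul_le_mul_right hfourier _)
  rw [hAeq, ← ENNReal.ofReal_pow hA, ← ENNReal.ofReal_mul (by positivity)] at hmain
  have hle : ∫ x, coulomb μ x ^ 2 * ‖φ x‖ ^ 2 ≤ A ^ 2 * K := by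
    refine (Real.le_norm_self _).trans ((norm_integral_le_lintegral_norm _).trans ?_)
    refine ENNReal.toReal_le_of_le_ofReal (by positivity) (le_trans ?_ hmain)
    gcongr with x
    rw [Real.norm_of_nonneg (by positivity), ENNReal.ofReal_mul (by positivity),
      ENNReal.ofReal_pow (by exact ENNReal.toReal_nonneg)]
    gcongr
    exact ENNReal.ofReal_toReal_le
  calc
    _ ≤ √(A ^ 2 * K) := Real.sqrt_le_sqrt hle
    _ = _ := by rw [Real.sqrt_mul (by positivity), Real.sqrt_sq hA]
end

section
/- Let (μ_n) be a sequence of nonnegative finite Borel measures on ℝ³ converging tightly to a nonnegative finite Borel measure μ, i.e. ∫_{ℝ³} f dμ_n → ∫_{ℝ³} f dμ for every bounded continuous f : ℝ³ → ℝ. Then V_{μ_n} → V_μ in L²(ℝ³) + L^∞(ℝ³): there exist measurable functions f_n, g_n : ℝ³ → ℝ with V_{μ_n} − V_μ = f_n + g_n almost everywhere, ‖f_n‖_{L²(ℝ³)} → 0 and ‖g_n‖_{L^∞(ℝ³)} → 0. -/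
open MeasureTheory Real Filter

section
open Topology

lemma exists_tendsto_zero_of_forall_eventually_le {ι : Type*} [Nonempty ι] {F : ℕ → ι → ENNReal}
    (hF : ∀ δ : ENNReal, 0 < δ → ∃ k, ∀ᶠ n in atTop, F n k ≤ δ) :
    ∃ k : ℕ → ι, Tendsto (fun n => F n (k n)) atTop (𝓝 0) := by
  have h1 : ∀ n, ∃ k, F n k ≤ (⨅ j, F n j) + ((n : ENNReal) + 1)⁻¹ := by
    intro n
    by_cases ht : (⨅ j, F n j) = ⊤
    · exact ⟨Classical.arbitrary ι, by simp [ht]⟩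
    · have : (⨅ j, F n j) < (⨅ j, F n j) + ((n : ENNReal) + 1)⁻¹ :=
        ENNReal.lt_add_right ht (by simp [ENNReal.add_eq_top])
      obtain ⟨k, hk⟩ := iInf_lt_iff.1 this
      exact ⟨k, hk.le⟩
  choose k hk using h1
  refine ⟨k, ?_⟩
  have h2 : Tendsto (fun n => ⨅ j, F n j) atTop (𝓝 0) := by
    rw [ENNReal.tendsto_nhds_zero]
    intro δ hδ
    obtain ⟨j, hj⟩ := hF δ hδ
    filter_upwards [hj] with n hn
    exact (iInf_le _ j).trans hn
  have h3 : Tendsto (fun n : ℕ => ((n : ENNReal) + 1)⁻¹) atTop (𝓝 0) := by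
    have := (tendsto_add_atTop_iff_nat 1).2 ENNReal.tendsto_inv_nat_nhds_zero
    simpa using this
  have h4 := h2.add h3
  rw [add_zero] at h4
  exact tendsto_of_tendsto_of_tendsto_of_le_of_le tendsto_const_nhds h4
    (fun _ => zero_le) hk

/-- The Coulomb kernel `‖z‖⁻¹` truncated at radius `ε`. -/
noncomputable def truncatedKernel {E : Type*} [Norm E] (ε : ℝ) (z : E) : ℝ := (max ‖z‖ ε)⁻¹

section truncatedKernel
variable {E : Type*} [NormedAddCommGroup E] {ε : ℝ}

lemma truncatedKernel_nonneg (hε : 0 < ε) (z : E) : 0 ≤ truncatedKernel ε z :=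
  inv_nonneg.2 (hε.le.trans (le_max_right _ _))

lemma truncatedKernel_le (hε : 0 < ε) (z : E) : truncatedKernel ε z ≤ ε⁻¹ :=
  inv_anti₀ hε (le_max_right _ _)

lemma abs_truncatedKernel_le (hε : 0 < ε) (z : E) : |truncatedKernel ε z| ≤ ε⁻¹ := by
  rw [abs_of_nonneg (truncatedKernel_nonneg hε z)]
  exact truncatedKernel_le hε z

lemma continuous_truncatedKernel (hε : 0 < ε) : Continuous (truncatedKernel ε : E → ℝ) :=
  (continuous_norm.max continuous_const).inv₀ fun _ => (lt_max_of_lt_right hε).ne'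

lemma abs_truncatedKernel_sub_le (hε : 0 < ε) (z w : E) :
    |truncatedKernel ε z - truncatedKernel ε w| ≤ ε⁻¹ * ε⁻¹ * ‖z - w‖ := by
  have hz : 0 < max ‖z‖ ε := lt_max_of_lt_right hε
  have hw : 0 < max ‖w‖ ε := lt_max_of_lt_right hε
  have h : truncatedKernel ε z - truncatedKernel ε w
      = (max ‖z‖ ε)⁻¹ * (max ‖w‖ ε)⁻¹ * (max ‖w‖ ε - max ‖z‖ ε) := by
    unfold truncatedKernel
    field_simp
  have h1 : |max ‖w‖ ε - max ‖z‖ ε| ≤ ‖z - w‖ := by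
    refine (abs_max_sub_max_le_abs _ _ _).trans ?_
    rw [norm_sub_rev]
    exact abs_norm_sub_norm_le w z
  rw [h, abs_mul, abs_of_nonneg (by positivity)]
  gcongr <;> exact le_max_right _ _

lemma truncatedKernel_sub_le {R : ℝ} (hε : 0 < ε) (hR : 0 < R) {x : E} (hx : 2 * R ≤ ‖x‖) (y : E) :
    truncatedKernel ε (x - y) ≤ ε⁻¹ * min 1 (‖y‖ / R) + R⁻¹ := by
  have hR' : 0 < R⁻¹ := inv_pos.2 hR
  by_cases hy : R ≤ ‖y‖
  · rw [min_eq_left ((one_le_div hR).2 hy)]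
    linarith [truncatedKernel_le hε (x - y)]
  · have h1 : R ≤ ‖x - y‖ := by
      have := norm_sub_norm_le x y
      linarith
    have h2 : truncatedKernel ε (x - y) ≤ R⁻¹ := inv_anti₀ hR (h1.trans (le_max_left _ _))
    have h3 : 0 ≤ ε⁻¹ * min 1 (‖y‖ / R) := by positivity
    linarith

variable [MeasurableSpace E] [BorelSpace E]

lemma integrable_truncatedKernel_sub (hε : 0 < ε) (ν : Measure E) [IsFiniteMeasure ν] (x : E) :
    Integrable (fun y => truncatedKernel ε (x - y)) ν :=
  Integrable.of_bound
    ((continuous_truncatedKernel hε).comp (continuous_const.sub continuous_id)).aestronglyMeasurable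
    ε⁻¹ (ae_of_all _ fun _ => abs_truncatedKernel_le hε _)

lemma abs_integral_truncatedKernel_sub_le (hε : 0 < ε) (ν : Measure E) [IsFiniteMeasure ν]
    (x x' : E) :
    |∫ y, truncatedKernel ε (x - y) ∂ν - ∫ y, truncatedKernel ε (x' - y) ∂ν|
      ≤ ε⁻¹ * ε⁻¹ * ‖x - x'‖ * ν.real Set.univ := by
  rw [← integral_sub (integrable_truncatedKernel_sub hε ν x)
    (integrable_truncatedKernel_sub hε ν x'), ← Real.norm_eq_abs]
  refine norm_integral_le_of_norm_le_const (ae_of_all _ fun y => ?_)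
  simpa using abs_truncatedKernel_sub_le hε (x - y) (x' - y)

lemma integral_truncatedKernel_le {R : ℝ} (hε : 0 < ε) (hR : 0 < R) (ν : Measure E)
    [IsFiniteMeasure ν] {x : E} (hx : 2 * R ≤ ‖x‖) :
    ∫ y, truncatedKernel ε (x - y) ∂ν
      ≤ ε⁻¹ * ∫ y, min 1 (‖y‖ / R) ∂ν + R⁻¹ * ν.real Set.univ := by
  have hi : Integrable (fun y : E => min 1 (‖y‖ / R)) ν := by
    refine Integrable.of_bound (C := 1) (Continuous.aestronglyMeasurable (by fun_prop))
      (ae_of_all _ fun y => ?_)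
    rw [Real.norm_eq_abs, abs_of_nonneg (by positivity)]
    exact min_le_left _ _
  calc ∫ y, truncatedKernel ε (x - y) ∂ν
      ≤ ∫ y, (ε⁻¹ * min 1 (‖y‖ / R) + R⁻¹) ∂ν :=
        integral_mono (integrable_truncatedKernel_sub hε ν x)
          ((hi.const_mul _).add (integrable_const _)) fun y => truncatedKernel_sub_le hε hR hx y
    _ = _ := by
        rw [integral_add (hi.const_mul _) (integrable_const _), integral_const_mul,
          integral_const, smul_eq_mul, mul_comm R⁻¹]

lemma tendsto_integral_min_norm_div (ν : Measure E) [IsFiniteMeasure ν] :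
    Tendsto (fun R : ℝ => ∫ y, min 1 (‖y‖ / R) ∂ν) atTop (𝓝 0) := by
  have := tendsto_integral_filter_of_dominated_convergence (μ := ν) (l := (atTop : Filter ℝ))
    (F := fun R y => min 1 (‖y‖ / R)) (f := fun _ => (0 : ℝ)) (fun _ => 1)
    (Eventually.of_forall fun R => Continuous.aestronglyMeasurable (by fun_prop))
    (by
      filter_upwards [eventually_gt_atTop 0] with R hR
      refine ae_of_all _ fun y => ?_
      rw [Real.norm_eq_abs, abs_of_nonneg (by positivity)]
      exact min_le_left _ _)
    (integrable_const _)
    (ae_of_all _ fun y => by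
      have : Tendsto (fun R : ℝ => min 1 (‖y‖ / R)) atTop (𝓝 (min 1 0)) :=
        tendsto_const_nhds.min (tendsto_const_nhds.div_atTop tendsto_id)
      simpa using this)
  simpa using this

/-- Truncated Coulomb potentials converge uniformly under tight convergence. -/
lemma eventually_forall_abs_integral_truncatedKernel_sub_le [ProperSpace E]
    {μn : ℕ → Measure E} {μ : Measure E} [∀ n, IsFiniteMeasure (μn n)] [IsFiniteMeasure μ]
    (htight : ∀ f : E → ℝ, Continuous f → (∃ M : ℝ, ∀ x, |f x| ≤ M) →
      Tendsto (fun n => ∫ x, f x ∂(μn n)) atTop (𝓝 (∫ x, f x ∂μ)))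
    (hε : 0 < ε) {δ : ℝ} (hδ : 0 < δ) :
    ∀ᶠ n in atTop, ∀ x, |∫ y, truncatedKernel ε (x - y) ∂(μn n)
      - ∫ y, truncatedKernel ε (x - y) ∂μ| ≤ δ := by
  have hmass : Tendsto (fun n => (μn n).real Set.univ) atTop (𝓝 (μ.real Set.univ)) := by
    simpa using htight (fun _ => 1) continuous_const ⟨1, by simp⟩
  set M : ℝ := μ.real Set.univ + 1 with hM
  have hMpos : 0 < M := by positivity
  have hM' : μ.real Set.univ ≤ M := by linarith
  have hMn : ∀ᶠ n in atTop, (μn n).real Set.univ ≤ M :=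
    (hmass.eventually (gt_mem_nhds (by linarith : μ.real Set.univ < M))).mono fun _ h => h.le
  obtain ⟨R, hR, hR1, hR2⟩ : ∃ R : ℝ, 0 < R ∧ ε⁻¹ * ∫ y, min 1 (‖y‖ / R) ∂μ < δ / 2
      ∧ R⁻¹ * M < δ / 2 := by
    have h1 := (tendsto_integral_min_norm_div μ).const_mul ε⁻¹
    have h2 := (tendsto_inv_atTop_zero (𝕜 := ℝ)).mul_const M
    rw [mul_zero] at h1
    rw [zero_mul] at h2
    exact ((eventually_gt_atTop 0).and ((h1.eventually (gt_mem_nhds (half_pos hδ))).and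
      (h2.eventually (gt_mem_nhds (half_pos hδ))))).exists
  have htail : ∀ᶠ n in atTop, ε⁻¹ * ∫ y, min 1 (‖y‖ / R) ∂(μn n) < δ / 2 := by
    refine ((htight (fun y => min 1 (‖y‖ / R)) (by fun_prop) ⟨1, fun y => ?_⟩).const_mul
      ε⁻¹).eventually (gt_mem_nhds hR1)
    rw [abs_of_nonneg (by positivity)]
    exact min_le_left _ _
  set r : ℝ := δ / 3 / (ε⁻¹ * ε⁻¹ * M) with hr
  have hrpos : 0 < r := by positivity
  have hrM : ε⁻¹ * ε⁻¹ * r * M = δ / 3 := by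
    rw [hr]; field_simp
  obtain ⟨t, -, htf, htc⟩ := (isCompact_closedBall (0 : E) (2 * R)).finite_cover_balls hrpos
  have hpt : ∀ᶠ n in atTop, ∀ x ∈ t, |∫ y, truncatedKernel ε (x - y) ∂(μn n)
      - ∫ y, truncatedKernel ε (x - y) ∂μ| < δ / 3 := by
    refine (eventually_all_finite htf).2 fun x _ => ?_
    have := htight (fun y => truncatedKernel ε (x - y))
      ((continuous_truncatedKernel hε).comp (continuous_const.sub continuous_id))
      ⟨ε⁻¹, fun y => abs_truncatedKernel_le hε _⟩
    exact (Metric.tendsto_nhds.1 this) _ (by positivity)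
  filter_upwards [hMn, htail, hpt] with n hn1 hn2 hn3 x
  by_cases hx : 2 * R ≤ ‖x‖
  · have key : ∀ ν : Measure E, IsFiniteMeasure ν → ν.real Set.univ ≤ M →
        ε⁻¹ * ∫ y, min 1 (‖y‖ / R) ∂ν < δ / 2 →
        0 ≤ ∫ y, truncatedKernel ε (x - y) ∂ν ∧ ∫ y, truncatedKernel ε (x - y) ∂ν ≤ δ := by
      intro ν _ h1 h2
      refine ⟨integral_nonneg fun y => truncatedKernel_nonneg hε _, ?_⟩
      have h3 := integral_truncatedKernel_le hε hR ν hx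
      have h4 : R⁻¹ * ν.real Set.univ ≤ R⁻¹ * M := by gcongr
      linarith
    obtain ⟨h1, h2⟩ := key (μn n) inferInstance hn1 hn2
    obtain ⟨h3, h4⟩ := key μ inferInstance hM' hR1
    rw [abs_le]
    constructor <;> linarith
  · have hx' : x ∈ Metric.closedBall (0 : E) (2 * R) := by
      simpa using (not_le.1 hx).le
    obtain ⟨z, hz, hxz⟩ := Set.mem_iUnion₂.1 (htc hx')
    rw [Metric.mem_ball, dist_eq_norm] at hxz
    have key : ∀ ν : Measure E, IsFiniteMeasure ν → ν.real Set.univ ≤ M →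
        |∫ y, truncatedKernel ε (x - y) ∂ν - ∫ y, truncatedKernel ε (z - y) ∂ν| ≤ δ / 3 := by
      intro ν _ h1
      refine (abs_integral_truncatedKernel_sub_le hε ν x z).trans ?_
      rw [← hrM]
      gcongr
    have h1 := abs_le.1 (key (μn n) inferInstance hn1)
    have h2 := abs_le.1 (key μ inferInstance hM')
    have h3 := abs_lt.1 (hn3 z hz)
    rw [abs_le]
    constructor <;> linarith

end truncatedKernel

lemma sq_lintegral_le_measure_univ_mul {α : Type*} [MeasurableSpace α] (ν : Measure α)
    {h : α → ENNReal} (hh : Measurable h) :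
    (∫⁻ y, h y ∂ν) ^ 2 ≤ ν Set.univ * ∫⁻ y, h y ^ 2 ∂ν := by
  have h1 := ENNReal.lintegral_mul_le_Lp_mul_Lq ν Real.HolderConjugate.two_two hh.aemeasurable
    (aemeasurable_const (b := (1 : ENNReal)))
  simp only [Pi.mul_apply, mul_one, lintegral_const, ENNReal.rpow_two, one_pow, one_mul] at h1
  calc (∫⁻ y, h y ∂ν) ^ 2
      ≤ ((∫⁻ y, h y ^ 2 ∂ν) ^ (1 / 2 : ℝ) * ν Set.univ ^ (1 / 2 : ℝ)) ^ 2 := by gcongr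
    _ = ν Set.univ * ∫⁻ y, h y ^ 2 ∂ν := by
      rw [mul_pow, ← ENNReal.rpow_two, ← ENNReal.rpow_two, ← ENNReal.rpow_mul,
        ← ENNReal.rpow_mul]
      norm_num
      exact mul_comm _ _

lemma lintegral_sq_lintegral_sub_le {G : Type*} [AddGroup G] [MeasurableSpace G]
    [MeasurableAdd₂ G] [MeasurableSub₂ G] (ρ ν : Measure G) [SFinite ρ] [SFinite ν]
    [ρ.IsAddRightInvariant]
    {h : G → ENNReal} (hh : Measurable h) :
    ∫⁻ x, (∫⁻ y, h (x - y) ∂ν) ^ 2 ∂ρ ≤ ν Set.univ ^ 2 * ∫⁻ z, h z ^ 2 ∂ρ := by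
  have hm : Measurable fun p : G × G => h (p.1 - p.2) ^ 2 :=
    (hh.comp measurable_sub).pow_const 2
  calc ∫⁻ x, (∫⁻ y, h (x - y) ∂ν) ^ 2 ∂ρ
      ≤ ∫⁻ x, ν Set.univ * ∫⁻ y, h (x - y) ^ 2 ∂ν ∂ρ := by
        gcongr with x
        exact sq_lintegral_le_measure_univ_mul ν (hh.comp (measurable_const_sub x))
    _ = ν Set.univ * ∫⁻ y, ∫⁻ x, h (x - y) ^ 2 ∂ρ ∂ν := by
        rw [lintegral_const_mul _ hm.lintegral_prod_right',
          lintegral_lintegral_swap hm.aemeasurable]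
    _ = ν Set.univ ^ 2 * ∫⁻ z, h z ^ 2 ∂ρ := by
        simp_rw [lintegral_sub_right_eq_self (fun z => h z ^ 2)]
        rw [lintegral_const]
        ring

lemma coulomb_eq_integral (ν : Measure (EuclideanSpace ℝ (Fin 3)))
    (x : EuclideanSpace ℝ (Fin 3)) : coulomb ν x = ∫ y, ‖x - y‖⁻¹ ∂ν := by
  rw [coulomb, integral_eq_lintegral_of_nonneg_ae (ae_of_all _ fun y => by positivity)
    (by fun_prop : Measurable fun y => ‖x - y‖⁻¹).aestronglyMeasurable]

lemma enorm_coulomb_sub_le {ε : ℝ} (hε : 0 < ε) (ν : Measure (EuclideanSpace ℝ (Fin 3)))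
    [IsFiniteMeasure ν] (x : EuclideanSpace ℝ (Fin 3)) :
    ‖coulomb ν x - ∫ y, truncatedKernel ε (x - y) ∂ν‖ₑ
      ≤ ∫⁻ y, ‖‖x - y‖⁻¹ - truncatedKernel ε (x - y)‖ₑ ∂ν := by
  by_cases hfin : ∫⁻ y, ‖‖x - y‖⁻¹ - truncatedKernel ε (x - y)‖ₑ ∂ν = ⊤
  · simp [hfin]
  have hb := integrable_truncatedKernel_sub hε ν x
  have hmeas : Measurable fun y => ‖x - y‖⁻¹ := by fun_prop
  have hd : Integrable (fun y => ‖x - y‖⁻¹ - truncatedKernel ε (x - y)) ν :=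
    ⟨hmeas.aestronglyMeasurable.sub hb.aestronglyMeasurable, lt_top_iff_ne_top.2 hfin⟩
  have hi : Integrable (fun y => ‖x - y‖⁻¹) ν := by
    refine (hd.add hb).congr (ae_of_all _ fun y => ?_)
    simp
  rw [coulomb_eq_integral, ← integral_sub hi hb]
  exact enorm_integral_le_lintegral_enorm _

lemma measurable_coulomb_s6 (ν : Measure (EuclideanSpace ℝ (Fin 3))) [IsFiniteMeasure ν] :
    Measurable (coulomb ν) :=
  (Measurable.lintegral_prod_right' (ν := ν)
    (f := fun p : EuclideanSpace ℝ (Fin 3) × EuclideanSpace ℝ (Fin 3) =>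
      ENNReal.ofReal ‖p.1 - p.2‖⁻¹) (by fun_prop)).ennreal_toReal

lemma measurable_integral_truncatedKernel {ε : ℝ} (hε : 0 < ε)
    (ν : Measure (EuclideanSpace ℝ (Fin 3))) [IsFiniteMeasure ν] :
    Measurable fun x => ∫ y, truncatedKernel ε (x - y) ∂ν :=
  (StronglyMeasurable.integral_prod_right' (ν := ν)
    (f := fun p : EuclideanSpace ℝ (Fin 3) × EuclideanSpace ℝ (Fin 3) =>
      truncatedKernel ε (p.1 - p.2))
    ((continuous_truncatedKernel hε).comp continuous_sub).stronglyMeasurable).measurable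

lemma measurable_inv_norm_sub_truncatedKernel {ε : ℝ} (hε : 0 < ε) :
    Measurable fun z : EuclideanSpace ℝ (Fin 3) => ‖z‖⁻¹ - truncatedKernel ε z :=
  measurable_norm.inv.sub (continuous_truncatedKernel hε).measurable

lemma tendsto_lintegral_sq_inv_norm_sub_truncatedKernel :
    Tendsto (fun ε : ℝ => ∫⁻ z : EuclideanSpace ℝ (Fin 3),
      ‖‖z‖⁻¹ - truncatedKernel ε z‖ₑ ^ 2) (𝓝[>] 0) (𝓝 0) := by
  have hint : IntegrableOn (fun z : EuclideanSpace ℝ (Fin 3) => (‖z‖⁻¹) ^ 2)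
      (Metric.ball 0 1) := by
    rw [integrableOn_fun_norm_addHaar volume (f := fun y : ℝ => (y⁻¹) ^ 2)]
    have : IntegrableOn (fun _ : ℝ => (1 : ℝ)) (Set.Ioo 0 1) := by simp
    refine this.congr_fun (fun y hy => ?_) measurableSet_Ioo
    have := hy.1.ne'
    simp [this]
  have hne : ∀ᵐ z : EuclideanSpace ℝ (Fin 3), z ≠ 0 :=
    Measure.ae_ne volume 0
  have := tendsto_lintegral_filter_of_dominated_convergence (μ := volume) (l := 𝓝[>] (0 : ℝ))
    (F := fun ε (z : EuclideanSpace ℝ (Fin 3)) => ‖‖z‖⁻¹ - truncatedKernel ε z‖ₑ ^ 2)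
    (f := fun _ => 0)
    ((Metric.ball 0 1).indicator fun z : EuclideanSpace ℝ (Fin 3) => ‖(‖z‖⁻¹) ^ 2‖ₑ)
    (by
      filter_upwards [self_mem_nhdsWithin] with ε hε
      exact (measurable_inv_norm_sub_truncatedKernel hε).enorm.pow_const 2)
    (by
      filter_upwards [Ioc_mem_nhdsGT (zero_lt_one' ℝ)] with ε hε
      filter_upwards [hne] with z hz
      have hz' : 0 < ‖z‖ := norm_pos_iff.2 hz
      by_cases h : ‖z‖ < ε
      · rw [Set.indicator_of_mem (by simpa using h.trans_le hε.2), enorm_pow]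
        gcongr
        rw [enorm_le_iff_norm_le, Real.norm_eq_abs, Real.norm_eq_abs, abs_of_nonneg,
          abs_of_nonneg (by positivity)]
        · linarith [truncatedKernel_nonneg hε.1 z]
        · exact sub_nonneg.2 (inv_anti₀ hz' (le_max_left _ _))
      · simp [truncatedKernel, max_eq_left (not_lt.1 h)])
    (by
      rw [lintegral_indicator measurableSet_ball]
      exact hint.2.ne)
    (by
      filter_upwards [hne] with z hz
      refine tendsto_const_nhds.congr' ?_
      filter_upwards [Ioo_mem_nhdsGT (norm_pos_iff.2 hz)] with ε hε
      simp [truncatedKernel, max_eq_left hε.2.le])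
  simpa using this

lemma eLpNorm_coulomb_sub_le {ε : ℝ} (hε : 0 < ε) (ν : Measure (EuclideanSpace ℝ (Fin 3)))
    [IsFiniteMeasure ν] :
    eLpNorm (fun x => coulomb ν x - ∫ y, truncatedKernel ε (x - y) ∂ν) 2 volume
      ≤ ν Set.univ * (∫⁻ z : EuclideanSpace ℝ (Fin 3),
        ‖‖z‖⁻¹ - truncatedKernel ε z‖ₑ ^ 2) ^ (1 / 2 : ℝ) := by
  rw [eLpNorm_eq_lintegral_rpow_enorm_toReal (by norm_num) (by norm_num)]
  simp only [ENNReal.toReal_ofNat, ENNReal.rpow_two]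
  calc _ ≤ (ν Set.univ ^ 2 * ∫⁻ z : EuclideanSpace ℝ (Fin 3),
        ‖‖z‖⁻¹ - truncatedKernel ε z‖ₑ ^ 2) ^ (1 / 2 : ℝ) := by
        gcongr
        refine le_trans ?_ (lintegral_sq_lintegral_sub_le volume ν
          (measurable_inv_norm_sub_truncatedKernel hε).enorm)
        gcongr with x
        exact enorm_coulomb_sub_le hε ν x
    _ = _ := by
        rw [ENNReal.mul_rpow_of_nonneg _ _ (by norm_num), ← ENNReal.rpow_two, ← ENNReal.rpow_mul]
        norm_num

end

theorem coulomb_tendsto_of_tight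
    (μn : ℕ → Measure (EuclideanSpace ℝ (Fin 3)))
    (μ : Measure (EuclideanSpace ℝ (Fin 3)))
    (hn : ∀ n, IsFiniteMeasure (μn n)) (hμ : IsFiniteMeasure μ)
    (htight : ∀ f : EuclideanSpace ℝ (Fin 3) → ℝ, Continuous f →
      (∃ M : ℝ, ∀ x, |f x| ≤ M) →
      Tendsto (fun n => ∫ x, f x ∂(μn n)) atTop (nhds (∫ x, f x ∂μ))) :
    ∃ f g : ℕ → EuclideanSpace ℝ (Fin 3) → ℝ,
      (∀ n, Measurable (f n)) ∧ (∀ n, Measurable (g n)) ∧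
      (∀ n, ∀ᵐ x ∂(volume : Measure (EuclideanSpace ℝ (Fin 3))),
        coulomb (μn n) x - coulomb μ x = f n x + g n x) ∧
      Tendsto (fun n => eLpNorm (f n) 2 volume) atTop (nhds 0) ∧
      Tendsto (fun n => eLpNorm (g n) ⊤ volume) atTop (nhds 0) := by
  let S : ℝ → Measure (EuclideanSpace ℝ (Fin 3)) → EuclideanSpace ℝ (Fin 3) → ℝ :=
    fun ε ν x => coulomb ν x - ∫ y, truncatedKernel ε (x - y) ∂ν
  let B : ℝ → Measure (EuclideanSpace ℝ (Fin 3)) → EuclideanSpace ℝ (Fin 3) → ℝ :=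
    fun ε ν x => ∫ y, truncatedKernel ε (x - y) ∂ν
  have hB : ∀ ε, 0 < ε → ∀ ν, IsFiniteMeasure ν → Measurable (B ε ν) :=
    fun ε hε ν _ => measurable_integral_truncatedKernel hε ν
  have hS : ∀ ε, 0 < ε → ∀ ν, IsFiniteMeasure ν → Measurable (S ε ν) :=
    fun ε hε ν hν => (measurable_coulomb_s6 ν).sub (hB ε hε ν hν)
  have hmass : ∀ᶠ n in atTop, μn n Set.univ ≤ ENNReal.ofReal (μ.real Set.univ + 1) := by
    have h : Tendsto (fun n => (μn n).real Set.univ) atTop (nhds (μ.real Set.univ)) := by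
      simpa using htight (fun _ => 1) continuous_const ⟨1, by simp⟩
    filter_upwards [h.eventually (gt_mem_nhds (lt_add_one _))] with n hn'
    rw [← ofReal_measureReal]
    exact ENNReal.ofReal_le_ofReal hn'.le
  obtain ⟨k, hk⟩ := exists_tendsto_zero_of_forall_eventually_le (ι := Set.Ioi (0 : ℝ))
    (F := fun n ε => eLpNorm (S ε (μn n) - S ε μ) 2 volume
      + eLpNorm (B ε (μn n) - B ε μ) ⊤ volume) (by
    intro δ hδ
    have hδ2 : 0 < δ / 2 := ENNReal.half_pos hδ.ne'
    obtain ⟨ε, hε, hsmall⟩ : ∃ ε : ℝ, 0 < ε ∧ (ENNReal.ofReal (μ.real Set.univ + 1) + μ Set.univ) *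
        (∫⁻ z : EuclideanSpace ℝ (Fin 3), ‖‖z‖⁻¹ - truncatedKernel ε z‖ₑ ^ 2) ^ (1 / 2 : ℝ)
          ≤ δ / 2 := by
      have h1 := ENNReal.Tendsto.const_mul
        (tendsto_lintegral_sq_inv_norm_sub_truncatedKernel.ennrpow_const (1 / 2))
        (Or.inr (by finiteness : ENNReal.ofReal (μ.real Set.univ + 1) + μ Set.univ ≠ ⊤))
      rw [ENNReal.zero_rpow_of_pos (by norm_num), mul_zero] at h1
      obtain ⟨ε, h2, h3⟩ := (eventually_mem_nhdsWithin.and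
        (ENNReal.tendsto_nhds_zero.1 h1 _ hδ2)).exists
      exact ⟨ε, h2, h3⟩
    obtain ⟨d, hd, hdδ⟩ : ∃ d : ℝ, 0 < d ∧ ENNReal.ofReal d ≤ δ / 2 := by
      obtain ⟨d, hd, hdδ⟩ := ENNReal.lt_iff_exists_nnreal_btwn.1 hδ2
      exact ⟨d, by exact_mod_cast hd, by simpa using hdδ.le⟩
    refine ⟨⟨ε, hε⟩, ?_⟩
    filter_upwards [hmass, eventually_forall_abs_integral_truncatedKernel_sub_le htight hε hd]
      with n hn1 hn2
    rw [← ENNReal.add_halves δ]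
    refine add_le_add (le_trans ?_ hsmall) (le_trans ?_ hdδ)
    · refine (eLpNorm_sub_le (hS ε hε _ (hn n)).aestronglyMeasurable
        (hS ε hε _ hμ).aestronglyMeasurable (by norm_num)).trans ?_
      rw [add_mul]
      refine add_le_add ((eLpNorm_coulomb_sub_le hε (μn n)).trans ?_)
        (eLpNorm_coulomb_sub_le hε μ)
      gcongr
    · rw [eLpNorm_exponent_top]
      exact eLpNormEssSup_le_of_ae_bound (ae_of_all _ hn2))
  refine ⟨fun n => S (k n) (μn n) - S (k n) μ, fun n => B (k n) (μn n) - B (k n) μ,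
    fun n => (hS _ (k n).2 _ (hn n)).sub (hS _ (k n).2 _ hμ),
    fun n => (hB _ (k n).2 _ (hn n)).sub (hB _ (k n).2 _ hμ),
    fun n => ae_of_all _ fun x => ?_, ?_, ?_⟩
  · simp only [S, B, Pi.sub_apply]
    ring
  · exact tendsto_of_tendsto_of_tendsto_of_le_of_le tendsto_const_nhds hk
      (fun _ => zero_le) (fun _ => le_self_add)
  · exact tendsto_of_tendsto_of_tendsto_of_le_of_le tendsto_const_nhds hk
      (fun _ => zero_le) (fun _ => le_add_self)
end

section
/- (Pointwise IMS formula for the Pauli operator.) Let (J_k)_{k∈F} be a finite family of differentiable functions J_k : ℝ³ → ℝ with Σ_{k∈F} J_k(x)² = 1 for all x ∈ ℝ³, and let φ : ℝ³ → ℂ² be differentiable. Then for every x ∈ ℝ³: Σ_{k∈F} ‖(σ·∇(J_k φ))(x)‖² = ‖(σ·∇φ)(x)‖² + ‖φ(x)‖²·Σ_{k∈F} ‖∇J_k(x)‖². -/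
open MeasureTheory Real

/-- The multiplication operator `σ·g = ∑ⱼ gⱼ σⱼ` applied to a spinor `w`. -/
noncomputable def pauliSmul (g : Fin 3 → ℝ) (w : EuclideanSpace ℂ (Fin 2)) :
    EuclideanSpace ℂ (Fin 2) :=
  ∑ j : Fin 3, g j • WithLp.toLp 2 ((pauli j).mulVec w.ofLp)

theorem norm_pauliSmul_sq (g : Fin 3 → ℝ) (w : EuclideanSpace ℂ (Fin 2)) :
    ‖pauliSmul g w‖ ^ 2 = ‖w‖ ^ 2 * ∑ j : Fin 3, g j ^ 2 := by
  simp only [EuclideanSpace.norm_sq_eq, Complex.sq_norm, Complex.normSq_apply]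
  simp [pauliSmul, pauli, Fin.sum_univ_three]
  ring

theorem pauliDeriv_smul {f : EuclideanSpace ℝ (Fin 3) → ℝ}
    {φ : EuclideanSpace ℝ (Fin 3) → EuclideanSpace ℂ (Fin 2)} {x : EuclideanSpace ℝ (Fin 3)}
    (hf : DifferentiableAt ℝ f x) (hφ : DifferentiableAt ℝ φ x) :
    pauliDeriv (fun y => f y • φ y) x =
      f x • pauliDeriv φ x +
        pauliSmul (fun j => fderiv ℝ f x (EuclideanSpace.single j 1)) (φ x) := by
  simp only [pauliDeriv, pauliSmul, Finset.smul_sum, ← Finset.sum_add_distrib]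
  refine Finset.sum_congr rfl fun j _ => ?_
  rw [fderiv_fun_smul hf hφ]
  simp only [WithLp.equiv_apply, WithLp.equiv_symm_apply, add_apply, smul_apply,
    ContinuousLinearMap.smulRight_apply, WithLp.ofLp_add, WithLp.ofLp_smul, Matrix.mulVec_add,
    Matrix.mulVec_smul, WithLp.toLp_add, WithLp.toLp_smul]

theorem sum_mul_fderiv_eq_zero {E F : Type*} [NormedAddCommGroup E] [NormedSpace ℝ E] [Fintype F]
    {J : F → E → ℝ} {c : ℝ} {x : E} (hJ : ∀ k, DifferentiableAt ℝ (J k) x)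
    (hsum : ∀ y, ∑ k, J k y ^ 2 = c) (v : E) :
    ∑ k, J k x * fderiv ℝ (J k) x v = 0 := by
  have h : HasFDerivAt (fun y => ∑ k, J k y ^ 2)
      (∑ k, (2 * J k x) • fderiv ℝ (J k) x) x := by
    refine HasFDerivAt.fun_sum fun k _ => ?_
    simpa using (hJ k).hasFDerivAt.pow 2
  have h0 := h.unique ((hasFDerivAt_const c x).congr_of_eventuallyEq (.of_forall hsum))
  have hv := DFunLike.congr_fun h0 v
  simp only [sum_apply, smul_apply, smul_eq_mul, mul_assoc, ← Finset.mul_sum, zero_apply] at hv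
  linarith

theorem sum_smul_pauliSmul {F : Type*} [Fintype F] (a : F → ℝ) (g : F → Fin 3 → ℝ)
    (w : EuclideanSpace ℂ (Fin 2)) (h : ∀ j, ∑ k, a k * g k j = 0) :
    ∑ k, a k • pauliSmul (g k) w = 0 := by
  simp only [pauliSmul, Finset.smul_sum, smul_smul]
  rw [Finset.sum_comm]
  simp only [← Finset.sum_smul, h, zero_smul, Finset.sum_const_zero]

theorem pointwise_IMS_formula_pauli
    (F : Type*) [Fintype F]
    (J : F → EuclideanSpace ℝ (Fin 3) → ℝ)
    (hJdiff : ∀ k, Differentiable ℝ (J k))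
    (hpartition : ∀ x, ∑ k : F, (J k x) ^ 2 = 1)
    (φ : EuclideanSpace ℝ (Fin 3) → EuclideanSpace ℂ (Fin 2))
    (hφ : Differentiable ℝ φ) (x : EuclideanSpace ℝ (Fin 3)) :
    ∑ k : F, ‖pauliDeriv (fun y => J k y • φ y) x‖ ^ 2 =
      ‖pauliDeriv φ x‖ ^ 2 +
        ‖φ x‖ ^ 2 * ∑ k : F,
          ∑ j : Fin 3, (fderiv ℝ (J k) x (EuclideanSpace.single j 1)) ^ 2 := by
  let : InnerProductSpace ℝ (EuclideanSpace ℂ (Fin 2)) := InnerProductSpace.rclikeToReal ℂ _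
  have hcross : ∑ k, inner ℝ (J k x • pauliDeriv φ x)
      (pauliSmul (fun j => fderiv ℝ (J k) x (EuclideanSpace.single j 1)) (φ x)) = 0 := by
    simp only [real_inner_smul_left, ← real_inner_smul_right]
    rw [← inner_sum, sum_smul_pauliSmul _ _ _ fun j =>
      sum_mul_fderiv_eq_zero (fun k => hJdiff k x) hpartition _, inner_zero_right]
  simp only [pauliDeriv_smul (hJdiff _ x) (hφ x), norm_add_sq_real, Finset.sum_add_distrib,
    ← Finset.mul_sum, hcross, norm_pauliSmul_sq, norm_smul, mul_pow, Real.norm_eq_abs, sq_abs,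
    ← Finset.sum_mul, hpartition]
  ring
end
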